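/- For every constant B > 0, the maximum over integers k with 0 ≤ k ≤ B·√g of |π·e^{k²/(30g)}·C(0^k, 2^{3g−3+k}) − 1| tends to 0 as g → ∞, where (0^k, 2^{3g−3+k}) denotes the tuple consisting of k entries equal to 0 followed by 3g−3+k entries equal to 2. In other words, C(0^k,2^{3g−3+k}) ∼ (1/π)·e^{−k²/(30g)} uniformly for k = O(√g). -/

import Mathlib

open scoped BigOperators

noncomputable section

namespace WittenAsym

/-- `g(d)` as a rational number: `g(d) = 1 + (∑ⱼ dⱼ − n)/3`. -/
def gQ (l : List ℕ) : ℚ := 1 + ((l.sum : ℚ) - (l.length : ℚ)) / 3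

/-- `X(d)` as a rational number: `X(d) = (∑ⱼ (2dⱼ+1))/3 = 2g(d) − 2 + n`. -/
def XQ (l : List ℕ) : ℚ := (2 * (l.sum : ℚ) + (l.length : ℚ)) / 3

/-- `X(d)` as a natural number (the correct value whenever `X(d)` is an integer). -/
def XN (l : List ℕ) : ℕ := (2 * l.sum + l.length) / 3

/-- `g(d)` is a nonnegative integer. -/
def IntegralG (l : List ℕ) : Prop := ∃ g : ℕ, (g : ℚ) = gQ l

/-- The subtuple of `r` indexed by the finite index set `I`. -/
def select (r : List ℕ) (I : Finset (Fin r.length)) : List ℕ :=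
  ((List.finRange r.length).filter (fun i => i ∈ I)).map r.get

/-- The characterization of the normalized Witten intersection numbers
`C(d) = 2^{2g(d)} ∏ⱼ (2dⱼ+1)!! / (3^{2g(d)-2+n} (2g(d)-3+n)!) ∫ ψ₁^{d₁}⋯ψₙ^{dₙ}`:
they form the unique family of rationals, symmetric in the entries of `d`, vanishing
when `g(d)` is not a nonnegative integer, with `C(0,0,0) = 1/3`, `C(1) = 1/6`,
and satisfying the DVV recursion whenever `X(d) = 2g(d) - 2 + n ≥ 2`. -/
structure IsNormalizedWitten (C : List ℕ → ℚ) : Prop where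
  symm : ∀ {l l' : List ℕ}, l.Perm l' → C l = C l'
  init3 : C [0, 0, 0] = 1/3
  init1 : C [1] = 1/6
  vanish : ∀ l : List ℕ, ¬ IntegralG l → C l = 0
  dvv : ∀ (d₁ : ℕ) (r : List ℕ), IntegralG (d₁ :: r) → 2 ≤ XQ (d₁ :: r) →
    C (d₁ :: r) =
      (∑ j : Fin r.length,
        if 1 ≤ d₁ + r.get j then
          (2 * (r.get j : ℚ) + 1) / (3 * (XQ (d₁ :: r) - 1)) *
            C (r.set j.val (d₁ + r.get j - 1))
        else 0)
      + ∑ a ∈ Finset.range (d₁ - 1),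
          (2 / (3 * (XQ (d₁ :: r) - 1)) * C (a :: (d₁ - 2 - a) :: r)
          + ∑ I : Finset (Fin r.length),
              if 3 ∣ (2 * (a + (select r I).sum) + (1 + (select r I).length)) then
                ((XN (a :: select r I) - 1).factorial : ℚ) *
                  ((XN ((d₁ - 2 - a) :: select r Iᶜ) - 1).factorial : ℚ) /
                  (6 * ((XN (d₁ :: r) - 1).factorial : ℚ)) *
                  C (a :: select r I) * C ((d₁ - 2 - a) :: select r Iᶜ)
              else 0)

/-- `T l = ∑ (2 d + 1)`, three times the level. -/
def T (l : List ℕ) : ℕ := 2 * l.sum + l.length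

@[simp] lemma T_nil : T [] = 0 := rfl
@[simp] lemma T_cons (d : ℕ) (l : List ℕ) : T (d :: l) = 2 * d + 1 + T l := by
  simp [T]; ring
lemma T_perm {l l' : List ℕ} (h : l.Perm l') : T l = T l' := by
  simp [T, h.sum_eq, h.length_eq]
lemma T_append (l l' : List ℕ) : T (l ++ l') = T l + T l' := by
  simp [T]; ring

lemma integralG_of {l : List ℕ} {X : ℕ} (h : T l = 3 * X) (h2 : l.length ≤ l.sum + 3) :
    IntegralG l := by
  unfold T at h
  refine ⟨l.sum + 1 - X, ?_⟩
  have h3 : X ≤ l.sum + 1 := by omega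
  rw [gQ, Nat.cast_sub h3]
  have h' : (2 * (l.sum : ℚ) + l.length) = 3 * X := by exact_mod_cast h
  rw [Nat.cast_add, Nat.cast_one]
  linarith

lemma of_integralG {l : List ℕ} (h : IntegralG l) :
    ∃ X, T l = 3 * X ∧ l.length ≤ l.sum + 3 := by
  obtain ⟨g, hg⟩ := h
  rw [gQ] at hg
  have h1 : 3 * (g : ℚ) + l.length = 3 + l.sum := by linarith
  have h2 : 3 * g + l.length = 3 + l.sum := by exact_mod_cast h1
  refine ⟨l.sum + 1 - g, ?_, by omega⟩
  unfold T; omega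

/-- Sum over the entries of a list, with the remaining list. -/
def pickSum : (ℕ → List ℕ → ℝ) → List ℕ → ℝ
  | _, [] => 0
  | φ, e :: l => φ e l + pickSum (fun d l' => φ d (e :: l')) l

/-- Sum over the ways to split a list into two sublists. -/
def splitSum : (List ℕ → List ℕ → ℝ) → List ℕ → ℝ
  | ψ, [] => ψ [] []
  | ψ, e :: l => splitSum (fun I J => ψ (e :: I) J) l + splitSum (fun I J => ψ I (e :: J)) l

lemma pickSum_eq (φ : ℕ → List ℕ → ℝ) (r : List ℕ) :
    ∑ j : Fin r.length, φ (r.get j) (r.eraseIdx j.val) = pickSum φ r := by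
  induction r generalizing φ with
  | nil => simp [pickSum]
  | cons e l ih =>
    have := Fin.sum_univ_succ (n := l.length)
      (fun j : Fin (l.length + 1) => φ ((e :: l).get j) ((e :: l).eraseIdx j.val))
    refine this.trans ?_
    rw [pickSum, ← ih]
    simp

lemma sum_finset_fin_succ (n : ℕ) (f : Finset (Fin (n + 1)) → ℝ) :
    ∑ I : Finset (Fin (n + 1)), f I =
      ∑ I : Finset (Fin n), f (insert 0 (I.map (Fin.succEmb n)))
      + ∑ I : Finset (Fin n), f (I.map (Fin.succEmb n)) := by
  classical
  have h1 : (Finset.univ : Finset (Finset (Fin (n+1)))) =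
      (insert 0 ((Finset.univ : Finset (Fin n)).map (Fin.succEmb n))).powerset := by
    ext I
    simp only [Finset.mem_univ, Finset.mem_powerset, true_iff]
    intro x _
    refine Fin.cases ?_ (fun i => ?_) x
    · simp
    · simp
  rw [h1, Finset.sum_powerset_insert (by simp), add_comm]
  have h2 : ∀ F : Finset (Fin (n+1)) → ℝ,
      ∑ t ∈ ((Finset.univ : Finset (Fin n)).map (Fin.succEmb n)).powerset, F t
        = ∑ I : Finset (Fin n), F (I.map (Fin.succEmb n)) := by
    intro F
    symm
    refine Finset.sum_bij (fun I _ => I.map (Fin.succEmb n)) ?_ ?_ ?_ ?_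
    · intro I _
      rw [Finset.mem_powerset]
      exact Finset.map_subset_map.2 (Finset.subset_univ _)
    · intro I _ J _ h
      exact Finset.map_injective _ h
    · intro t ht
      rw [Finset.mem_powerset, Finset.subset_map_iff] at ht
      obtain ⟨u, _, hu⟩ := ht
      exact ⟨u, Finset.mem_univ _, hu.symm⟩
    · intros; rfl
  rw [h2, h2]

lemma select_cons_in (e : ℕ) (l : List ℕ) (I : Finset (Fin l.length)) :
    select (e :: l) (insert 0 (I.map (Fin.succEmb l.length)) : Finset (Fin (l.length+1)))
      = e :: select l I := by
  unfold select
  have : List.finRange (e :: l).length = 0 :: (List.finRange l.length).map Fin.succ :=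
    List.finRange_succ
  rw [this, List.filter_cons, List.filter_map, ]
  simp [Function.comp_def, Fin.succ_ne_zero]

lemma select_cons_out (e : ℕ) (l : List ℕ) (I : Finset (Fin l.length)) :
    select (e :: l) (I.map (Fin.succEmb l.length) : Finset (Fin (l.length+1)))
      = select l I := by
  unfold select
  have : List.finRange (e :: l).length = 0 :: (List.finRange l.length).map Fin.succ :=
    List.finRange_succ
  rw [this, List.filter_cons, List.filter_map]
  simp [Function.comp_def, Fin.succ_ne_zero]

lemma compl_in (n : ℕ) (I : Finset (Fin n)) :
    (insert 0 (I.map (Fin.succEmb n)) : Finset (Fin (n+1)))ᶜ = (Iᶜ).map (Fin.succEmb n) := by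
  ext x
  refine Fin.cases ?_ (fun i => ?_) x
  · simp [Fin.succ_ne_zero]
  · simp [Fin.succ_ne_zero]

lemma compl_out (n : ℕ) (I : Finset (Fin n)) :
    (I.map (Fin.succEmb n) : Finset (Fin (n+1)))ᶜ = insert 0 ((Iᶜ).map (Fin.succEmb n)) := by
  ext x
  refine Fin.cases ?_ (fun i => ?_) x
  · simp [Fin.succ_ne_zero]
  · simp [Fin.succ_ne_zero]

lemma splitSum_eq (ψ : List ℕ → List ℕ → ℝ) (r : List ℕ) :
    ∑ I : Finset (Fin r.length), ψ (select r I) (select r Iᶜ) = splitSum ψ r := by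
  induction r generalizing ψ with
  | nil => simp [splitSum, select]
  | cons e l ih =>
    have := sum_finset_fin_succ l.length
      (fun I => ψ (select (e :: l) I) (select (e :: l) Iᶜ))
    refine this.trans ?_
    rw [splitSum, ← ih, ← ih]
    congr 1
    · refine Finset.sum_congr rfl fun I _ => ?_
      rw [select_cons_in, compl_in, select_cons_out]
    · refine Finset.sum_congr rfl fun I _ => ?_
      rw [select_cons_out, compl_out, select_cons_in]

/-! basic lemmas on the two sums -/
lemma pickSum_le {φ φ' : ℕ → List ℕ → ℝ} {r : List ℕ}
    (h : ∀ d l, (d :: l).Perm r → φ d l ≤ φ' d l) : pickSum φ r ≤ pickSum φ' r := by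
  induction r generalizing φ φ' with
  | nil => simp [pickSum]
  | cons e l ih =>
    rw [pickSum, pickSum]
    refine add_le_add (h e l (List.Perm.refl _)) (ih fun d l' hp => h d (e :: l') ?_)
    exact (List.Perm.swap e d l').trans (hp.cons e)

lemma pickSum_congr {φ φ' : ℕ → List ℕ → ℝ} {r : List ℕ}
    (h : ∀ d l, (d :: l).Perm r → φ d l = φ' d l) : pickSum φ r = pickSum φ' r :=
  le_antisymm (pickSum_le fun d l hp => (h d l hp).le) (pickSum_le fun d l hp => (h d l hp).ge)

lemma pickSum_weight (w : ℕ → ℝ) (r : List ℕ) :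
    pickSum (fun d _ => w d) r = (r.map w).sum := by
  induction r with
  | nil => simp [pickSum]
  | cons e l ih => simp [pickSum, ih]

lemma sum_weight (r : List ℕ) : (r.map (fun d : ℕ => 2 * (d:ℝ) + 1)).sum = T r := by
  induction r with
  | nil => simp
  | cons e l ih => simp [ih]

lemma splitSum_le {φ φ' : List ℕ → List ℕ → ℝ} {r : List ℕ}
    (h : ∀ I J, (I ++ J).Perm r → φ I J ≤ φ' I J) : splitSum φ r ≤ splitSum φ' r := by
  induction r generalizing φ φ' with
  | nil => simpa [splitSum] using h [] [] (List.Perm.refl _)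
  | cons e l ih =>
    rw [splitSum, splitSum]
    refine add_le_add (ih fun I J hp => h (e :: I) J ?_) (ih fun I J hp => h I (e :: J) ?_)
    · simpa using hp
    · exact (List.perm_middle).trans (hp.cons e)

lemma splitSum_congr {φ φ' : List ℕ → List ℕ → ℝ} {r : List ℕ}
    (h : ∀ I J, (I ++ J).Perm r → φ I J = φ' I J) : splitSum φ r = splitSum φ' r :=
  le_antisymm (splitSum_le fun d l hp => (h d l hp).le) (splitSum_le fun d l hp => (h d l hp).ge)

lemma splitSum_zero (r : List ℕ) : splitSum (fun _ _ => 0) r = 0 := by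
  induction r with
  | nil => rfl
  | cons e l ih => simp [splitSum, ih]

lemma splitSum_nonneg {φ : List ℕ → List ℕ → ℝ} {r : List ℕ}
    (h : ∀ I J, (I ++ J).Perm r → 0 ≤ φ I J) : 0 ≤ splitSum φ r := by
  rw [← splitSum_zero r]; exact splitSum_le h

lemma splitSum_mul (k : ℝ) (φ : List ℕ → List ℕ → ℝ) (r : List ℕ) :
    splitSum (fun I J => k * φ I J) r = k * splitSum φ r := by
  induction r generalizing φ with
  | nil => rfl
  | cons e l ih => simp [splitSum, ih, mul_add]

/-- the quadratic term -/
def qt (C : List ℕ → ℚ) (X a b : ℕ) (I J : List ℕ) : ℝ :=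
  if 3 ∣ T (a :: I) then
    ((T (a :: I) / 3 - 1).factorial : ℝ) * ((T (b :: J) / 3 - 1).factorial : ℝ) /
      (6 * ((X - 1).factorial : ℝ)) * (C (a :: I) : ℝ) * (C (b :: J) : ℝ)
  else 0

/-- the merging term -/
def mt (C : List ℕ → ℚ) (d₁ d : ℕ) (l : List ℕ) : ℝ :=
  if 1 ≤ d₁ + d then (2 * (d:ℝ) + 1) * (C ((d₁ + d - 1) :: l) : ℝ) else 0

section Lemmas

variable {C : List ℕ → ℚ}

lemma set_perm (r : List ℕ) (j : Fin r.length) (v : ℕ) :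
    (r.set j.val v).Perm (v :: r.eraseIdx j.val) := by
  exact List.set_perm_cons_eraseIdx j.isLt v

theorem dvvR (hC : IsNormalizedWitten C) {d₁ X : ℕ} {r : List ℕ} (hT : T (d₁ :: r) = 3 * X)
    (hX : 2 ≤ X) (hl : (d₁ :: r).length ≤ (d₁ :: r).sum + 3) :
    3 * ((X:ℝ) - 1) * (C (d₁ :: r) : ℝ) = pickSum (mt C d₁) r
      + ∑ a ∈ Finset.range (d₁ - 1), (2 * (C (a :: (d₁ - 2 - a) :: r) : ℝ)
        + 3 * ((X:ℝ) - 1) * splitSum (qt C X a (d₁ - 2 - a)) r) := by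
  have hXQ : XQ (d₁ :: r) = X := by
    have h' : ((T (d₁ :: r) : ℕ) : ℚ) = 3 * X := by exact_mod_cast hT
    rw [XQ]; simp only [T] at h'; push_cast at h' ⊢; linarith
  have hXN : XN (d₁ :: r) = X := by
    rw [XN]; have := hT; unfold T at this; omega
  have h := hC.dvv d₁ r (integralG_of hT hl) (by rw [hXQ]; exact_mod_cast hX)
  rw [hXQ, hXN] at h
  have h2 := congrArg (fun q : ℚ => (q : ℝ)) h
  beta_reduce at h2
  have hX1 : (0:ℝ) < (X:ℝ) - 1 := by
    have : (2:ℝ) ≤ X := by exact_mod_cast hX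
    linarith
  rw [h2, ← pickSum_eq]
  push_cast
  rw [mul_add, Finset.mul_sum, Finset.mul_sum]
  congr 1
  · refine Finset.sum_congr rfl fun j _ => ?_
    rw [mt]
    rw [hC.symm (set_perm r j _)]
    split_ifs with h1
    · push_cast; field_simp
    · simp
  · refine Finset.sum_congr rfl fun a _ => ?_
    rw [mul_add]
    congr 1
    · field_simp
    · rw [← splitSum_eq]
      congr 1
      refine Finset.sum_congr rfl fun I _ => ?_
      rw [qt]
      have e1 : 2 * (a + (select r I).sum) + (1 + (select r I).length) = T (a :: select r I) := by
        simp [T]; ring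
      rw [e1]
      have e2 : ∀ l, XN l = T l / 3 := fun l => rfl
      simp only [e2]
      split_ifs with h1
      · push_cast; rfl
      · simp

lemma C_not_dvd (hC : IsNormalizedWitten C) {l : List ℕ} (h : ¬ 3 ∣ T l) : C l = 0 := by
  apply hC.vanish
  intro hI
  obtain ⟨X, hX, _⟩ := of_integralG hI
  exact h ⟨X, hX⟩

lemma C_genus (hC : IsNormalizedWitten C) {l : List ℕ} (h : l.sum + 3 < l.length) : C l = 0 := by
  apply hC.vanish
  intro hI
  obtain ⟨X, _, hX⟩ := of_integralG hI
  omega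

lemma pickSum_zero (r : List ℕ) : pickSum (fun _ _ => 0) r = 0 := by
  rw [pickSum_weight (fun _ => 0)]; simp

lemma pickSum_nonneg {φ : ℕ → List ℕ → ℝ} {r : List ℕ}
    (h : ∀ d l, (d :: l).Perm r → 0 ≤ φ d l) : 0 ≤ pickSum φ r := by
  rw [← pickSum_zero r]; exact pickSum_le h

lemma pickSum_mul (k : ℝ) (φ : ℕ → List ℕ → ℝ) (r : List ℕ) :
    pickSum (fun d l => k * φ d l) r = k * pickSum φ r := by
  induction r generalizing φ with
  | nil => simp [pickSum]
  | cons e l ih => simp [pickSum, ih, mul_add]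

lemma pickSum_add (φ ψ : ℕ → List ℕ → ℝ) (r : List ℕ) :
    pickSum (fun d l => φ d l + ψ d l) r = pickSum φ r + pickSum ψ r := by
  induction r generalizing φ ψ with
  | nil => simp [pickSum]
  | cons e l ih => simp [pickSum, ih]; ring

/-- DVV without the genus condition. -/
theorem dvvU (hC : IsNormalizedWitten C) {d₁ X : ℕ} {r : List ℕ} (hT : T (d₁ :: r) = 3 * X)
    (hX : 2 ≤ X) :
    3 * ((X:ℝ) - 1) * (C (d₁ :: r) : ℝ) = pickSum (mt C d₁) r
      + ∑ a ∈ Finset.range (d₁ - 1), (2 * (C (a :: (d₁ - 2 - a) :: r) : ℝ)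
        + 3 * ((X:ℝ) - 1) * splitSum (qt C X a (d₁ - 2 - a)) r) := by
  by_cases hl : (d₁ :: r).length ≤ (d₁ :: r).sum + 3
  · exact dvvR hC hT hX hl
  · push Not at hl
    have e1 : pickSum (mt C d₁) r = 0 := by
      rw [← pickSum_zero r]
      refine pickSum_congr fun d l hp => ?_
      rw [mt]
      split_ifs with h
      · rw [C_genus hC]
        · simp
        · have := hp.length_eq
          have := hp.sum_eq
          simp only [List.length_cons, List.sum_cons] at *
          omega
      · rfl
    rw [e1, C_genus hC hl]
    symm
    simp only [Rat.cast_zero, mul_zero, zero_add]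
    refine Finset.sum_eq_zero fun a ha => ?_
    rw [Finset.mem_range] at ha
    rw [C_genus hC]
    · have e2 : splitSum (qt C X a (d₁ - 2 - a)) r = 0 := by
        rw [← splitSum_zero r]
        refine splitSum_congr fun I J hp => ?_
        rw [qt]
        split_ifs with h
        · have h1 := hp.length_eq
          have h2 := hp.sum_eq
          simp only [List.length_cons, List.sum_cons, List.length_append, List.sum_append] at *
          by_cases h3 : (a :: I).sum + 3 < (a :: I).length
          · rw [C_genus hC h3]; simp
          · rw [C_genus hC (l := (d₁ - 2 - a) :: J)]
            · simp
            · simp only [List.length_cons, List.sum_cons] at *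
              omega
        · rfl
      rw [e2]; simp
    · simp only [List.length_cons, List.sum_cons] at *
      omega

lemma T_pos {s : List ℕ} (h : s ≠ []) : 0 < T s := by
  cases s with
  | nil => simp at h
  | cons d l => simp

lemma T_eq_zero {s : List ℕ} (h : T s = 0) : s = [] := by
  by_contra h'
  have := T_pos h'
  omega

lemma T_eq_three {s : List ℕ} (h : T s = 3) : s = [1] ∨ s = [0,0,0] := by
  rcases s with _ | ⟨d, _ | ⟨e, _ | ⟨f, r⟩⟩⟩
  · simp at h
  · simp at h; left; simp; omega
  · simp at h; omega
  · simp at h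
    right
    have : T r = 0 := by omega
    rw [T_eq_zero this]
    simp; omega

lemma mt_nonneg {d₁ d : ℕ} {l : List ℕ} (h : 1 ≤ d₁ + d → (0:ℝ) ≤ C ((d₁ + d - 1) :: l)) :
    0 ≤ mt C d₁ d l := by
  rw [mt]; split_ifs with h1
  · have := h h1; positivity
  · rfl

lemma C_nonneg (hC : IsNormalizedWitten C) : ∀ (N : ℕ) (s : List ℕ), T s ≤ N → s ≠ [] →
    (0:ℝ) ≤ C s := by
  intro N
  induction N with
  | zero =>
    intro s h hs
    have := T_pos hs; omega
  | succ N ih =>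
    intro s h hs
    by_cases h3 : 3 ∣ T s
    · obtain ⟨X, hX⟩ := h3
      by_cases hX2 : 2 ≤ X
      · rcases s with _ | ⟨d₁, r⟩
        · simp at hs
        have hd := dvvU hC hX hX2
        have hX1 : (0:ℝ) < 3 * ((X:ℝ) - 1) := by
          have : (2:ℝ) ≤ X := by exact_mod_cast hX2
          linarith
        suffices h0 : 0 ≤ 3 * ((X:ℝ) - 1) * (C (d₁ :: r) : ℝ) from
          nonneg_of_mul_nonneg_right h0 hX1
        rw [hd]
        rw [T_cons] at h
        refine add_nonneg (pickSum_nonneg fun d l hp => mt_nonneg fun h1 => ?_)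
          (Finset.sum_nonneg fun a ha => ?_)
        · refine ih _ ?_ (by simp)
          have := T_perm hp
          simp only [T_cons] at *
          omega
        · rw [Finset.mem_range] at ha
          refine add_nonneg (mul_nonneg zero_le_two (ih _ ?_ (by simp)))
            (mul_nonneg hX1.le (splitSum_nonneg fun I J hp => ?_))
          · simp only [T_cons] at *; omega
          · rw [qt]
            split_ifs with h3
            · have := T_perm hp
              rw [T_append] at this
              have e1 : (0:ℝ) ≤ C (a :: I) := ih _ (by rw [T_cons]; omega) (by simp)
              have e2 : (0:ℝ) ≤ C ((d₁ - 2 - a) :: J) := ih _ (by rw [T_cons]; omega) (by simp)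
              positivity
            · rfl
      · have hp := T_pos hs
        have : T s = 3 := by omega
        rcases T_eq_three this with rfl | rfl
        · rw [hC.init1]; norm_num
        · rw [hC.init3]; norm_num
    · rw [C_not_dvd hC h3]; simp

lemma C_nn (hC : IsNormalizedWitten C) (d : ℕ) (l : List ℕ) : (0:ℝ) ≤ C (d :: l) :=
  C_nonneg hC _ _ le_rfl (by simp)

lemma C_nn' (hC : IsNormalizedWitten C) {s : List ℕ} (h : s ≠ []) : (0:ℝ) ≤ C s :=
  C_nonneg hC _ _ le_rfl h

lemma C_perm (hC : IsNormalizedWitten C) {s t : List ℕ} (h : s.Perm t) : (C s : ℝ) = C t := by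
  rw [hC.symm h]

lemma qt_nonneg (hC : IsNormalizedWitten C) (X a b : ℕ) (I J : List ℕ) : 0 ≤ qt C X a b I J := by
  rw [qt]
  split_ifs
  · have := C_nn hC a I
    have := C_nn hC b J
    positivity
  · rfl

lemma dilaton (hC : IsNormalizedWitten C) {r : List ℕ} (h : r ≠ []) : C (1 :: r) = C r := by
  by_cases h3 : 3 ∣ T (1 :: r)
  · obtain ⟨X, hX⟩ := h3
    have hp := T_pos h
    have hX' := hX
    rw [T_cons] at hX'
    have hX2 : 2 ≤ X := by omega
    have hd := dvvU hC hX hX2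
    simp only [Nat.sub_self, Finset.range_zero, Finset.sum_empty, add_zero] at hd
    have e : pickSum (mt C 1) r = pickSum (fun d _ => (C r : ℝ) * (2 * (d:ℝ) + 1)) r := by
      refine pickSum_congr fun d l hp => ?_
      rw [mt, if_pos (by omega), show 1 + d - 1 = d by omega, C_perm hC hp]
      ring
    rw [e, pickSum_weight (fun d : ℕ => (C r : ℝ) * (2 * (d:ℝ) + 1)),
      List.sum_map_mul_left, sum_weight] at hd
    have h1 : (T r : ℝ) = 3 * ((X:ℝ) - 1) := by
      have : ((2 * 1 + 1 + T r : ℕ):ℝ) = ((3 * X : ℕ) : ℝ) := by rw [hX']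
      push_cast at this; linarith
    have hX1 : (0:ℝ) < 3 * ((X:ℝ) - 1) := by
      have : (2:ℝ) ≤ X := by exact_mod_cast hX2
      linarith
    rw [h1, mul_comm] at hd
    have := mul_right_cancel₀ hX1.ne' hd
    exact_mod_cast this
  · have : ¬ 3 ∣ T r := by rw [T_cons] at h3; omega
    rw [C_not_dvd hC h3, C_not_dvd hC this]

lemma string_eq (hC : IsNormalizedWitten C) {X : ℕ} {r : List ℕ} (hT : T (0 :: r) = 3 * X)
    (hX : 2 ≤ X) :
    3 * ((X:ℝ) - 1) * (C (0 :: r) : ℝ) = pickSum (mt C 0) r := by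
  have := dvvU hC hT hX
  simpa using this

lemma exists_min {s : List ℕ} (h : s ≠ []) : ∃ d r, (d :: r).Perm s ∧ ∀ e ∈ r, d ≤ e := by
  induction s with
  | nil => simp at h
  | cons d l ih =>
    by_cases hl : l = []
    · subst hl; exact ⟨d, [], List.Perm.refl _, by simp⟩
    · obtain ⟨e, r, hp, hm⟩ := ih hl
      by_cases hde : d ≤ e
      · refine ⟨d, l, List.Perm.refl _, fun x hx => ?_⟩
        have := hp.symm.subset hx
        rcases List.mem_cons.1 this with rfl | h'
        · exact hde
        · exact hde.trans (hm _ h')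
      · refine ⟨e, d :: r, (List.Perm.swap d e r).trans (hp.cons d), fun x hx => ?_⟩
        rcases List.mem_cons.1 hx with rfl | h'
        · omega
        · exact hm _ h'

/-- The averaging functional. -/
def W : ℕ → (List ℕ → ℝ) → ℝ
  | 0, F => F []
  | N + 1, F => 2 / ((N:ℝ) + 1) * ∑ d ∈ Finset.range (N / 2 + 1), W (N - 2 * d) (fun l => F (d :: l))
termination_by N => N
decreasing_by omega

lemma W_zero (F : List ℕ → ℝ) : W 0 F = F [] := by rw [W]

lemma W_rec (N : ℕ) (F : List ℕ → ℝ) :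
    (N:ℝ) * W N F = 2 * ∑ d ∈ Finset.range ((N + 1) / 2), W (N - 2 * d - 1) (fun l => F (d :: l)) := by
  cases N with
  | zero => simp
  | succ N =>
    rw [W]
    have h : ((N:ℝ) + 1) ≠ 0 := by positivity
    rw [show (N + 1 + 1) / 2 = N / 2 + 1 by omega]
    push_cast
    rw [← mul_assoc, mul_div_cancel₀ _ h]
    congr 1
    refine Finset.sum_congr rfl fun d hd => ?_
    rw [show N + 1 - 2 * d - 1 = N - 2 * d by omega]

lemma W_eq_of_mul {N : ℕ} (hN : 0 < N) {x y : ℝ} (h : (N:ℝ) * x = N * y) : x = y := by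
  have : (N:ℝ) ≠ 0 := by positivity
  exact mul_left_cancel₀ this h

lemma W_mono {N : ℕ} {F G : List ℕ → ℝ} (h : ∀ l, T l = N → F l ≤ G l) : W N F ≤ W N G := by
  induction N using Nat.strong_induction_on generalizing F G with
  | _ N ih =>
    rcases Nat.eq_zero_or_pos N with rfl | hN
    · rw [W_zero, W_zero]; exact h [] rfl
    · have hN' : (0:ℝ) < N := by exact_mod_cast hN
      refine le_of_mul_le_mul_left ?_ hN'
      rw [W_rec, W_rec]
      refine mul_le_mul_of_nonneg_left (Finset.sum_le_sum fun d hd => ?_) zero_le_two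
      rw [Finset.mem_range] at hd
      refine ih _ (by omega) fun l hl => h _ ?_
      rw [T_cons]; omega

lemma W_congr {N : ℕ} {F G : List ℕ → ℝ} (h : ∀ l, T l = N → F l = G l) : W N F = W N G :=
  le_antisymm (W_mono fun l hl => (h l hl).le) (W_mono fun l hl => (h l hl).ge)

lemma W_add (N : ℕ) (F G : List ℕ → ℝ) : W N (fun l => F l + G l) = W N F + W N G := by
  induction N using Nat.strong_induction_on generalizing F G with
  | _ N ih =>
    rcases Nat.eq_zero_or_pos N with rfl | hN
    · simp [W_zero]
    · refine W_eq_of_mul hN ?_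
      rw [mul_add, W_rec, W_rec, W_rec, ← mul_add, ← Finset.sum_add_distrib]
      congr 1
      refine Finset.sum_congr rfl fun d hd => ?_
      exact ih _ (by omega) _ _

lemma W_mul (N : ℕ) (k : ℝ) (F : List ℕ → ℝ) : W N (fun l => k * F l) = k * W N F := by
  induction N using Nat.strong_induction_on generalizing F with
  | _ N ih =>
    rcases Nat.eq_zero_or_pos N with rfl | hN
    · simp [W_zero]
    · refine W_eq_of_mul hN ?_
      rw [mul_left_comm, W_rec, W_rec, mul_left_comm k, Finset.mul_sum _ _ k]
      rw [Finset.sum_congr rfl (g := fun d => k * W (N - 2 * d - 1) (fun l => F (d :: l)))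
        (fun d _ => ih _ (by omega) _)]

lemma W_sum {ι : Type*} (N : ℕ) (s : Finset ι) (F : ι → List ℕ → ℝ) :
    W N (fun l => ∑ i ∈ s, F i l) = ∑ i ∈ s, W N (F i) := by
  classical
  induction s using Finset.induction_on with
  | empty =>
    simp only [Finset.sum_empty]
    have := W_mul N 0 (fun _ => 0)
    simpa using this
  | insert a s ha ih =>
    rw [Finset.sum_insert ha, ← ih, ← W_add]
    exact W_congr fun l _ => Finset.sum_insert ha

lemma W_one {N : ℕ} (hN : 0 < N) : W N (fun _ => 1) = 2 := by
  induction N using Nat.strong_induction_on with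
  | _ N ih =>
    refine W_eq_of_mul hN ?_
    rw [W_rec]
    rcases Nat.even_or_odd' N with ⟨k, rfl | rfl⟩
    · rw [Finset.sum_congr rfl (g := fun _ => (2:ℝ))]
      · rw [show (2 * k + 1) / 2 = k by omega]
        simp; ring
      · intro d hd
        rw [Finset.mem_range] at hd
        exact ih _ (by omega) (by omega)
    · rw [show (2 * k + 1 + 1) / 2 = k + 1 by omega, Finset.sum_range_succ,
        Finset.sum_congr rfl (g := fun _ => (2:ℝ))]
      · rw [show 2 * k + 1 - 2 * k - 1 = 0 by omega, W_zero]
        simp; ring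
      · intro d hd
        rw [Finset.mem_range] at hd
        exact ih _ (by omega) (by omega)

/-- triangular reindexing -/
lemma tri_sum (N : ℕ) (f : ℕ → ℕ → ℝ) :
    ∑ d ∈ Finset.range ((N + 1) / 2), ∑ e ∈ Finset.range ((N - 2 * d - 1 + 1) / 2), f d e
      = ∑ m ∈ Finset.range (N / 2), ∑ k ∈ Finset.range (m + 1), f k (m - k) := by
  rw [Finset.sum_range_diag_flip]
  have h1 : ∀ d ∈ Finset.range ((N + 1) / 2),
      ∑ e ∈ Finset.range ((N - 2 * d - 1 + 1) / 2), f d e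
        = ∑ e ∈ Finset.range (N / 2 - d), f d e := by
    intro d hd
    rw [Finset.mem_range] at hd
    rw [show (N - 2 * d - 1 + 1) / 2 = N / 2 - d by omega]
  rw [Finset.sum_congr rfl h1]
  symm
  refine Finset.sum_subset ?_ ?_
  · intro x hx; rw [Finset.mem_range] at *; omega
  · intro x hx hx'
    rw [Finset.mem_range] at *
    rw [show N / 2 - x = 0 by omega]; simp

lemma tri_comm (N : ℕ) (f : ℕ → ℕ → ℝ) :
    ∑ d ∈ Finset.range ((N + 1) / 2), ∑ e ∈ Finset.range ((N - 2 * d - 1 + 1) / 2), f d e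
      = ∑ d ∈ Finset.range ((N + 1) / 2), ∑ e ∈ Finset.range ((N - 2 * d - 1 + 1) / 2), f e d := by
  rw [tri_sum, tri_sum N (fun d e => f e d)]
  refine Finset.sum_congr rfl fun m _ => ?_
  rw [← Finset.sum_range_reflect]
  refine Finset.sum_congr rfl fun k hk => ?_
  rw [Finset.mem_range] at hk
  rw [show m + 1 - 1 - k = m - k by omega, show m - (m - k) = k by omega]

theorem mecke (N : ℕ) (φ : ℕ → List ℕ → ℝ) :
    W N (pickSum φ) = ∑ d ∈ Finset.range ((N + 1) / 2),
      2 / (2 * (d:ℝ) + 1) * W (N - 2 * d - 1) (φ d) := by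
  induction N using Nat.strong_induction_on generalizing φ with
  | _ N ih =>
    rcases Nat.eq_zero_or_pos N with rfl | hN
    · simp [W_zero, pickSum]
    refine W_eq_of_mul hN ?_
    rw [W_rec]
    have h1 : ∀ e ∈ Finset.range ((N + 1) / 2),
        W (N - 2 * e - 1) (fun l => pickSum φ (e :: l)) =
          W (N - 2 * e - 1) (φ e) + ∑ d ∈ Finset.range ((N - 2 * e - 1 + 1) / 2),
            2 / (2 * (d:ℝ) + 1) * W (N - 2 * e - 1 - 2 * d - 1) (fun l => φ d (e :: l)) := by
      intro e he
      rw [Finset.mem_range] at he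
      rw [← ih _ (by omega), ← W_add]
      rfl
    rw [Finset.sum_congr rfl h1, Finset.sum_add_distrib, tri_comm, ← Finset.sum_add_distrib,
      Finset.mul_sum, Finset.mul_sum]
    refine Finset.sum_congr rfl fun d hd => ?_
    rw [Finset.mem_range] at hd
    have h2 := W_rec (N - 2 * d - 1) (φ d)
    have h3 : ∑ e ∈ Finset.range ((N - 2 * d - 1 + 1) / 2),
        2 / (2 * (d:ℝ) + 1) * W (N - 2 * e - 1 - 2 * d - 1) (fun l => φ d (e :: l))
        = 2 / (2 * (d:ℝ) + 1) * ∑ e ∈ Finset.range ((N - 2 * d - 1 + 1) / 2),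
          W (N - 2 * d - 1 - 2 * e - 1) (fun l => φ d (e :: l)) := by
      rw [Finset.mul_sum]
      refine Finset.sum_congr rfl fun e he => ?_
      rw [show N - 2 * e - 1 - 2 * d - 1 = N - 2 * d - 1 - 2 * e - 1 by omega]
    rw [h3]
    have h4 : ((N - 2 * d - 1 : ℕ) : ℝ) = N - 2 * d - 1 := by
      rw [Nat.sub_sub, Nat.cast_sub (by omega)]; push_cast; ring
    rw [h4] at h2
    have h5 : (2 * (d:ℝ) + 1) ≠ 0 := by positivity
    field_simp
    linarith

lemma anti_shift (N : ℕ) (G : ℕ → ℕ → ℕ → ℝ) :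
    ∑ p ∈ Finset.HasAntidiagonal.antidiagonal N, ∑ a ∈ Finset.range ((p.1 + 1) / 2), G a (p.1 - 2 * a - 1) p.2
      = ∑ a ∈ Finset.range ((N + 1) / 2), ∑ p ∈ Finset.HasAntidiagonal.antidiagonal (N - 2 * a - 1), G a p.1 p.2 := by
  rw [Finset.sum_sigma', Finset.sum_sigma']
  refine Finset.sum_nbij' (fun x => ⟨x.2, (x.1.1 - 2 * x.2 - 1, x.1.2)⟩)
    (fun y => ⟨(y.2.1 + 2 * y.1 + 1, y.2.2), y.1⟩) ?_ ?_ ?_ ?_ ?_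
  · rintro ⟨⟨P, R⟩, a⟩ h
    simp only [Finset.mem_sigma, Finset.HasAntidiagonal.mem_antidiagonal, Finset.mem_range] at *
    omega
  · rintro ⟨a, ⟨P, R⟩⟩ h
    simp only [Finset.mem_sigma, Finset.HasAntidiagonal.mem_antidiagonal, Finset.mem_range] at *
    omega
  · rintro ⟨⟨P, R⟩, a⟩ h
    simp only [Finset.mem_sigma, Finset.HasAntidiagonal.mem_antidiagonal, Finset.mem_range] at *
    simp only [Sigma.mk.injEq, Prod.mk.injEq, and_true, heq_eq_eq]
    omega
  · rintro ⟨a, ⟨P, R⟩⟩ h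
    simp only [Finset.mem_sigma, Finset.HasAntidiagonal.mem_antidiagonal, Finset.mem_range] at *
    have : P + 2 * a + 1 - 2 * a - 1 = P := by omega
    simp only [this]
  · rintro ⟨⟨P, R⟩, a⟩ h
    rfl

lemma anti_shift' (N : ℕ) (G : ℕ → ℕ → ℕ → ℝ) :
    ∑ p ∈ Finset.HasAntidiagonal.antidiagonal N, ∑ a ∈ Finset.range ((p.2 + 1) / 2), G a p.1 (p.2 - 2 * a - 1)
      = ∑ a ∈ Finset.range ((N + 1) / 2), ∑ p ∈ Finset.HasAntidiagonal.antidiagonal (N - 2 * a - 1), G a p.1 p.2 := by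
  have := anti_shift N (fun a x y => G a y x)
  rw [← Finset.Nat.sum_antidiagonal_swap]
  refine this.trans (Finset.sum_congr rfl fun a _ => ?_)
  rw [← Finset.Nat.sum_antidiagonal_swap]
  rfl

theorem W_split (N : ℕ) (ψ : List ℕ → List ℕ → ℝ) :
    W N (splitSum ψ) = ∑ p ∈ Finset.HasAntidiagonal.antidiagonal N, W p.1 (fun I => W p.2 (fun J => ψ I J)) := by
  induction N using Nat.strong_induction_on generalizing ψ with
  | _ N ih =>
    rcases Nat.eq_zero_or_pos N with rfl | hN
    · simp [W_zero, splitSum]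
    refine W_eq_of_mul hN ?_
    rw [W_rec]
    have h1 : ∀ e ∈ Finset.range ((N + 1) / 2),
        W (N - 2 * e - 1) (fun l => splitSum ψ (e :: l)) =
          (∑ p ∈ Finset.HasAntidiagonal.antidiagonal (N - 2 * e - 1),
            W p.1 (fun I => W p.2 (fun J => ψ (e :: I) J)))
          + ∑ p ∈ Finset.HasAntidiagonal.antidiagonal (N - 2 * e - 1),
            W p.1 (fun I => W p.2 (fun J => ψ I (e :: J))) := by
      intro e he
      rw [Finset.mem_range] at he
      rw [← ih _ (by omega), ← ih _ (by omega), ← W_add]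
      rfl
    rw [Finset.sum_congr rfl h1, Finset.sum_add_distrib,
      ← anti_shift N (fun e x y => W x (fun I => W y (fun J => ψ (e :: I) J))),
      ← anti_shift' N (fun e x y => W x (fun I => W y (fun J => ψ I (e :: J)))),
      ← Finset.sum_add_distrib, Finset.mul_sum, Finset.mul_sum]
    refine Finset.sum_congr rfl fun p hp => ?_
    rw [Finset.HasAntidiagonal.mem_antidiagonal] at hp
    have e1 := W_rec p.1 (fun I => W p.2 (fun J => ψ I J))
    have e2 : (p.2:ℝ) * W p.1 (fun I => W p.2 (fun J => ψ I J)) =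
        2 * ∑ a ∈ Finset.range ((p.2 + 1) / 2),
          W p.1 (fun I => W (p.2 - 2 * a - 1) (fun J => ψ I (a :: J))) := by
      rw [← W_mul, ← W_sum, ← W_mul]
      exact W_congr fun I _ => W_rec _ _
    rw [mul_add, ← e1, ← e2, ← add_mul, ← Nat.cast_add, hp]

/-- the average of `C` -/
def wA (C : List ℕ → ℚ) (N : ℕ) : ℝ := W N (fun l => (C l : ℝ))

/-- coefficient of the quadratic term -/
def qc (X P R : ℕ) : ℝ :=
  if 3 ∣ P then ((P / 3 - 1).factorial : ℝ) * ((R / 3 - 1).factorial : ℝ) /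
      (6 * ((X - 1).factorial : ℝ)) else 0

lemma qt_eq (C : List ℕ → ℚ) (X a b : ℕ) (I J : List ℕ) :
    qt C X a b I J = qc X (T (a :: I)) (T (b :: J)) * ((C (a :: I) : ℝ) * C (b :: J)) := by
  rw [qt, qc]; split_ifs <;> ring

lemma merge_avg (C : List ℕ → ℚ) {N : ℕ} (hN : 3 ≤ N) :
    ∑ d ∈ Finset.range ((N + 1) / 2), W (N - 2 * d - 1) (pickSum (mt C d)) =
      ∑ f ∈ Finset.range ((N - 3 + 1) / 2), 2 * ((f:ℝ) + 2) *
        W (N - 3 - 2 * f - 1) (fun l => (C (f :: l) : ℝ)) := by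
  have h1 : ∀ d ∈ Finset.range ((N + 1) / 2), W (N - 2 * d - 1) (pickSum (mt C d)) =
      ∑ e ∈ Finset.range ((N - 2 * d - 1 + 1) / 2),
        if 1 ≤ d + e then 2 * W (N - 2 * (d + e) - 2) (fun l => (C ((d + e - 1) :: l) : ℝ)) else 0 := by
    intro d hd
    rw [mecke]
    refine Finset.sum_congr rfl fun e he => ?_
    by_cases h : 1 ≤ d + e
    · rw [if_pos h]
      have : mt C d e = fun l => (2 * (e:ℝ) + 1) * (C ((d + e - 1) :: l) : ℝ) := by
        funext l; rw [mt, if_pos h]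
      rw [this, W_mul, show N - 2 * d - 1 - 2 * e - 1 = N - 2 * (d + e) - 2 by omega]
      have : (2 * (e:ℝ) + 1) ≠ 0 := by positivity
      field_simp
    · rw [if_neg h]
      have : mt C d e = fun l => 0 * (0:ℝ) := by
        funext l; rw [mt, if_neg h]; simp
      rw [this, W_mul]; simp
  rw [Finset.sum_congr rfl h1, tri_sum N (fun d e => if 1 ≤ d + e then
    2 * W (N - 2 * (d + e) - 2) (fun l => (C ((d + e - 1) :: l) : ℝ)) else 0)]
  have h2 : ∀ m ∈ Finset.range (N / 2), (∑ k ∈ Finset.range (m + 1), if 1 ≤ k + (m - k) then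
    2 * W (N - 2 * (k + (m - k)) - 2) (fun l => (C ((k + (m - k) - 1) :: l) : ℝ)) else 0)
      = if 1 ≤ m then 2 * ((m:ℝ) + 1) * W (N - 2 * m - 2) (fun l => (C ((m - 1) :: l) : ℝ)) else 0 := by
    intro m hm
    rw [Finset.sum_congr rfl (g := fun _ => if 1 ≤ m then
      2 * W (N - 2 * m - 2) (fun l => (C ((m - 1) :: l) : ℝ)) else 0)]
    · rw [Finset.sum_const, Finset.card_range]
      split_ifs
      · simp; ring
      · simp
    · intro k hk
      rw [Finset.mem_range] at hk
      rw [show k + (m - k) = m by omega]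
  rw [Finset.sum_congr rfl h2]
  obtain ⟨n, hn⟩ : ∃ n, N / 2 = n + 1 := ⟨N / 2 - 1, by omega⟩
  rw [hn, Finset.sum_range_succ', show (N - 3 + 1) / 2 = n by omega]
  simp only [Nat.le_add_left, if_true, Nat.add_sub_cancel]
  rw [if_neg (by omega), add_zero]
  refine Finset.sum_congr rfl fun f hf => ?_
  rw [show N - 2 * (f + 1) - 2 = N - 3 - 2 * f - 1 by omega]
  push_cast; ring

lemma split_reindex {N : ℕ} (hN : 4 ≤ N) (f : ℕ → ℕ → ℕ → ℝ) :
    ∑ d ∈ Finset.range ((N + 1) / 2), ∑ a ∈ Finset.range (d - 1), f (N - 2 * d - 1) a (d - 2 - a)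
      = ∑ a ∈ Finset.range ((N - 3 + 1) / 2),
        ∑ b ∈ Finset.range ((N - 3 - 2 * a - 1 + 1) / 2), f (N - 3 - 2 * a - 1 - 2 * b - 1) a b := by
  rw [tri_sum (N - 3) (fun a b => f (N - 3 - 2 * a - 1 - 2 * b - 1) a b)]
  obtain ⟨n, hn⟩ : ∃ n, (N + 1) / 2 = n + 1 + 1 := ⟨(N + 1) / 2 - 2, by omega⟩
  rw [hn, Finset.sum_range_succ', Finset.sum_range_succ', show (N - 3) / 2 = n by omega]
  simp only [Nat.add_sub_cancel, zero_add, Nat.sub_self, Nat.zero_sub, Finset.range_zero,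
    Finset.sum_empty, add_zero]
  refine Finset.sum_congr rfl fun m hm => Finset.sum_congr rfl fun a ha => ?_
  rw [Finset.mem_range] at *
  rw [show m + 1 + 1 - 2 - a = m - a by omega,
    show N - 3 - 2 * a - 1 - 2 * (m - a) - 1 = N - 2 * (m + 1 + 1) - 1 by omega]

lemma split_avg (C : List ℕ → ℚ) {N : ℕ} (hN : 4 ≤ N) :
    ∑ d ∈ Finset.range ((N + 1) / 2), ∑ a ∈ Finset.range (d - 1),
        W (N - 2 * d - 1) (fun l => (C (a :: (d - 2 - a) :: l) : ℝ)) =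
      ∑ f ∈ Finset.range ((N - 3 + 1) / 2), (((N - 3 - 2 * f - 1 : ℕ) : ℝ) / 2) *
        W (N - 3 - 2 * f - 1) (fun l => (C (f :: l) : ℝ)) := by
  rw [split_reindex hN (fun n a b => W n (fun l => (C (a :: b :: l) : ℝ)))]
  refine Finset.sum_congr rfl fun f hf => ?_
  have := W_rec (N - 3 - 2 * f - 1) (fun l => (C (f :: l) : ℝ))
  linarith

lemma W_prod (n m : ℕ) (k : ℝ) (F G : List ℕ → ℝ) :
    W n (fun I => W m (fun J => k * (F I * G J))) = k * (W n F * W m G) := by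
  have h1 : ∀ I, W m (fun J => k * (F I * G J)) = (k * W m G) * F I := by
    intro I
    rw [W_mul, W_mul]; ring
  simp only [h1]
  rw [W_mul]; ring

lemma half_rec (C : List ℕ → ℚ) (p : ℕ) : (p:ℝ) / 2 * wA C p =
    ∑ d ∈ Finset.range ((p + 1) / 2), W (p - 2 * d - 1) (fun l => (C (d :: l) : ℝ)) := by
  have e1 := W_rec p (fun l => (C l : ℝ))
  rw [wA]; linarith

lemma quad_avg (C : List ℕ → ℚ) {N X : ℕ} (hN : 4 ≤ N) :
    ∑ d ∈ Finset.range ((N + 1) / 2), ∑ a ∈ Finset.range (d - 1),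
        W (N - 2 * d - 1) (splitSum (qt C X a (d - 2 - a))) =
      ∑ p ∈ Finset.HasAntidiagonal.antidiagonal (N - 3), qc X p.1 p.2 *
        (((p.1:ℝ) / 2 * wA C p.1) * ((p.2:ℝ) / 2 * wA C p.2)) := by
  rw [split_reindex hN (fun n a b => W n (splitSum (qt C X a b)))]
  simp only [W_split]
  have h1 : ∀ p ∈ Finset.HasAntidiagonal.antidiagonal (N - 3), qc X p.1 p.2 *
        (((p.1:ℝ) / 2 * wA C p.1) * ((p.2:ℝ) / 2 * wA C p.2)) =
      ∑ a ∈ Finset.range ((p.1 + 1) / 2), ∑ b ∈ Finset.range ((p.2 + 1) / 2),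
        W (p.1 - 2 * a - 1) (fun I => W (p.2 - 2 * b - 1) (fun J => qt C X a b I J)) := by
    intro p _
    rw [half_rec, half_rec, Finset.sum_mul_sum, Finset.mul_sum]
    refine Finset.sum_congr rfl fun a ha => ?_
    rw [Finset.mul_sum]
    refine Finset.sum_congr rfl fun b hb => ?_
    rw [Finset.mem_range] at ha hb
    rw [← W_prod]
    refine W_congr fun I hI => W_congr fun J hJ => ?_
    rw [qt_eq, T_cons, T_cons, hI, hJ, show 2 * a + 1 + (p.1 - 2 * a - 1) = p.1 by omega,
      show 2 * b + 1 + (p.2 - 2 * b - 1) = p.2 by omega]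
  rw [Finset.sum_congr rfl h1,
    anti_shift (N - 3) (fun a x y => ∑ b ∈ Finset.range ((y + 1) / 2),
        W x (fun I => W (y - 2 * b - 1) (fun J => qt C X a b I J)))]
  refine Finset.sum_congr rfl fun a ha => ?_
  rw [anti_shift' (N - 3 - 2 * a - 1) (fun b x y => W x (fun I => W y (fun J => qt C X a b I J)))]

theorem wA_rec (hC : IsNormalizedWitten C) {X : ℕ} (hX : 2 ≤ X) :
    (3 * (X:ℝ)) * wA C (3 * X) = (3 * (X:ℝ)) * wA C (3 * X - 3) +
      2 * ∑ p ∈ Finset.HasAntidiagonal.antidiagonal (3 * X - 3), qc X p.1 p.2 *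
        (((p.1:ℝ) / 2 * wA C p.1) * ((p.2:ℝ) / 2 * wA C p.2)) := by
  have hX1 : (0:ℝ) < 3 * ((X:ℝ) - 1) := by
    have : (2:ℝ) ≤ X := by exact_mod_cast hX
    linarith
  have h0 := W_rec (3 * X) (fun l => (C l : ℝ))
  have h1 : ∀ d ∈ Finset.range ((3 * X + 1) / 2),
      3 * ((X:ℝ) - 1) * W (3 * X - 2 * d - 1) (fun l => (C (d :: l) : ℝ)) =
      W (3 * X - 2 * d - 1) (pickSum (mt C d)) +
        (2 * (∑ a ∈ Finset.range (d - 1),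
          W (3 * X - 2 * d - 1) (fun l => (C (a :: (d - 2 - a) :: l) : ℝ)))
        + 3 * ((X:ℝ) - 1) * ∑ a ∈ Finset.range (d - 1),
          W (3 * X - 2 * d - 1) (splitSum (qt C X a (d - 2 - a)))) := by
    intro d hd
    rw [Finset.mem_range] at hd
    rw [← W_mul, ← W_sum, ← W_sum, ← W_mul, ← W_mul, ← W_add, ← W_add]
    refine W_congr fun l hl => ?_
    rw [dvvU hC (X := X) (by rw [T_cons]; omega) hX, Finset.sum_add_distrib, Finset.mul_sum,
      Finset.mul_sum]
  have h2 := Finset.sum_congr rfl h1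
  rw [← Finset.mul_sum, Finset.sum_add_distrib, Finset.sum_add_distrib, ← Finset.mul_sum,
    ← Finset.mul_sum, merge_avg C (by omega), split_avg C (by omega), quad_avg C (by omega)] at h2
  rw [Finset.mul_sum _ _ (2:ℝ), ← add_assoc, ← Finset.sum_add_distrib] at h2
  have h3 : ∀ f ∈ Finset.range ((3 * X - 3 + 1) / 2), 2 * ((f:ℝ) + 2) *
        W (3 * X - 3 - 2 * f - 1) (fun l => (C (f :: l) : ℝ)) +
      2 * ((((3 * X - 3 - 2 * f - 1 : ℕ) : ℝ) / 2) *
        W (3 * X - 3 - 2 * f - 1) (fun l => (C (f :: l) : ℝ))) =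
      3 * X * W (3 * X - 3 - 2 * f - 1) (fun l => (C (f :: l) : ℝ)) := by
    intro f hf
    rw [Finset.mem_range] at hf
    rw [show 3 * X - 3 - 2 * f - 1 = 3 * X - (2 * f + 4) by omega, Nat.cast_sub (by omega)]
    push_cast; ring
  rw [Finset.sum_congr rfl h3, ← Finset.mul_sum] at h2
  have h4 := half_rec C (3 * X - 3)
  rw [← h4] at h2
  have h5 : ((3 * X - 3 : ℕ) : ℝ) = 3 * ((X:ℝ) - 1) := by
    rw [Nat.cast_sub (by omega)]; push_cast; ring
  rw [h5] at h2
  push_cast at h0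
  refine mul_left_cancel₀ hX1.ne' ?_
  change 3 * ((X:ℝ) - 1) * (3 * X * W (3 * X) (fun l => (C l : ℝ))) = _
  rw [h0, mul_left_comm, h2]
  ring

/-- `X! A_X` -/
def BX (C : List ℕ → ℚ) (X : ℕ) : ℝ := if X = 0 then 0 else (X.factorial : ℝ) * wA C (3 * X) / 2

lemma BX_one (hC : IsNormalizedWitten C) : BX C 1 = 5 / 18 := by
  have h3 := half_rec C 3
  have e2 : W 2 (fun l => (C (0 :: l) : ℝ)) = 2 / 3 := by
    have h2 := W_rec 2 (fun l => (C (0 :: l) : ℝ))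
    have h1 := W_rec 1 (fun l => (C (0 :: 0 :: l) : ℝ))
    simp [W_zero, hC.init3] at h1 h2
    rw [h1] at h2
    linarith
  simp [Finset.sum_range_succ, W_zero, hC.init1, e2] at h3
  simp [BX]
  linarith

theorem BX_rec (hC : IsNormalizedWitten C) {X : ℕ} (hX : 2 ≤ X) :
    BX C X = X * BX C (X - 1) +
      1 / 2 * ∑ p ∈ Finset.HasAntidiagonal.antidiagonal (X - 1), BX C p.1 * BX C p.2 := by
  have h := wA_rec hC hX
  have h1 : ∑ p ∈ Finset.HasAntidiagonal.antidiagonal (3 * X - 3), qc X p.1 p.2 *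
        (((p.1:ℝ) / 2 * wA C p.1) * ((p.2:ℝ) / 2 * wA C p.2)) =
      ∑ p ∈ Finset.HasAntidiagonal.antidiagonal (X - 1), qc X (3 * p.1) (3 * p.2) *
        ((((3 * p.1 : ℕ):ℝ) / 2 * wA C (3 * p.1)) * (((3 * p.2 : ℕ):ℝ) / 2 * wA C (3 * p.2))) := by
    symm
    refine Finset.sum_of_injOn (fun p => (3 * p.1, 3 * p.2)) ?_ ?_ ?_ ?_
    · rintro ⟨a, b⟩ _ ⟨c, d⟩ _ h
      simp at h ⊢; exact h
    · rintro ⟨a, b⟩ h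
      simp [Finset.HasAntidiagonal.mem_antidiagonal] at h ⊢
      omega
    · rintro ⟨a, b⟩ h h'
      simp only [Finset.HasAntidiagonal.mem_antidiagonal] at h
      have : ¬ 3 ∣ a := by
        rintro ⟨x, rfl⟩
        apply h'
        refine ⟨(x, X - 1 - x), ?_, ?_⟩
        · simp [Finset.HasAntidiagonal.mem_antidiagonal]; omega
        · simp; omega
      rw [qc, if_neg this, zero_mul]
    · intro p _; rfl
  rw [h1] at h
  have h2 : ∀ p ∈ Finset.HasAntidiagonal.antidiagonal (X - 1), qc X (3 * p.1) (3 * p.2) *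
        ((((3 * p.1 : ℕ):ℝ) / 2 * wA C (3 * p.1)) * (((3 * p.2 : ℕ):ℝ) / 2 * wA C (3 * p.2)))
      = 3 / (2 * ((X - 1).factorial : ℝ)) * (BX C p.1 * BX C p.2) := by
    rintro ⟨x, y⟩ _
    rw [qc, if_pos (Dvd.intro _ rfl)]
    simp only [Nat.mul_div_cancel_left _ (show 0 < 3 by norm_num)]
    rcases x with _ | x
    · simp [BX]
    rcases y with _ | y
    · simp [BX]
    simp only [BX, Nat.add_sub_cancel, Nat.factorial_succ]
    simp only [Nat.add_eq_zero_iff, one_ne_zero, and_false, if_false]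
    have : ((X - 1).factorial : ℝ) ≠ 0 := by positivity
    push_cast
    field_simp
    ring
  rw [Finset.sum_congr rfl h2, ← Finset.mul_sum] at h
  obtain ⟨Y, rfl⟩ : ∃ Y, X = Y + 1 := ⟨X - 1, by omega⟩
  simp only [Nat.add_sub_cancel] at *
  rw [show 3 * (Y + 1) - 3 = 3 * Y by omega] at h
  have hY : Y ≠ 0 := by omega
  set S := ∑ p ∈ Finset.HasAntidiagonal.antidiagonal Y, BX C p.1 * BX C p.2
  rw [BX, BX, if_neg (by omega), if_neg hY, Nat.factorial_succ]
  have : (Y.factorial : ℝ) ≠ 0 := by positivity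
  push_cast at h ⊢
  field_simp at h ⊢
  linarith

/-- Airy asymptotic coefficients -/
def ph : ℕ → ℝ
  | 0 => 1
  | k + 1 => ((k:ℝ) + 1/6) * ((k:ℝ) + 5/6) / ((k:ℝ) + 1) * ph k

lemma ph_succ (k : ℕ) : ((k:ℝ) + 1) * ph (k + 1) = ((k:ℝ) + 1/6) * ((k:ℝ) + 5/6) * ph k := by
  rw [ph]; field_simp

lemma ph_pos (k : ℕ) : 0 < ph k := by
  induction k with
  | zero => simp [ph]
  | succ k ih => rw [ph]; positivity

theorem BX_ph (hC : IsNormalizedWitten C) (X : ℕ) :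
    ∑ p ∈ Finset.HasAntidiagonal.antidiagonal X, BX C p.1 * ph p.2 = 2 * X * ph X := by
  open PowerSeries in
  set f : PowerSeries ℝ := PowerSeries.mk ph with hf
  set b : PowerSeries ℝ := PowerSeries.mk (BX C) with hb
  let d := PowerSeries.derivative ℝ
  have coeff_d : ∀ (g : PowerSeries ℝ) (n : ℕ), PowerSeries.coeff n (d g) = PowerSeries.coeff (n+1) g * ((n:ℝ)+1) := by
    intro g n; exact PowerSeries.coeff_derivative g n
  have hX0 : BX C 0 = 0 := by simp [BX]
  have eq1 : b = PowerSeries.C (5/18:ℝ) * PowerSeries.X + PowerSeries.X * d (PowerSeries.X * b)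
      + PowerSeries.C (1/2:ℝ) * (PowerSeries.X * (b * b)) := by
    ext n
    rcases n with _ | n
    · simp [hb, hX0]
    · rw [map_add, map_add, PowerSeries.coeff_C_mul, PowerSeries.coeff_C_mul,
        PowerSeries.coeff_succ_X_mul, PowerSeries.coeff_succ_X_mul, coeff_d,
        PowerSeries.coeff_succ_X_mul, PowerSeries.coeff_mul, PowerSeries.coeff_X]
      simp only [hb, PowerSeries.coeff_mk]
      rcases n with _ | n
      · simp [hX0, BX_one hC]
      · rw [BX_rec hC (by omega), if_neg (by omega)]
        simp only [Nat.add_sub_cancel]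
        push_cast
        ring
  have eq2 : d f = PowerSeries.X * d (PowerSeries.X * d f) + PowerSeries.X * d f
      + PowerSeries.C (5/36:ℝ) * f := by
    ext n
    have hs := ph_succ n
    rw [map_add, map_add, PowerSeries.coeff_C_mul]
    rcases n with _ | n
    · rw [coeff_d]
      simp [hf]
      simp at hs
      linarith
    · rw [PowerSeries.coeff_succ_X_mul, PowerSeries.coeff_succ_X_mul, coeff_d, coeff_d,
        PowerSeries.coeff_succ_X_mul, coeff_d]
      simp only [hf, PowerSeries.coeff_mk]
      push_cast at hs ⊢
      linarith
  set u := b * f - 2 * (PowerSeries.X * d f) with hu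
  have hdX : d PowerSeries.X = 1 := by
    ext n
    rw [coeff_d, PowerSeries.coeff_X, PowerSeries.coeff_one]
    rcases n with _ | n <;> simp
  have hmul : ∀ g h : PowerSeries ℝ, d (g * h) = g * d h + h * d g := by
    intro g h
    have := d.leibniz g h
    exact this
  have eq3 : u = PowerSeries.X * d (PowerSeries.X * u) + PowerSeries.C (1/2:ℝ) * (PowerSeries.X * (b * u)) := by
    have h2 : d (2 : PowerSeries ℝ) = 0 := by
      have := d.map_natCast 2
      simpa using this
    have hc : (PowerSeries.C (1/2:ℝ)) * 2 = 1 := by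
      have : (2 : PowerSeries ℝ) = PowerSeries.C (2:ℝ) := (map_ofNat PowerSeries.C 2).symm
      rw [this, ← map_mul]; norm_num
    have hc2 : (PowerSeries.C (5/18:ℝ)) = 2 * PowerSeries.C (5/36:ℝ) := by
      have : (2 : PowerSeries ℝ) = PowerSeries.C (2:ℝ) := (map_ofNat PowerSeries.C 2).symm
      rw [this, ← map_mul]; norm_num
    have e2 := eq2
    simp only [hmul, hdX, mul_one] at e2
    have e1 := eq1
    simp only [hmul, hdX, mul_one] at e1
    rw [hu]
    simp only [map_sub, hmul, hdX, h2, mul_one, mul_zero, add_zero, mul_sub, ]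
    rw [hc2] at e1
    generalize PowerSeries.C (5/36:ℝ) = c5 at *
    generalize PowerSeries.C (1/2:ℝ) = c2 at *
    generalize d (d f) = f2 at *
    generalize d f = f1 at *
    generalize d b = b1 at *
    linear_combination f * e1 - 2 * PowerSeries.X * e2 + (b * f1 * PowerSeries.X ^ 2) * hc
  have u0 : ∀ n, PowerSeries.coeff n u = 0 := by
    intro n
    induction n using Nat.strong_induction_on with
    | _ n ih =>
      rw [eq3, map_add, PowerSeries.coeff_C_mul]
      rcases n with _ | n
      · simp
      · rw [PowerSeries.coeff_succ_X_mul, PowerSeries.coeff_succ_X_mul, coeff_d,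
          PowerSeries.coeff_succ_X_mul, PowerSeries.coeff_mul, ih n (by omega),
          Finset.sum_eq_zero]
        · simp
        · intro p hp
          rw [Finset.HasAntidiagonal.mem_antidiagonal] at hp
          rw [ih p.2 (by omega), mul_zero]
  have := u0 X
  rw [hu, map_sub, PowerSeries.coeff_mul] at this
  simp only [hf, hb, PowerSeries.coeff_mk] at this
  have h3 : PowerSeries.coeff X (2 * (PowerSeries.X * d f)) = 2 * X * ph X := by
    have : (2 : PowerSeries ℝ) = PowerSeries.C (2:ℝ) := (map_ofNat PowerSeries.C 2).symm
    rw [this, PowerSeries.coeff_C_mul]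
    rcases X with _ | n
    · simp
    · rw [PowerSeries.coeff_succ_X_mul, coeff_d]
      simp only [hf, PowerSeries.coeff_mk]; push_cast; ring
  rw [h3] at this
  linarith

/-- normalized Airy coefficients -/
def aA (k : ℕ) : ℝ := ph (k + 1) / (k.factorial : ℝ)

lemma ph_prod (n : ℕ) : (∏ j ∈ Finset.range n, ((1/6:ℝ) + j)) * (∏ j ∈ Finset.range n, ((5/6:ℝ) + j))
    = ph n * (n.factorial : ℝ) := by
  induction n with
  | zero => simp [ph]
  | succ n ih =>
    rw [Finset.prod_range_succ, Finset.prod_range_succ, Nat.factorial_succ, mul_mul_mul_comm, ih]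
    have := ph_succ n
    push_cast
    linear_combination - (n.factorial : ℝ) * this

lemma aA_tendsto : Filter.Tendsto aA Filter.atTop (nhds (1 / (2 * Real.pi))) := by
  have h1 := Real.GammaSeq_tendsto_Gamma (1/6)
  have h2 := Real.GammaSeq_tendsto_Gamma (5/6)
  have h3 := h1.mul h2
  have hg : Real.Gamma (1/6) * Real.Gamma (5/6) = 2 * Real.pi := by
    have := Real.Gamma_mul_Gamma_one_sub (1/6)
    rw [show (1:ℝ) - 1/6 = 5/6 by norm_num, show Real.pi * (1/6) = Real.pi / 6 by ring,
      Real.sin_pi_div_six] at this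
    rw [this]; ring
  rw [hg] at h3
  have h4 : Filter.Tendsto (fun n : ℕ => (n:ℝ) / ((n:ℝ) + 1)) Filter.atTop (nhds 1) :=
    tendsto_natCast_div_add_atTop 1
  have h5 := h4.div h3 (by positivity)
  refine h5.congr' ?_
  filter_upwards [Filter.eventually_gt_atTop 0] with n hn
  have hn' : (0:ℝ) < n := by exact_mod_cast hn
  simp only [Pi.div_apply, Real.GammaSeq]
  rw [div_mul_div_comm, ph_prod, aA, Nat.factorial_succ]
  have e : (n:ℝ) ^ (1/6:ℝ) * (n:ℝ) ^ (5/6:ℝ) = n := by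
    rw [← Real.rpow_add hn']; norm_num
  have e' : (n:ℝ) ^ (1/6:ℝ) * n.factorial * ((n:ℝ) ^ (5/6:ℝ) * n.factorial) =
      n * n.factorial * n.factorial := by
    linear_combination ((n.factorial : ℝ) * n.factorial) * e
  rw [e']
  have := ph_pos (n + 1)
  push_cast
  field_simp

lemma fact_mul_le (x m : ℕ) : (x + 1).factorial * (m + 1).factorial ≤ (x + m + 1).factorial := by
  induction x with
  | zero => simp
  | succ x ih =>
    rw [Nat.factorial_succ (x + 1), show x + 1 + m + 1 = (x + m + 1) + 1 by ring,
      Nat.factorial_succ (x + m + 1), mul_assoc]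
    exact Nat.mul_le_mul (by omega) ih

lemma BX_nonneg (hC : IsNormalizedWitten C) (X : ℕ) : 0 ≤ BX C X := by
  rw [BX]
  split_ifs with h
  · rfl
  · have : 0 ≤ wA C (3 * X) := by
      have := W_mono (N := 3 * X) (F := fun _ => (0:ℝ) * 0) (G := fun l => (C l : ℝ)) (by
        intro l hl
        have hl' : l ≠ [] := by rintro rfl; simp at hl; omega
        simpa using C_nn' hC hl')
      rw [W_mul, zero_mul] at this
      exact this
    positivity

theorem A_tendsto (hC : IsNormalizedWitten C) :
    Filter.Tendsto (fun X : ℕ => wA C (3 * X)) Filter.atTop (nhds (2 / Real.pi)) := by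
  obtain ⟨K, hK⟩ := aA_tendsto.bddAbove_range
  have hK : ∀ n, aA n ≤ K := fun n => hK ⟨n, rfl⟩
  have hK0 : 0 ≤ K := le_trans (by rw [aA]; have := ph_pos 1; positivity) (hK 0)
  have hph : ∀ n, ph (n + 1) ≤ K * n.factorial := by
    intro n
    have := hK n
    rw [aA, div_le_iff₀ (by positivity)] at this
    exact this
  have hsum : ∀ X, BX C (X + 1) + ∑ x ∈ Finset.range (X + 1), BX C x * ph (X + 1 - x)
      = 2 * ((X:ℝ) + 1) * ph (X + 1) := by
    intro X
    have := BX_ph hC (X + 1)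
    rw [Finset.Nat.sum_antidiagonal_eq_sum_range_succ (fun x y => BX C x * ph y),
      Finset.sum_range_succ] at this
    simp only [Nat.sub_self, ph, mul_one] at this
    push_cast at this
    simp only [ph]
    linarith
  have hB : ∀ X, BX C X ≤ 2 * K * X.factorial := by
    intro X
    rcases X with _ | X
    · simp [BX]; exact hK0
    · have h1 := hsum X
      have h2 : 0 ≤ ∑ x ∈ Finset.range (X + 1), BX C x * ph (X + 1 - x) :=
        Finset.sum_nonneg fun x _ => mul_nonneg (BX_nonneg hC x) (ph_pos _).le
      have h3 := mul_le_mul_of_nonneg_left (hph X) (show 0 ≤ 2 * ((X:ℝ) + 1) by positivity)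
      rw [Nat.factorial_succ]; push_cast
      nlinarith
  have herr : ∀ X, ∑ x ∈ Finset.range (X + 1), BX C x * ph (X + 1 - x) ≤ 4 * K ^ 2 * X.factorial := by
    intro X
    rcases X with _ | X
    · simp [BX]; positivity
    rw [Finset.sum_range_succ, Finset.sum_range_succ']
    have h0 : BX C 0 = 0 := by simp [BX]
    rw [h0, zero_mul, add_zero, show X + 1 + 1 - (X + 1) = 0 + 1 by omega]
    have h1 : BX C (X + 1) * ph (0 + 1) ≤ 2 * K ^ 2 * (X + 1).factorial := by
      have a := hB (X + 1)
      have b := hph 0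
      have := mul_le_mul a b (ph_pos _).le (by positivity)
      simp at this ⊢
      nlinarith
    have h2 : ∑ x ∈ Finset.range X, BX C (x + 1) * ph (X + 1 + 1 - (x + 1)) ≤
        ∑ x ∈ Finset.range X, 2 * K ^ 2 * (X.factorial : ℝ) := by
      refine Finset.sum_le_sum fun x hx => ?_
      rw [Finset.mem_range] at hx
      obtain ⟨m, rfl⟩ : ∃ m, X = x + m + 1 := ⟨X - x - 1, by omega⟩
      rw [show x + m + 1 + 1 + 1 - (x + 1) = (m + 1) + 1 by omega]
      have a := hB (x + 1)
      have b := hph (m + 1)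
      have := mul_le_mul a b (ph_pos _).le (by positivity)
      have c : (((x + 1).factorial * (m + 1).factorial : ℕ) : ℝ) ≤ ((x + m + 1).factorial : ℕ) := by
        exact_mod_cast fact_mul_le x m
      push_cast at c
      refine this.trans ?_
      nlinarith [sq_nonneg K]
    rw [Finset.sum_const, Finset.card_range, nsmul_eq_mul] at h2
    have h3 : (X:ℝ) * (2 * K ^ 2 * (X.factorial : ℝ)) ≤ 2 * K ^ 2 * (X + 1).factorial := by
      rw [Nat.factorial_succ]; push_cast
      have : 0 ≤ 2 * K ^ 2 * (X.factorial : ℝ) := by positivity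
      nlinarith
    linarith
  have hA : ∀ X, wA C (3 * (X + 1)) = 2 * BX C (X + 1) / (X + 1).factorial := by
    intro X
    rw [BX, if_neg (by omega)]
    field_simp
  have hup : ∀ X, wA C (3 * (X + 1)) ≤ 4 * aA X := by
    intro X
    rw [hA, aA, div_le_iff₀ (by positivity), Nat.factorial_succ]
    have h1 := hsum X
    have h2 : 0 ≤ ∑ x ∈ Finset.range (X + 1), BX C x * ph (X + 1 - x) :=
        Finset.sum_nonneg fun x _ => mul_nonneg (BX_nonneg hC x) (ph_pos _).le
    push_cast
    have : 4 * (ph (X + 1) / (X.factorial:ℝ)) * (((X:ℝ) + 1) * (X.factorial : ℝ)) =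
      2 * (2 * ((X:ℝ) + 1) * ph (X + 1)) := by field_simp; ring
    rw [this]; linarith
  have hlo : ∀ X : ℕ, 4 * aA X - 8 * K ^ 2 / ((X:ℝ) + 1) ≤ wA C (3 * (X + 1)) := by
    intro X
    rw [hA, aA, le_div_iff₀ (by positivity), Nat.factorial_succ]
    have h1 := hsum X
    have h2 := herr X
    push_cast
    have : (4 * (ph (X + 1) / (X.factorial:ℝ)) - 8 * K ^ 2 / ((X:ℝ) + 1)) * (((X:ℝ) + 1) * (X.factorial : ℝ)) =
      2 * (2 * ((X:ℝ) + 1) * ph (X + 1)) - 8 * K ^ 2 * (X.factorial : ℝ) := by field_simp; ring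
    rw [this]; linarith
  have l1 : Filter.Tendsto (fun X => 4 * aA X) Filter.atTop (nhds (2 / Real.pi)) := by
    have := aA_tendsto.const_mul 4
    convert this using 2
    field_simp; norm_num
  have l2 : Filter.Tendsto (fun X : ℕ => 4 * aA X - 8 * K ^ 2 / ((X:ℝ) + 1)) Filter.atTop
      (nhds (2 / Real.pi)) := by
    have h := (tendsto_one_div_add_atTop_nhds_zero_nat (𝕜 := ℝ)).const_mul (8 * K ^ 2)
    have := l1.sub h
    simp only [mul_zero, sub_zero] at this
    refine this.congr fun X => ?_
    ring
  have := tendsto_of_tendsto_of_tendsto_of_le_of_le l2 l1 hlo hup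
  exact (Filter.tendsto_add_atTop_iff_nat (f := fun X : ℕ => wA C (3 * X)) 1).1 this

lemma le_choose' (N p : ℕ) (h1 : 1 ≤ p) (h2 : p + 1 ≤ N) : N ≤ N.choose p := by
  induction N generalizing p with
  | zero => omega
  | succ N ih =>
    obtain ⟨p, rfl⟩ : ∃ k, p = k + 1 := ⟨p - 1, by omega⟩
    rw [Nat.choose_succ_succ']
    have h3 : 1 ≤ N.choose (p + 1) := Nat.choose_pos (by omega)
    rcases Nat.eq_zero_or_pos p with rfl | hp
    · simp
    · have := ih p hp (by omega)
      omega

lemma vand (n M i k : ℕ) : n.choose i * M.choose k ≤ (n + M).choose (i + k) := by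
  rw [Nat.add_choose_eq]
  exact Finset.single_le_sum (f := fun ij : ℕ × ℕ => n.choose ij.1 * M.choose ij.2)
    (fun _ _ => Nat.zero_le _) (a := (i, k)) (by simp [Finset.HasAntidiagonal.mem_antidiagonal])

lemma sum_choose_split (n : ℕ) (k : ℕ → ℝ) :
    ∑ i ∈ Finset.range (n + 2), ((n + 1).choose i : ℝ) * k i =
      ∑ i ∈ Finset.range (n + 1), (n.choose i : ℝ) * k (i + 1)
      + ∑ i ∈ Finset.range (n + 1), (n.choose i : ℝ) * k i := by
  rw [Finset.sum_range_succ']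
  simp only [Nat.choose_succ_succ]
  push_cast
  simp only [add_mul, Finset.sum_add_distrib]
  rw [add_assoc]
  congr 1
  rw [Finset.sum_range_succ, Nat.choose_succ_self, Finset.sum_range_succ' _ n]
  simp

lemma splitSum_len (k : ℕ → ℝ) (r : List ℕ) :
    splitSum (fun I _ => k I.length) r =
      ∑ i ∈ Finset.range (r.length + 1), (r.length.choose i : ℝ) * k i := by
  induction r generalizing k with
  | nil => simp [splitSum]
  | cons e l ih =>
    rw [splitSum, List.length_cons, sum_choose_split, ← ih (fun i => k (i + 1)), ← ih k]
    rfl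

lemma splitSum_len' (k : ℕ → ℝ) (r : List ℕ) :
    splitSum (fun I _ => 1 / (r.length.choose I.length : ℝ) * k I.length) r =
      ∑ i ∈ Finset.range (r.length + 1), k i := by
  rw [splitSum_len (fun i => 1 / (r.length.choose i : ℝ) * k i)]
  refine Finset.sum_congr rfl fun i hi => ?_
  rw [Finset.mem_range] at hi
  have : (0:ℝ) < r.length.choose i := by exact_mod_cast Nat.choose_pos (by omega)
  field_simp

lemma T_ge {l : List ℕ} {m : ℕ} (h : ∀ e ∈ l, m ≤ e) : l.length * (2 * m + 1) ≤ T l := by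
  induction l with
  | nil => simp
  | cons d l ih =>
    have h1 := ih fun e he => h e (List.mem_cons_of_mem _ he)
    have h2 := h d (List.mem_cons_self)
    rw [T_cons, List.length_cons]
    nlinarith

/-- inverse binomial weight -/
def vq (X a : ℕ) (I : List ℕ) : ℝ :=
  if 3 ∣ T (a :: I) then 1 / ((X - 3).choose (T (a :: I) / 3 - 1) : ℝ) else 0

/-- majorant -/
def kq (δ n M a b i : ℕ) : ℝ :=
  (if i = 0 then (if a = 1 then (1:ℝ) else 0) + 1 / ((δ:ℝ) + 1) else 0) +
  (if i = n then (if b = 1 then (1:ℝ) else 0) + 1 / ((δ:ℝ) + 1) else 0) +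
  (if δ = 0 ∧ i = 1 then (1:ℝ) else 0) + (if δ = 0 ∧ i + 1 = n then (1:ℝ) else 0) +
  (if 1 ≤ i ∧ i < n then 1 / (M:ℝ) else 0)

lemma kq_nonneg (δ n M a b i : ℕ) : 0 ≤ kq δ n M a b i := by
  unfold kq
  have : (0:ℝ) ≤ 1 / ((δ:ℝ) + 1) := by positivity
  have : (0:ℝ) ≤ 1 / (M:ℝ) := by positivity
  refine add_nonneg (add_nonneg (add_nonneg (add_nonneg ?_ ?_) ?_) ?_) ?_ <;>
    split_ifs <;> linarith

lemma ite_nn (p : Prop) [Decidable p] {x : ℝ} (h : 0 ≤ x) : 0 ≤ (if p then x else 0) := by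
  split_ifs
  · exact h
  · exact le_refl _

lemma kq_ge_zero' (δ n M a b i : ℕ) (hi : i = 0) :
    (if a = 1 then (1:ℝ) else 0) + 1 / ((δ:ℝ) + 1) ≤ kq δ n M a b i := by
  unfold kq
  rw [if_pos hi]
  have h0 : (0:ℝ) ≤ 1 / ((δ:ℝ) + 1) := by positivity
  have h1 : (0:ℝ) ≤ 1 / (M:ℝ) := by positivity
  have h2 := ite_nn (i = n) (add_nonneg (ite_nn (b = 1) zero_le_one) h0)
  have h3 := ite_nn (δ = 0 ∧ i = 1) (zero_le_one (α := ℝ))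
  have h4 := ite_nn (δ = 0 ∧ i + 1 = n) (zero_le_one (α := ℝ))
  have h5 := ite_nn (1 ≤ i ∧ i < n) h1
  linarith

lemma kq_ge_zero (δ n M a b : ℕ) :
    (if a = 1 then (1:ℝ) else 0) + 1 / ((δ:ℝ) + 1) ≤ kq δ n M a b 0 :=
  kq_ge_zero' _ _ _ _ _ _ rfl

lemma kq_ge_n (δ n M a b : ℕ) :
    (if b = 1 then (1:ℝ) else 0) + 1 / ((δ:ℝ) + 1) ≤ kq δ n M a b n := by
  unfold kq
  rw [if_pos (rfl : n = n)]
  have h0 : (0:ℝ) ≤ 1 / ((δ:ℝ) + 1) := by positivity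
  have h1 : (0:ℝ) ≤ 1 / (M:ℝ) := by positivity
  have h2 := ite_nn (n = 0) (add_nonneg (ite_nn (a = 1) zero_le_one) h0)
  have h3 := ite_nn (δ = 0 ∧ n = 1) (zero_le_one (α := ℝ))
  have h4 := ite_nn (δ = 0 ∧ n + 1 = n) (zero_le_one (α := ℝ))
  have h5 := ite_nn (1 ≤ n ∧ n < n) h1
  linarith

lemma kq_ge_ext (δ n M a b i : ℕ) (h : δ = 0 ∧ (i = 1 ∨ i + 1 = n)) :
    1 ≤ kq δ n M a b i := by
  unfold kq
  have h0 : (0:ℝ) ≤ 1 / ((δ:ℝ) + 1) := by positivity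
  have h1 : (0:ℝ) ≤ 1 / (M:ℝ) := by positivity
  have h2 := ite_nn (i = n) (add_nonneg (ite_nn (b = 1) zero_le_one) h0)
  have h2' := ite_nn (i = 0) (add_nonneg (ite_nn (a = 1) zero_le_one) h0)
  have h3 := ite_nn (δ = 0 ∧ i = 1) (zero_le_one (α := ℝ))
  have h4 := ite_nn (δ = 0 ∧ i + 1 = n) (zero_le_one (α := ℝ))
  have h5 := ite_nn (1 ≤ i ∧ i < n) h1
  rcases h with ⟨h6, h7 | h7⟩
  · rw [if_pos (⟨h6, h7⟩ : δ = 0 ∧ i = 1)] at *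
    linarith
  · rw [if_pos (⟨h6, h7⟩ : δ = 0 ∧ i + 1 = n)] at *
    linarith

lemma kq_ge_mid (δ n M a b i : ℕ) (h : 1 ≤ i ∧ i < n) :
    1 / (M:ℝ) ≤ kq δ n M a b i := by
  unfold kq
  have h0 : (0:ℝ) ≤ 1 / ((δ:ℝ) + 1) := by positivity
  have h1 : (0:ℝ) ≤ 1 / (M:ℝ) := by positivity
  have h2 := ite_nn (i = n) (add_nonneg (ite_nn (b = 1) zero_le_one) h0)
  have h2' := ite_nn (i = 0) (add_nonneg (ite_nn (a = 1) zero_le_one) h0)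
  have h3 := ite_nn (δ = 0 ∧ i = 1) (zero_le_one (α := ℝ))
  have h4 := ite_nn (δ = 0 ∧ i + 1 = n) (zero_le_one (α := ℝ))
  rw [if_pos h]
  linarith

lemma one_div_choose_le (N p : ℕ) {m : ℕ} (hm : 0 < m) (h : m ≤ N.choose p) :
    1 / (N.choose p : ℝ) ≤ 1 / m := by
  have : (0:ℝ) < m := by exact_mod_cast hm
  exact one_div_le_one_div_of_le this (by exact_mod_cast h)

lemma one_div_nat_le_one (N : ℕ) : 1 / (N:ℝ) ≤ 1 := by
  rcases Nat.eq_zero_or_pos N with rfl | h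
  · simp
  · rw [div_le_one (by exact_mod_cast h)]; exact_mod_cast h

lemma end_bound {X a b δ : ℕ} {J : List ℕ} (hab : a + b = δ) (hJ : ∀ e ∈ J, δ + 2 ≤ e)
    (hJn : J ≠ []) (hT : T [a] + T (b :: J) + 3 = 3 * X) (h3 : 3 ∣ T [a]) {p : ℕ}
    (hp : p = T [a] / 3 - 1 ∨ p = T (b :: J) / 3 - 1) :
    1 / ((X - 3).choose p : ℝ) ≤ (if a = 1 then (1:ℝ) else 0) + 1 / ((δ:ℝ) + 1) := by
  by_cases ha : a = 1
  · rw [if_pos ha]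
    have := one_div_nat_le_one ((X - 3).choose p)
    have : (0:ℝ) ≤ 1 / ((δ:ℝ) + 1) := by positivity
    linarith
  · rw [if_neg ha, zero_add]
    simp only [T_cons, T_nil] at *
    have hJ1 := T_ge hJ
    have : 1 ≤ J.length := by
      rcases J with _ | _
      · simp at hJn
      · simp
    have hJ2 : 1 * (2 * (δ + 2) + 1) ≤ T J := le_trans (Nat.mul_le_mul_right _ this) hJ1
    have key : δ + 1 ≤ (X - 3).choose p := by
      refine le_trans ?_ (le_choose' _ _ ?_ ?_)
      · omega
      · omega
      · omega
    have := one_div_choose_le (X - 3) p (Nat.succ_pos δ) key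
    push_cast at this
    exact this

lemma vq_le {X a b δ : ℕ} {r I J : List ℕ} (hab : a + b = δ) (hr : ∀ e ∈ r, δ + 2 ≤ e)
    (hrn : r ≠ []) (hT : T r + 2 * δ + 5 = 3 * X) (hp : (I ++ J).Perm r) :
    vq X a I ≤ 1 / (r.length.choose I.length : ℝ) * kq δ r.length (X - 3 - r.length) a b I.length := by
  have hk := kq_nonneg δ r.length (X - 3 - r.length) a b I.length
  rw [vq]
  split_ifs with h3
  swap
  · positivity
  have hl := hp.length_eq
  rw [List.length_append] at hl
  have hTp := T_perm hp
  rw [T_append] at hTp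
  have hI : ∀ e ∈ I, δ + 2 ≤ e := fun e he => hr e (hp.subset (List.mem_append_left _ he))
  have hJ : ∀ e ∈ J, δ + 2 ≤ e := fun e he => hr e (hp.subset (List.mem_append_right _ he))
  have nn1 : (0:ℝ) ≤ 1 / ((δ:ℝ) + 1) := by positivity
  have nn2 : (0:ℝ) ≤ 1 / ((X - 3 - r.length : ℕ):ℝ) := by positivity
  by_cases hI0 : I = []
  · subst hI0
    have hJn : J ≠ [] := by
      rintro rfl
      apply hrn
      simpa using hp.symm
    have hrl : 0 < r.length := List.length_pos_iff.2 hrn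
    have := end_bound (X := X) hab hJ hJn (by simp at *; omega) h3 (Or.inl rfl)
    refine this.trans ?_
    simp only [List.length_nil, Nat.choose_zero_right, Nat.cast_one, div_one, one_mul]
    exact kq_ge_zero _ _ _ _ _
  by_cases hJ0 : J = []
  · subst hJ0
    have e : I.length = r.length := by simpa using hl
    have h3b : 3 ∣ T [b] := by simp at *; omega
    have := end_bound (X := X) (a := b) (b := a) (by omega) hI hI0 (by simp at *; omega) h3b (Or.inr rfl)
    refine this.trans ?_
    rw [e, Nat.choose_self]
    simp only [Nat.cast_one, div_one, one_mul]
    exact kq_ge_n _ _ _ _ _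
  have hi : 1 ≤ I.length := List.length_pos_iff.2 hI0
  have hj : 1 ≤ J.length := List.length_pos_iff.2 hJ0
  have hTI := T_ge hI
  have hTJ := T_ge hJ
  have hTI' : 5 * I.length + 2 * δ ≤ T I := by nlinarith
  have hTJ' : 5 * J.length + 2 * δ ≤ T J := by nlinarith
  obtain ⟨x, hx⟩ := h3
  have hx' := hx
  rw [T_cons] at hx'
  have hxd : T (a :: I) / 3 - 1 = x - 1 := by rw [hx]; omega
  rw [hxd]
  obtain ⟨k, hk1⟩ : ∃ k, x - 1 = I.length + k := ⟨x - 1 - I.length, by omega⟩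
  have hM : X - 3 = r.length + (X - 3 - r.length) := by omega
  obtain ⟨M, hMdef⟩ : ∃ M, X - 3 - r.length = M := ⟨_, rfl⟩
  rw [hMdef] at hM ⊢
  have hv := vand r.length M I.length k
  rw [← hM, ← hk1] at hv
  have hcp : 0 < r.length.choose I.length := Nat.choose_pos (by omega)
  have hcp' : (0:ℝ) < r.length.choose I.length := by exact_mod_cast hcp
  have hkM : k ≤ M := by omega
  have hMk : 0 < M.choose k := Nat.choose_pos hkM
  have hgen : ∀ m : ℕ, 0 < m → m ≤ M.choose k →
      1 / ((X - 3).choose (x - 1) : ℝ) ≤ 1 / (r.length.choose I.length : ℝ) * (1 / m) := by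
    intro m hm hm2
    rw [one_div_mul_one_div]
    have := one_div_choose_le (X - 3) (x - 1) (m := r.length.choose I.length * m)
      (Nat.mul_pos hcp hm) (le_trans (Nat.mul_le_mul_left _ hm2) hv)
    push_cast at this
    exact this
  by_cases hext : δ = 0 ∧ (I.length = 1 ∨ I.length + 1 = r.length)
  · refine (hgen 1 one_pos hMk).trans ?_
    refine mul_le_mul_of_nonneg_left ?_ (by positivity)
    simpa using kq_ge_ext _ _ _ _ _ _ hext
  · have hMM : M ≤ M.choose k := le_choose' M k (by omega) (by omega)
    refine (hgen M (by omega) hMM).trans ?_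
    refine mul_le_mul_of_nonneg_left ?_ (by positivity)
    exact kq_ge_mid _ _ _ _ _ _ ⟨hi, by omega⟩

lemma sum_ite_le_one (n : ℕ) (p : ℕ → Prop) [DecidablePred p] (i₀ : ℕ) (h : ∀ i, p i → i = i₀)
    (q : Prop) [Decidable q] (hq : ∀ i, p i → q) {x : ℝ} (hx : 0 ≤ x) :
    ∑ i ∈ Finset.range n, (if p i then x else 0) ≤ if q then x else 0 := by
  by_cases hq' : q
  · rw [if_pos hq']
    calc ∑ i ∈ Finset.range n, (if p i then x else 0)
        ≤ ∑ i ∈ Finset.range n, (if i₀ = i then x else 0) := by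
          refine Finset.sum_le_sum fun i _ => ?_
          by_cases hp : p i
          · rw [if_pos hp, if_pos (h i hp).symm]
          · rw [if_neg hp]; exact ite_nn _ hx
      _ ≤ x := by
          rw [Finset.sum_ite_eq]
          split_ifs <;> linarith
  · rw [if_neg hq']
    refine le_of_eq (Finset.sum_eq_zero fun i _ => if_neg fun hp => hq' (hq i hp))

lemma kq_sum (δ n M a b : ℕ) (hn : 1 ≤ n) :
    ∑ i ∈ Finset.range (n + 1), kq δ n M a b i ≤
      (if a = 1 then (1:ℝ) else 0) + (if b = 1 then (1:ℝ) else 0) + 2 / ((δ:ℝ) + 1)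
      + (if δ = 0 then (2:ℝ) else 0) + ((n:ℝ) - 1) / M := by
  unfold kq
  simp only [Finset.sum_add_distrib]
  have h0 : (0:ℝ) ≤ 1 / ((δ:ℝ) + 1) := by positivity
  have h1 := sum_ite_le_one (n + 1) (fun i => i = 0) 0 (fun i h => h) True (fun _ _ => trivial)
    (add_nonneg (ite_nn (a = 1) zero_le_one) h0)
  have h2 := sum_ite_le_one (n + 1) (fun i => i = n) n (fun i h => h) True (fun _ _ => trivial)
    (add_nonneg (ite_nn (b = 1) zero_le_one) h0)
  have h3 := sum_ite_le_one (n + 1) (fun i => δ = 0 ∧ i = 1) 1 (fun i h => h.2) (δ = 0)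
    (fun _ h => h.1) (zero_le_one (α := ℝ))
  have h4 := sum_ite_le_one (n + 1) (fun i => δ = 0 ∧ i + 1 = n) (n - 1) (fun i h => by omega) (δ = 0)
    (fun _ h => h.1) (zero_le_one (α := ℝ))
  have h5 : ∑ i ∈ Finset.range (n + 1), (if 1 ≤ i ∧ i < n then 1 / (M:ℝ) else 0)
      = ((n:ℝ) - 1) / M := by
    rw [← Finset.sum_filter]
    have : Finset.filter (fun i => 1 ≤ i ∧ i < n) (Finset.range (n + 1)) = Finset.Ico 1 n := by
      ext i; simp; omega
    rw [this, Finset.sum_const, Nat.card_Ico, nsmul_eq_mul, Nat.cast_sub hn]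
    push_cast; ring
  have h6 : 2 / ((δ:ℝ) + 1) = 1 / ((δ:ℝ) + 1) + 1 / ((δ:ℝ) + 1) := by ring
  have h7 : (if δ = 0 then (2:ℝ) else 0) = (if δ = 0 then (1:ℝ) else 0) + (if δ = 0 then (1:ℝ) else 0) := by
    split_ifs <;> norm_num
  rw [if_pos trivial] at h1 h2
  linarith

lemma mid_bound {δ n X : ℕ} (hn : 1 ≤ n) (h : (n + 1) * (2 * δ + 5) ≤ 3 * X) :
    ((n:ℝ) - 1) / ((X - 3 - n : ℕ) : ℝ) ≤ 2 / ((δ:ℝ) + 1) := by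
  obtain ⟨M, hM⟩ : ∃ M, X - 3 - n = M := ⟨_, rfl⟩
  rw [hM]
  rcases Nat.eq_zero_or_pos M with h0 | h0
  · subst h0; simp; positivity
  · have h1 : 3 * M + 9 + 3 * n = 3 * X := by omega
    have h2 : (n - 1) * (δ + 1) ≤ 2 * M := by
      obtain ⟨k, rfl⟩ : ∃ k, n = k + 1 := ⟨n - 1, by omega⟩
      have : 2 * ((k + 1 - 1) * (δ + 1)) + 4 * δ ≤ 3 * M + 2 := by
        rw [Nat.add_sub_cancel]; nlinarith
      rcases Nat.eq_zero_or_pos δ with h3 | h3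
      · subst h3; omega
      · omega
    have h3 : ((n:ℝ) - 1) * (δ + 1) ≤ 2 * M := by
      have : (((n - 1) * (δ + 1) : ℕ) : ℝ) ≤ ((2 * M : ℕ) : ℝ) := by exact_mod_cast h2
      push_cast [Nat.cast_sub hn] at this
      exact this
    have hM0 : (0:ℝ) < M := by exact_mod_cast h0
    rw [div_le_div_iff₀ hM0 (by positivity)]
    exact h3

lemma vsum_le {X a b δ : ℕ} {r : List ℕ} (hab : a + b = δ) (hr : ∀ e ∈ r, δ + 2 ≤ e)
    (hT : T r + 2 * δ + 5 = 3 * X) :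
    splitSum (fun I _ => vq X a I) r ≤ (if a = 1 then (1:ℝ) else 0) + (if b = 1 then (1:ℝ) else 0)
      + 4 / ((δ:ℝ) + 1) + (if δ = 0 then (2:ℝ) else 0) := by
  have n1 := ite_nn (a = 1) (zero_le_one (α := ℝ))
  have n2 := ite_nn (b = 1) (zero_le_one (α := ℝ))
  have n3 := ite_nn (δ = 0) (zero_le_two (α := ℝ))
  have n4 : (0:ℝ) ≤ 4 / ((δ:ℝ) + 1) := by positivity
  by_cases hr0 : r = []
  · subst hr0
    simp only [splitSum, vq]
    by_cases h3 : 3 ∣ T [a]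
    swap
    · rw [if_neg h3]; linarith
    rw [if_pos h3]
    have hle := one_div_nat_le_one ((X - 3).choose (T [a] / 3 - 1))
    by_cases ha : a = 1
    · rw [if_pos ha]; linarith
    by_cases hb : b = 1
    · rw [if_pos hb]; linarith
    simp only [T_cons, T_nil] at *
    have key : X - 3 ≤ (X - 3).choose ((2 * a + 1 + 0) / 3 - 1) :=
      le_choose' _ _ (by omega) (by omega)
    have h1 := one_div_choose_le (X - 3) ((2 * a + 1 + 0) / 3 - 1) (m := X - 3) (by omega) key
    have h2 : 1 / ((X - 3 : ℕ) : ℝ) ≤ 4 / ((δ:ℝ) + 1) := by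
      have h4 : δ + 1 ≤ 4 * (X - 3) := by omega
      have h5 : (δ:ℝ) + 1 ≤ 4 * ((X - 3 : ℕ) : ℝ) := by exact_mod_cast h4
      have h6 : (0:ℝ) < ((X - 3 : ℕ) : ℝ) := by
        have : 0 < X - 3 := by omega
        exact_mod_cast this
      rw [div_le_div_iff₀ h6 (by positivity)]
      linarith
    linarith
  · have hn : 1 ≤ r.length := List.length_pos_iff.2 hr0
    have h1 : splitSum (fun I _ => vq X a I) r ≤ _ :=
      splitSum_le fun I J hp => vq_le (b := b) hab hr hr0 hT hp
    rw [splitSum_len' (fun i => kq δ r.length (X - 3 - r.length) a b i)] at h1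
    have h2 := kq_sum δ r.length (X - 3 - r.length) a b hn
    have h3 := T_ge hr
    have h4 := mid_bound (δ := δ) (X := X) hn (by nlinarith)
    have h5 : 4 / ((δ:ℝ) + 1) = 2 / ((δ:ℝ) + 1) + 2 / ((δ:ℝ) + 1) := by ring
    linarith

lemma vsum_total {X δ : ℕ} {r : List ℕ} (hr : ∀ e ∈ r, δ + 2 ≤ e)
    (hT : T r + 2 * δ + 5 = 3 * X) :
    ∑ a ∈ Finset.range (δ + 1), splitSum (fun I _ => vq X a I) r ≤ 6 := by
  rcases Nat.eq_zero_or_pos δ with h0 | h0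
  · subst h0
    have := vsum_le (a := 0) (b := 0) (X := X) (δ := 0) rfl hr hT
    simp at this ⊢
    linarith
  · have h1 : ∑ a ∈ Finset.range (δ + 1), splitSum (fun I _ => vq X a I) r ≤
        ∑ a ∈ Finset.range (δ + 1), ((if a = 1 then (1:ℝ) else 0) + (if δ - a = 1 then (1:ℝ) else 0)
          + 4 / ((δ:ℝ) + 1)) := by
      refine Finset.sum_le_sum fun a ha => ?_
      rw [Finset.mem_range] at ha
      have := vsum_le (a := a) (b := δ - a) (X := X) (δ := δ) (by omega) hr hT
      rw [if_neg (by omega : ¬ δ = 0), add_zero] at this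
      exact this
    refine h1.trans ?_
    simp only [Finset.sum_add_distrib, Finset.sum_const, Finset.card_range, nsmul_eq_mul]
    have h2 := sum_ite_le_one (δ + 1) (fun i => i = 1) 1 (fun i h => h) True (fun _ _ => trivial)
      (zero_le_one (α := ℝ))
    have h3 := sum_ite_le_one (δ + 1) (fun i => δ - i = 1) (δ - 1) (fun i h => by omega) True
      (fun _ _ => trivial) (zero_le_one (α := ℝ))
    rw [if_pos trivial] at h2 h3
    have h4 : ((δ + 1 : ℕ) : ℝ) * (4 / ((δ:ℝ) + 1)) = 4 := by push_cast; field_simp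
    linarith

lemma qt_eq_vq {X a b : ℕ} {I J : List ℕ} (hX : 3 ≤ X) (hT : T (a :: I) + T (b :: J) + 3 = 3 * X) :
    qt C X a b I J = vq X a I / (6 * (((X:ℝ) - 1) * ((X:ℝ) - 2))) * (C (a :: I) : ℝ) * (C (b :: J) : ℝ) := by
  rw [qt, vq]
  split_ifs with h3
  swap
  · simp
  obtain ⟨x, hx⟩ := h3
  have hx0 : 0 < T (a :: I) := by simp
  have hy0 : 0 < T (b :: J) := by simp
  obtain ⟨p, hp⟩ : ∃ p, T (a :: I) / 3 - 1 = p := ⟨_, rfl⟩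
  obtain ⟨q, hq⟩ : ∃ q, T (b :: J) / 3 - 1 = q := ⟨_, rfl⟩
  rw [hp, hq]
  have hpq : X = p + q + 3 := by omega
  subst hpq
  have h1 : (p + q + 3 - 1).factorial = (p + q + 2) * ((p + q + 1) * (p + q).factorial) := by
    rw [show p + q + 3 - 1 = (p + q + 1) + 1 by omega, Nat.factorial_succ, Nat.factorial_succ]
  have h2 := Nat.add_choose_mul_factorial_mul_factorial p q
  rw [← Nat.choose_symm_add] at h2
  rw [h1, show p + q + 3 - 3 = p + q by omega, ← h2]
  have c0 : (0:ℝ) < (p + q).choose p := by exact_mod_cast Nat.choose_pos (by omega)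
  have f1 : (0:ℝ) < p.factorial := by exact_mod_cast Nat.factorial_pos p
  have f2 : (0:ℝ) < q.factorial := by exact_mod_cast Nat.factorial_pos q
  have e1 : ((p + q + 3 : ℕ) : ℝ) - 1 = p + q + 2 := by push_cast; ring
  have e2 : ((p + q + 3 : ℕ) : ℝ) - 2 = p + q + 1 := by push_cast; ring
  rw [e1, e2]
  push_cast
  have g1 : (0:ℝ) < p + q + 2 := by positivity
  have g2 : (0:ℝ) < p + q + 1 := by positivity
  field_simp

lemma quad_gen (hC : IsNormalizedWitten C) {X δ : ℕ} {r : List ℕ} {R : ℝ} (hR0 : 0 ≤ R) (hX : 3 ≤ X)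
    (hr : ∀ e ∈ r, δ + 2 ≤ e)
    (hT : T r + 2 * δ + 5 = 3 * X)
    (hR : ∀ a I J, a ≤ δ → (I ++ J).Perm r → (C (a :: I) : ℝ) ≤ R) :
    ∑ a ∈ Finset.range (δ + 1), splitSum (qt C X a (δ - a)) r ≤ R ^ 2 / (((X:ℝ) - 1) * ((X:ℝ) - 2)) := by
  have hX' : (3:ℝ) ≤ X := by exact_mod_cast hX
  have hD : 0 < ((X:ℝ) - 1) * ((X:ℝ) - 2) := mul_pos (by linarith) (by linarith)
  obtain ⟨D, hDd⟩ : ∃ D, D = ((X:ℝ) - 1) * ((X:ℝ) - 2) := ⟨_, rfl⟩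
  rw [← hDd] at hD ⊢
  calc _ ≤ ∑ a ∈ Finset.range (δ + 1), R ^ 2 / (6 * D) * splitSum (fun I _ => vq X a I) r := by
        refine Finset.sum_le_sum fun a ha => ?_
        rw [Finset.mem_range] at ha
        rw [← splitSum_mul]
        refine splitSum_le fun I J hp => ?_
        have hTp := T_perm hp
        rw [T_append] at hTp
        rw [qt_eq_vq hX (by simp; omega), ← hDd]
        have h1 := hR a I J (by omega) hp
        have h2 := hR (δ - a) J I (by omega) (List.perm_append_comm.trans hp)
        have h3 := C_nn hC a I
        have h4 := C_nn hC (δ - a) J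
        have h5 : 0 ≤ vq X a I := by
          rw [vq]; exact ite_nn _ (by positivity)
        have h6 := mul_le_mul h1 h2 h4 hR0
        have h7 : 0 ≤ vq X a I / (6 * D) := by positivity
        calc _ = vq X a I / (6 * D) * ((C (a :: I) : ℝ) * (C ((δ - a) :: J) : ℝ)) := by ring
          _ ≤ vq X a I / (6 * D) * (R * R) := mul_le_mul_of_nonneg_left h6 h7
          _ = _ := by ring
    _ = R ^ 2 / (6 * D) * ∑ a ∈ Finset.range (δ + 1), splitSum (fun I _ => vq X a I) r := by
        rw [Finset.mul_sum]
    _ ≤ R ^ 2 / (6 * D) * 6 := mul_le_mul_of_nonneg_left (vsum_total hr hT) (by positivity)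
    _ = _ := by field_simp

lemma sum_weight0 (r : List ℕ) : (r.map (fun d : ℕ => if 1 ≤ d then 2 * (d:ℝ) + 1 else 0)).sum
    = (T r : ℝ) - (r.count 0 : ℝ) := by
  induction r with
  | nil => simp
  | cons e l ih =>
    rw [List.map_cons, List.sum_cons, ih, T_cons, List.count_cons]
    rcases Nat.eq_zero_or_pos e with rfl | he
    · simp; ring
    · rw [if_pos (show 1 ≤ e from he)]
      have : (e == 0) = false := by simp; omega
      simp [this]; ring

lemma string_le (hC : IsNormalizedWitten C) {x : ℕ} {r : List ℕ} {K : ℝ} (hT : T (0 :: r) = 3 * x)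
    (hx : 2 ≤ x) (hK : ∀ d l, (d :: l).Perm r → 1 ≤ d → (C ((d - 1) :: l) : ℝ) ≤ K) :
    3 * ((x:ℝ) - 1) * (C (0 :: r) : ℝ) ≤ ((T r : ℝ) - (r.count 0 : ℝ)) * K := by
  rw [string_eq hC hT hx, ← sum_weight0, ← pickSum_weight, mul_comm, ← pickSum_mul]
  refine pickSum_le fun d l hp => ?_
  rw [mt, zero_add]
  split_ifs with h
  · rw [mul_comm K]
    exact mul_le_mul_of_nonneg_left (hK d l hp h) (by positivity)
  · simp

lemma string_ge (hC : IsNormalizedWitten C) {x : ℕ} {r : List ℕ} {K : ℝ} (hT : T (0 :: r) = 3 * x)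
    (hx : 2 ≤ x) (hK : ∀ d l, (d :: l).Perm r → 1 ≤ d → K ≤ (C ((d - 1) :: l) : ℝ)) :
    ((T r : ℝ) - (r.count 0 : ℝ)) * K ≤ 3 * ((x:ℝ) - 1) * (C (0 :: r) : ℝ) := by
  rw [string_eq hC hT hx, ← sum_weight0, ← pickSum_weight, mul_comm, ← pickSum_mul]
  refine pickSum_le fun d l hp => ?_
  rw [mt, zero_add]
  split_ifs with h
  · rw [mul_comm K]
    exact mul_le_mul_of_nonneg_left (hK d l hp h) (by positivity)
  · simp

lemma merge_le {d₁ : ℕ} {r : List ℕ} {K : ℝ} (h1 : 1 ≤ d₁)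
    (hK : ∀ d l, (d :: l).Perm r → (C ((d₁ + d - 1) :: l) : ℝ) ≤ K) :
    pickSum (mt C d₁) r ≤ (T r : ℝ) * K := by
  rw [← sum_weight, ← pickSum_weight, mul_comm, ← pickSum_mul]
  refine pickSum_le fun d l hp => ?_
  rw [mt, if_pos (by omega), mul_comm K]
  exact mul_le_mul_of_nonneg_left (hK d l hp) (by positivity)

lemma merge_ge {d₁ : ℕ} {r : List ℕ} {K : ℝ} (h1 : 1 ≤ d₁)
    (hK : ∀ d l, (d :: l).Perm r → K ≤ (C ((d₁ + d - 1) :: l) : ℝ)) :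
    (T r : ℝ) * K ≤ pickSum (mt C d₁) r := by
  rw [← sum_weight, ← pickSum_weight, mul_comm, ← pickSum_mul]
  refine pickSum_le fun d l hp => ?_
  rw [mt, if_pos (by omega), mul_comm K]
  exact mul_le_mul_of_nonneg_left (hK d l hp) (by positivity)

lemma count_zero_of {r : List ℕ} (h : ∀ e ∈ r, 1 ≤ e) : r.count 0 = 0 := by
  rw [List.count_eq_zero]
  intro h0
  have := h 0 h0
  omega

/-- string bound when all other entries are at least two -/
lemma zero_two (hC : IsNormalizedWitten C) {x : ℕ} {r : List ℕ} {S : ℝ} (hT : T (0 :: r) = 3 * x)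
    (hx : 2 ≤ x) (hr : ∀ e ∈ r, 2 ≤ e)
    (hS : ∀ t : List ℕ, t ≠ [] → (∀ e ∈ t, 1 ≤ e) → t.length ≤ r.length → T t + 3 = 3 * x → (C t : ℝ) ≤ S) :
    (C (0 :: r) : ℝ) ≤ (1 + 2 / 3 / ((x:ℝ) - 1)) * S := by
  have h1 := string_le hC (K := S) hT hx (fun d l hp hd => by
    have hTp := T_perm hp
    have hl := hp.length_eq
    have hd2 := hr d (hp.subset List.mem_cons_self)
    apply hS
    · simp
    · intro e he
      rcases List.mem_cons.1 he with rfl | he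
      · omega
      · have := hr e (hp.subset (List.mem_cons_of_mem _ he))
        omega
    · simp at hl ⊢; omega
    · simp at hT hTp ⊢; omega)
  rw [count_zero_of fun e he => (by norm_num : 1 ≤ 2).trans (hr e he)] at h1
  have hx' : (2:ℝ) ≤ x := by exact_mod_cast hx
  have hTr : (T r : ℝ) = 3 * x - 1 := by
    have : T r + 1 = 3 * x := by simp at hT; omega
    have : (T r : ℝ) + 1 = 3 * x := by exact_mod_cast this
    linarith
  rw [hTr] at h1
  have h2 : (1 + 2 / 3 / ((x:ℝ) - 1)) * S = (3 * x - 1 - ((0:ℕ):ℝ)) * S / (3 * ((x:ℝ) - 1)) := by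
    have : (x:ℝ) - 1 ≠ 0 := by linarith
    push_cast; field_simp; ring
  rw [h2, le_div_iff₀ (by linarith)]
  linarith

/-- hypothesis on the comparison class -/
def BS (C : List ℕ → ℚ) (X n : ℕ) (S : ℝ) : Prop :=
  ∀ t : List ℕ, t ≠ [] → (∀ e ∈ t, 1 ≤ e) → t.length ≤ n → T t < 3 * X → 3 * X ≤ T t + 12 →
    (C t : ℝ) ≤ S

lemma bdry2 (hC : IsNormalizedWitten C) {X δ : ℕ} {r : List ℕ} {S : ℝ} (hδ : 2 ≤ δ) (hX : 3 ≤ X)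
    (hr : ∀ e ∈ r, δ + 2 ≤ e) (hT : T r + 2 * δ + 5 = 3 * X) (hS : BS C X (r.length + 1) S) :
    (C (0 :: δ :: r) : ℝ) ≤ (1 + 2 / 3 / ((X:ℝ) - 2)) * S := by
  have h := zero_two hC (x := X - 1) (r := δ :: r) (S := S) (by simp; omega) (by omega) (by
    intro e he
    rcases List.mem_cons.1 he with rfl | he
    · exact hδ
    · have := hr e he; omega) (fun t h1 h2 h3 h4 => hS t h1 h2 (by simpa using h3) (by omega) (by omega))
  rw [Nat.cast_sub (by omega)] at h
  convert h using 4
  push_cast; ring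

lemma bdry1 (hC : IsNormalizedWitten C) {X : ℕ} {r : List ℕ} {S : ℝ}
    (hr : ∀ e ∈ r, 3 ≤ e) (hT : T r + 7 = 3 * X) (hS : BS C X (r.length + 1) S) :
    5 ≤ X ∧ (C (0 :: 1 :: r) : ℝ) ≤ (1 + 2 / 3 / ((X:ℝ) - 3)) * S := by
  have hX : 5 ≤ X := by
    have := T_ge hr
    rcases r with _ | ⟨a, _ | ⟨b, r⟩⟩
    · simp at hT; omega
    · simp at hT this; omega
    · simp at hT this; omega
  refine ⟨hX, ?_⟩
  rw [C_perm hC (List.Perm.swap 1 0 r), dilaton hC (by simp)]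
  have h := zero_two hC (x := X - 2) (r := r) (S := S) (by simp; omega) (by omega)
    (fun e he => by have := hr e he; omega)
    (fun t h1 h2 h3 h4 => hS t h1 h2 (by omega) (by omega) (by omega))
  rw [Nat.cast_sub (by omega)] at h
  convert h using 4
  push_cast; ring

lemma bdry0 (hC : IsNormalizedWitten C) {X : ℕ} {r : List ℕ} {S : ℝ} (hS0 : 0 ≤ S)
    (hr : ∀ e ∈ r, 2 ≤ e) (hT : T r + 5 = 3 * X) (hS : BS C X (r.length + 1) S) :
    4 ≤ X ∧ (C (0 :: 0 :: r) : ℝ) ≤ (1 + 1 / 3 / ((X:ℝ) - 2)) *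
      ((1 + 2 / 3 / (if X = 4 then (1:ℝ) else (X:ℝ) - 4)) * S) := by
  have hr1 : 1 ≤ r.length := by
    rcases r with _ | ⟨a, r⟩
    · simp at hT; omega
    · simp
  have hX : 4 ≤ X := by
    have := T_ge hr
    rcases r with _ | ⟨a, _ | ⟨b, r⟩⟩
    · simp at hT; omega
    · simp at hT this; omega
    · simp at hT this; omega
  refine ⟨hX, ?_⟩
  have hX' : (4:ℝ) ≤ X := by exact_mod_cast hX
  have h1 := string_le hC (x := X - 1) (r := 0 :: r)
    (K := (1 + 2 / 3 / (if X = 4 then (1:ℝ) else (X:ℝ) - 4)) * S) (by simp; omega) (by omega) (by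
    intro d l hp hd
    -- d :: l ~ 0 :: r
    have h0 : (0:ℕ) ∈ l := by
      have : (0:ℕ) ∈ d :: l := hp.symm.subset List.mem_cons_self
      rcases List.mem_cons.1 this with h | h
      · omega
      · exact h
    obtain ⟨l', hl'⟩ : ∃ l', l.Perm (0 :: l') := ⟨_, List.perm_cons_erase h0⟩
    have hp2 : (d :: l').Perm r := by
      have : (0 :: d :: l').Perm (0 :: r) :=
        ((List.Perm.swap d 0 l').trans ((hl'.cons d).symm)).trans hp
      exact (List.perm_cons 0).1 this
    have hd2 : 2 ≤ d := hr d (hp2.subset List.mem_cons_self)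
    have hl2 : ∀ e ∈ l', 2 ≤ e := fun e he => hr e (hp2.subset (List.mem_cons_of_mem _ he))
    have hTp := T_perm hp2
    have hlen := hp2.length_eq
    rw [C_perm hC ((hl'.cons (d-1)).trans (List.Perm.swap 0 (d-1) l'))]
    simp only [T_cons, List.length_cons] at hTp hlen
    rcases Nat.eq_or_lt_of_le hd2 with hd3 | hd3
    · subst hd3
      rw [C_perm hC (List.Perm.swap (2-1) 0 l'), show (2 - 1 : ℕ) = 1 by rfl, dilaton hC (by simp)]
      have hX5 : 5 ≤ X := by
        have h9 := T_ge hl2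
        rcases l' with _ | ⟨a, _ | ⟨b, r⟩⟩
        · simp at hTp; omega
        · simp at hTp h9; omega
        · simp at hTp h9; omega
      have h := zero_two hC (x := X - 3) (r := l') (S := S) (by simp; omega) (by omega) hl2
        (fun t h1 h2 h3 h4 => hS t h1 h2 (by omega) (by omega) (by omega))
      rw [if_neg (by omega)]
      rw [Nat.cast_sub (by omega)] at h
      convert h using 4
      push_cast; ring
    · have h := zero_two hC (x := X - 2) (r := (d - 1) :: l') (S := S) (by simp; omega) (by omega)
        (by
          intro e he
          rcases List.mem_cons.1 he with rfl | he
          · omega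
          · exact hl2 e he)
        (fun t h1 h2 h3 h4 => hS t h1 h2 (by simp at h3; omega) (by omega) (by omega))
      refine h.trans ?_
      apply mul_le_mul_of_nonneg_right _ hS0
      rw [Nat.cast_sub (by omega)]
      push_cast
      have : 2 / 3 / ((X:ℝ) - 2 - 1) ≤ 2 / 3 / (if X = 4 then (1:ℝ) else (X:ℝ) - 4) := by
        split_ifs with h4
        · subst h4; norm_num
        · have : 5 ≤ X := by omega
          have : (5:ℝ) ≤ X := by exact_mod_cast this
          exact div_le_div_of_nonneg_left (by norm_num) (by linarith) (by linarith)
      linarith)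
  obtain ⟨K, hK⟩ : ∃ K, K = (1 + 2 / 3 / (if X = 4 then (1:ℝ) else (X:ℝ) - 4)) * S := ⟨_, rfl⟩
  rw [← hK] at h1 ⊢
  have hc : (0 :: r).count 0 = 1 := by
    rw [List.count_cons_self, count_zero_of fun e he => (by norm_num : 1 ≤ 2).trans (hr e he)]
  rw [hc, Nat.cast_sub (by omega)] at h1
  have hTr : (T (0 :: r) : ℝ) = 3 * X - 4 := by
    have : T (0 :: r) + 4 = 3 * X := by simp; omega
    have : (T (0 :: r) : ℝ) + 4 = 3 * X := by exact_mod_cast this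
    linarith
  rw [hTr] at h1
  have h2 : (1 + 1 / 3 / ((X:ℝ) - 2)) * K = (3 * X - 4 - 1) * K / (3 * ((X:ℝ) - 2)) := by
    have : (X:ℝ) - 2 ≠ 0 := by linarith
    field_simp; ring
  rw [h2, le_div_iff₀ (by linarith)]
  push_cast at h1
  linarith

/-- global bound below level X -/
def HB (C : List ℕ → ℚ) (X : ℕ) (S : ℝ) : Prop :=
  ∀ t : List ℕ, t ≠ [] → (∀ e ∈ t, 1 ≤ e) → T t < 3 * X → (C t : ℝ) ≤ S

lemma HB.toBS {X : ℕ} {S : ℝ} (h : HB C X S) (n : ℕ) : BS C X n S :=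
  fun t h1 h2 _ h4 _ => h t h1 h2 h4

lemma sum_ends {δ : ℕ} (hδ : 1 ≤ δ) (f : ℕ → ℝ) :
    ∑ a ∈ Finset.range (δ + 1), f a = f 0 + f δ + ∑ a ∈ Finset.range (δ - 1), f (a + 1) := by
  obtain ⟨k, rfl⟩ : ∃ k, δ = k + 1 := ⟨δ - 1, by omega⟩
  rw [Finset.sum_range_succ, Finset.sum_range_succ', Nat.add_sub_cancel]
  ring

/-- bound for the pieces in the quadratic term -/
lemma piece_le (hC : IsNormalizedWitten C) {X δ a : ℕ} {r I J : List ℕ} {S : ℝ} (hS0 : 0 ≤ S)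
    (hr : ∀ e ∈ r, δ + 2 ≤ e) (hT : T r + 2 * δ + 5 = 3 * X) (hB : HB C X S)
    (ha : a ≤ δ) (hp : (I ++ J).Perm r) : (C (a :: I) : ℝ) ≤ 5 / 3 * S := by
  have hTp := T_perm hp
  rw [T_append] at hTp
  have hI : ∀ e ∈ I, δ + 2 ≤ e := fun e he => hr e (hp.subset (List.mem_append_left _ he))
  rcases Nat.eq_zero_or_pos a with rfl | h0
  · by_cases h3 : 3 ∣ T (0 :: I)
    swap
    · rw [C_not_dvd hC h3]; push_cast; positivity
    obtain ⟨x, hx⟩ := h3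
    have hx2 : 2 ≤ x := by
      by_contra h
      have hx1 : x = 0 ∨ x = 1 := by omega
      have h2 := T_ge hI
      rcases hx1 with rfl | rfl
      · simp at hx
      · rcases I with _ | ⟨b, I⟩
        · simp at hx
        · simp only [T_cons, List.length_cons] at hx h2
          nlinarith
    have h := zero_two hC hx hx2 (fun e he => by have := hI e he; omega)
      (fun t h1 h2 h3 h4 => hB t h1 h2 (by simp at hx; omega))
    refine h.trans (mul_le_mul_of_nonneg_right ?_ hS0)
    have hx' : (2:ℝ) ≤ x := by exact_mod_cast hx2
    have : 2 / 3 / ((x:ℝ) - 1) ≤ 2 / 3 / 1 := div_le_div_of_nonneg_left (by norm_num) (by norm_num) (by linarith)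
    linarith
  · have := hB (a :: I) (by simp) (by
      intro e he
      rcases List.mem_cons.1 he with rfl | he
      · exact h0
      · have := hI e he; omega) (by simp; omega)
    linarith

lemma quad_HB (hC : IsNormalizedWitten C) {X δ : ℕ} {r : List ℕ} {S : ℝ} (hS0 : 0 ≤ S) (hX : 3 ≤ X)
    (hr : ∀ e ∈ r, δ + 2 ≤ e) (hT : T r + 2 * δ + 5 = 3 * X) (hB : HB C X S) :
    ∑ a ∈ Finset.range (δ + 1), splitSum (qt C X a (δ - a)) r
      ≤ 25 / 9 * S ^ 2 / (((X:ℝ) - 1) * ((X:ℝ) - 2)) := by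
  have := quad_gen hC (R := 5 / 3 * S) (by positivity) hX hr hT
    (fun a I J ha hp => piece_le hC hS0 hr hT hB ha hp)
  convert this using 2
  ring

/-- excess constants -/
def cX (X : ℕ) : ℝ := if X = 3 then 8/9 else if X = 4 then 4/3 else if X = 5 then 12/7 else 32/27

lemma cX_ge (X : ℕ) : 8/9 ≤ cX X := by unfold cX; split_ifs <;> norm_num
lemma cX_ge4 (X : ℕ) (h : X ≠ 3) : 32/27 ≤ cX X := by unfold cX; rw [if_neg h]; split_ifs <;> norm_num
lemma cX_5 : cX 5 = 12/7 := by norm_num [cX]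
lemma cX_4 : cX 4 = 4/3 := by norm_num [cX]
lemma cX_3 : cX 3 = 8/9 := by norm_num [cX]
lemma cX_6 {X : ℕ} (h : 6 ≤ X) : cX X = 32/27 := by
  unfold cX; rw [if_neg (by omega), if_neg (by omega), if_neg (by omega)]

/-- expanded DVV for least entry δ+2 -/
lemma dvv2 (hC : IsNormalizedWitten C) {X δ : ℕ} {r : List ℕ} (hX : 3 ≤ X)
    (hT : T r + 2 * δ + 5 = 3 * X) :
    3 * ((X:ℝ) - 1) * (C ((δ + 2) :: r) : ℝ) = pickSum (mt C (δ + 2)) r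
      + 2 * ∑ a ∈ Finset.range (δ + 1), (C (a :: (δ - a) :: r) : ℝ)
      + 3 * ((X:ℝ) - 1) * ∑ a ∈ Finset.range (δ + 1), splitSum (qt C X a (δ - a)) r := by
  have h := dvvU hC (d₁ := δ + 2) (r := r) (X := X) (by simp; omega) (by omega)
  rw [h, Finset.sum_add_distrib, Finset.mul_sum, Finset.mul_sum, show δ + 2 - 1 = δ + 1 by omega,
    show δ + 2 - 2 = δ by omega]
  ring

/-- boundary contribution bound -/
lemma lin_le (hC : IsNormalizedWitten C) {X δ : ℕ} {r : List ℕ} {S : ℝ} (hS0 : 0 ≤ S) (hX : 3 ≤ X)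
    (hr : ∀ e ∈ r, δ + 2 ≤ e) (hT : T r + 2 * δ + 5 = 3 * X) (hB : HB C X S) :
    2 * ∑ a ∈ Finset.range (δ + 1), (C (a :: (δ - a) :: r) : ℝ) ≤ (2 * δ + 2) * S
      + 3 * cX X / ((X:ℝ) - 2) * S := by
  have hX' : (3:ℝ) ≤ X := by exact_mod_cast hX
  have hBS := hB.toBS (r.length + 1)
  rcases Nat.eq_zero_or_pos δ with rfl | hδ
  · obtain ⟨h4, h⟩ := bdry0 hC hS0 hr (by omega) hBS
    have : ∑ a ∈ Finset.range (0 + 1), (C (a :: (0 - a) :: r) : ℝ) = C (0 :: 0 :: r) := by simp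
    rw [this]
    have key : 2 * ((1 + 1 / 3 / ((X:ℝ) - 2)) * (1 + 2 / 3 / (if X = 4 then (1:ℝ) else (X:ℝ) - 4)))
        ≤ 2 + 3 * cX X / ((X:ℝ) - 2) := by
      by_cases h44 : X = 4
      · subst h44; rw [cX_4]; norm_num
      by_cases h55 : X = 5
      · subst h55; rw [cX_5]; norm_num
      have h6 : 6 ≤ X := by omega
      have h6' : (6:ℝ) ≤ X := by exact_mod_cast h6
      rw [cX_6 h6, if_neg h44]
      obtain ⟨y, hy⟩ : ∃ y : ℝ, (X:ℝ) = y + 6 := ⟨X - 6, by ring⟩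
      have hy0 : 0 ≤ y := by linarith
      rw [hy, show y + 6 - 2 = y + 4 by ring, show y + 6 - 4 = y + 2 by ring]
      rw [← sub_nonneg]
      have : 2 + 3 * (32 / 27) / (y + 4) - 2 * ((1 + 1 / 3 / (y + 4)) * (1 + 2 / 3 / (y + 2)))
        = (14 * y + 4 * 0) / (9 * ((y + 4) * (y + 2))) := by
          field_simp
          ring
      rw [this]
      positivity
    have := mul_le_mul_of_nonneg_right key hS0
    push_cast
    linarith
  · rw [sum_ends hδ]
    have hsw : (C (δ :: (δ - δ) :: r) : ℝ) = C (0 :: δ :: r) := by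
      rw [Nat.sub_self]; exact C_perm hC (List.Perm.swap 0 δ r)
    rw [hsw, Nat.sub_zero]
    have hinterior : ∑ a ∈ Finset.range (δ - 1), (C ((a + 1) :: (δ - (a + 1)) :: r) : ℝ) ≤ ((δ:ℝ) - 1) * S := by
      have : ∑ a ∈ Finset.range (δ - 1), (C ((a + 1) :: (δ - (a + 1)) :: r) : ℝ)
          ≤ ∑ a ∈ Finset.range (δ - 1), S := by
        refine Finset.sum_le_sum fun a ha => ?_
        rw [Finset.mem_range] at ha
        refine hB _ (by simp) ?_ (by simp; omega)
        intro e he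
        simp only [List.mem_cons] at he
        rcases he with rfl | rfl | he
        · omega
        · omega
        · have := hr e he; omega
      rw [Finset.sum_const, Finset.card_range, nsmul_eq_mul, Nat.cast_sub hδ] at this
      push_cast at this
      exact this
    have key : (C (0 :: δ :: r) : ℝ) ≤ (1 + 3 / 4 * cX X / ((X:ℝ) - 2)) * S := by
      rcases Nat.eq_or_lt_of_le hδ with h1 | h1
      · have h1' : δ = 1 := h1.symm
        subst h1'
        obtain ⟨h5, h⟩ := bdry1 hC hr (by omega) hBS
        refine h.trans (mul_le_mul_of_nonneg_right ?_ hS0)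
        have h5' : (5:ℝ) ≤ X := by exact_mod_cast h5
        have : 2 / 3 / ((X:ℝ) - 3) ≤ 3 / 4 * cX X / ((X:ℝ) - 2) := by
          rw [div_le_div_iff₀ (by linarith) (by linarith)]
          by_cases h55 : X = 5
          · subst h55; rw [cX_5]; norm_num
          · have h6 : 6 ≤ X := by omega
            have h6' : (6:ℝ) ≤ X := by exact_mod_cast h6
            rw [cX_6 h6]; linarith
        linarith
      · have h := bdry2 hC h1 hX hr hT hBS
        refine h.trans (mul_le_mul_of_nonneg_right ?_ hS0)
        have : 2 / 3 / ((X:ℝ) - 2) ≤ 3 / 4 * cX X / ((X:ℝ) - 2) := by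
          apply div_le_div_of_nonneg_right _ (by linarith)
          have := cX_ge X
          linarith
        linarith
    have e1 : (1 + 3 / 4 * cX X / ((X:ℝ) - 2)) * S = S + (3 * cX X / ((X:ℝ) - 2) * S) / 4 := by ring
    rw [e1] at key
    linarith

lemma bd_step (hC : IsNormalizedWitten C) {X δ : ℕ} {r : List ℕ} {S : ℝ} (hS0 : 0 ≤ S) (hX : 3 ≤ X)
    (hr : ∀ e ∈ r, δ + 2 ≤ e) (hT : T r + 2 * δ + 5 = 3 * X) (hB : HB C X S) :
    (C ((δ + 2) :: r) : ℝ) ≤ S + (cX X * S + 25 / 9 * S ^ 2) / (((X:ℝ) - 1) * ((X:ℝ) - 2)) := by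
  have hX' : (3:ℝ) ≤ X := by exact_mod_cast hX
  have h := dvv2 hC hX hT
  have h1 : pickSum (mt C (δ + 2)) r ≤ (T r : ℝ) * S := merge_le (by omega) (fun d l hp => by
    have hTp := T_perm hp
    rw [T_cons] at hTp
    refine hB _ (by simp) ?_ (by simp; omega)
    intro e he
    rcases List.mem_cons.1 he with rfl | he
    · omega
    · have := hr e (hp.subset (List.mem_cons_of_mem _ he)); omega)
  have h2 := lin_le hC hS0 hX hr hT hB
  have h3 := quad_HB hC hS0 hX hr hT hB
  have hTr : (T r : ℝ) = 3 * X - 5 - 2 * δ := by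
    have : (T r : ℝ) + 2 * δ + 5 = 3 * X := by exact_mod_cast hT
    linarith
  rw [hTr] at h1
  have p1 : 0 < (X:ℝ) - 1 := by linarith
  have p2 : 0 < (X:ℝ) - 2 := by linarith
  have h4 := mul_le_mul_of_nonneg_left h3 (by linarith : 0 ≤ 3 * ((X:ℝ) - 1))
  have h5 : 3 * ((X:ℝ) - 1) * (C ((δ + 2) :: r) : ℝ) ≤
      3 * ((X:ℝ) - 1) * (S + (cX X * S + 25 / 9 * S ^ 2) / (((X:ℝ) - 1) * ((X:ℝ) - 2))) := by
    have e1 : 3 * ((X:ℝ) - 1) * (S + (cX X * S + 25 / 9 * S ^ 2) / (((X:ℝ) - 1) * ((X:ℝ) - 2)))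
      = 3 * ((X:ℝ) - 1) * S + 3 * cX X / ((X:ℝ) - 2) * S +
        3 * ((X:ℝ) - 1) * (25 / 9 * S ^ 2 / (((X:ℝ) - 1) * ((X:ℝ) - 2))) := by
      field_simp
      ring
    rw [e1]
    linarith
  exact le_of_mul_le_mul_left h5 (by linarith)

lemma HB_succ (hC : IsNormalizedWitten C) {X : ℕ} {S S' : ℝ} (hS0 : 0 ≤ S) (hX : 2 ≤ X)
    (hB : HB C X S) (h1 : S ≤ S')
    (h2 : 3 ≤ X → S + (cX X * S + 25 / 9 * S ^ 2) / (((X:ℝ) - 1) * ((X:ℝ) - 2)) ≤ S') :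
    HB C (X + 1) S' := by
  intro t ht h0 hT
  by_cases hlt : T t < 3 * X
  · exact (hB t ht h0 hlt).trans h1
  by_cases h3 : 3 ∣ T t
  swap
  · rw [C_not_dvd hC h3]; push_cast; linarith
  have hTt : T t = 3 * X := by omega
  obtain ⟨d, r, hp, hmin⟩ := exists_min ht
  have hTp := T_perm hp
  rw [← C_perm hC hp]
  rw [T_cons, hTt] at hTp
  have hd1 : 1 ≤ d := h0 d (hp.subset List.mem_cons_self)
  rcases Nat.eq_or_lt_of_le hd1 with hd | hd
  · subst hd
    have hr : r ≠ [] := by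
      rintro rfl
      simp at hTp
      omega
    rw [dilaton hC hr]
    refine (hB r hr (fun e he => hmin e he) (by omega)).trans h1
  · obtain ⟨δ, rfl⟩ : ∃ δ, d = δ + 2 := ⟨d - 2, by omega⟩
    have hX3 : 3 ≤ X := by
      have := T_ge hmin
      rcases r with _ | ⟨a, r⟩
      · simp at hTp; omega
      · simp only [List.length_cons] at this; nlinarith
    exact (bd_step hC hS0 hX3 hmin (by omega) hB).trans (h2 hX3)

lemma HB_2 (hC : IsNormalizedWitten C) : HB C 2 (1/6) := by
  intro t ht h0 hT
  by_cases h3 : 3 ∣ T t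
  swap
  · rw [C_not_dvd hC h3]; norm_num
  have := T_pos ht
  rcases T_eq_three (by omega : T t = 3) with rfl | rfl
  · rw [hC.init1]; norm_num
  · have := h0 0 (by simp); omega

lemma HB_6 (hC : IsNormalizedWitten C) : HB C 6 (1 / (0.77 + 5.5 / (((6:ℕ):ℝ) - 2))) := by
  have h3 := HB_succ hC (by norm_num) (by norm_num) (HB_2 hC) (le_refl _) (by omega)
  have h4 := HB_succ hC (S' := 0.2794) (by norm_num) (by norm_num) h3 (by norm_num)
    (fun _ => by rw [cX_3]; norm_num)
  have h5 := HB_succ hC (S' := 0.3777) (by norm_num) (by norm_num) h4 (by norm_num)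
    (fun _ => by rw [cX_4]; norm_num)
  exact HB_succ hC (by norm_num) (by norm_num) h5 (by norm_num)
    (fun _ => by rw [cX_5]; norm_num)

lemma HB_all (hC : IsNormalizedWitten C) (X : ℕ) (hX : 6 ≤ X) :
    HB C X (1 / (0.77 + 5.5 / ((X:ℝ) - 2))) := by
  induction X, hX using Nat.le_induction with
  | base => exact HB_6 hC
  | succ X hX ih =>
    have hX' : (6:ℝ) ≤ X := by exact_mod_cast hX
    obtain ⟨y, hy⟩ : ∃ y : ℝ, (X:ℝ) = y + 6 := ⟨X - 6, by ring⟩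
    have hy0 : 0 ≤ y := by linarith
    push_cast
    rw [hy] at ih ⊢
    rw [show y + 6 - 2 = y + 4 by ring] at ih
    rw [show y + 6 + 1 - 2 = y + 5 by ring]
    have m1 : 5.5 / (y + 5) ≤ 5.5 / (y + 4) :=
      div_le_div_of_nonneg_left (by norm_num) (by linarith) (by linarith)
    have q0 : 0 < 5.5 / (y + 5) := by positivity
    refine HB_succ hC (by positivity) (by omega) ih ?_ fun _ => ?_
    · exact one_div_le_one_div_of_le (by linarith) (by linarith)
    · rw [cX_6 hX, hy, show y + 6 - 2 = y + 4 by ring, show y + 6 - 1 = y + 5 by ring]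
      obtain ⟨D, hD⟩ : ∃ D, D = 1 / ((y + 5) * (y + 4)) := ⟨_, rfl⟩
      have hD0 : 0 < D := by rw [hD]; positivity
      obtain ⟨u, hu⟩ : ∃ u : ℝ, u = 0.77 + 5.5 / (y + 4) := ⟨_, rfl⟩
      have e1 : 0.77 + 5.5 / (y + 5) = u - 5.5 * D := by
        rw [hu, hD]; field_simp; ring
      rw [← hu, e1]
      have hu1 : u ≤ 2.145 := by
        have : 5.5 / (y + 4) ≤ 5.5 / 4 :=
          div_le_div_of_nonneg_left (by norm_num) (by linarith) (by linarith)
        rw [hu]; linarith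
      have hu0 : 0 < u - 5.5 * D := by rw [← e1]; linarith
      have hu00 : 0 < u := by nlinarith
      have e2 : 1 / u + (32 / 27 * (1 / u) + 25 / 9 * (1 / u) ^ 2) / ((y + 5) * (y + 4))
          = (u + (32 / 27 * u + 25 / 9) * D) / u ^ 2 := by
        rw [hD]; field_simp
      rw [e2, div_le_div_iff₀ (by positivity) hu0]
      have h1 : (32 / 27 * u + 25 / 9) ≤ 5.5 := by linarith
      have h2 := mul_le_mul_of_nonneg_right h1 hD0.le
      have h3 : u + (32 / 27 * u + 25 / 9) * D ≤ u + 5.5 * D := by linarith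
      have h4 := mul_le_mul_of_nonneg_right h3 hu0.le
      nlinarith [sq_nonneg D]

/-- uniform bound on lists without zeros -/
theorem Z_bound (hC : IsNormalizedWitten C) {t : List ℕ} (ht : t ≠ []) (h1 : ∀ e ∈ t, 1 ≤ e) :
    (C t : ℝ) ≤ 4 / 3 := by
  have h := HB_all hC (T t + 6) (by omega) t ht h1 (by omega)
  refine h.trans ?_
  have : (0:ℝ) ≤ 5.5 / (((T t + 6 : ℕ) : ℝ) - 2) := by
    apply div_nonneg (by norm_num)
    push_cast; linarith [(Nat.cast_nonneg (T t) : (0:ℝ) ≤ T t)]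
  rw [div_le_div_iff₀ (by linarith) (by norm_num)]
  linarith

/-- bound depending on the number of zeros -/
def Kz (z : ℕ) : ℝ := if z = 0 then 4/3 else if z = 1 then 20/9 else 3

lemma Kz_le (z : ℕ) : Kz z ≤ 3 := by unfold Kz; split_ifs <;> norm_num
lemma Kz_ge (z : ℕ) : 4/3 ≤ Kz z := by unfold Kz; split_ifs <;> norm_num

lemma C_boundN (hC : IsNormalizedWitten C) (N : ℕ) : ∀ s : List ℕ, s ≠ [] → T s ≤ N →
    (C s : ℝ) ≤ Kz (s.count 0) := by
  induction N with
  | zero => intro s hs h; have := T_pos hs; omega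
  | succ N ih =>
    intro s hs h
    by_cases h3 : 3 ∣ T s
    swap
    · rw [C_not_dvd hC h3]; push_cast; linarith [Kz_ge (s.count 0)]
    obtain ⟨X, hX⟩ := h3
    have hpos := T_pos hs
    by_cases hX1 : X = 1
    · subst hX1
      have := Kz_ge (s.count 0)
      rcases T_eq_three hX with rfl | rfl
      · rw [hC.init1]; push_cast; linarith
      · rw [hC.init3]; push_cast; linarith
    by_cases hone : 1 ∈ s
    · have hp := List.perm_cons_erase hone
      obtain ⟨r, hr⟩ : ∃ r, r = s.erase 1 := ⟨_, rfl⟩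
      rw [← hr] at hp
      have hTp := T_perm hp
      rw [T_cons] at hTp
      have hr0 : r ≠ [] := by
        intro h0; rw [h0] at hTp; simp at hTp; omega
      have := ih r hr0 (by omega)
      rw [C_perm hC hp, dilaton hC hr0, hp.count_eq]
      simpa using this
    by_cases hz : 0 ∈ s
    swap
    · refine (Z_bound hC hs ?_).trans (Kz_ge _)
      intro e he
      rcases Nat.eq_zero_or_pos e with rfl | h0
      · exact absurd he hz
      · exact h0
    have hp := List.perm_cons_erase hz
    obtain ⟨r, hr⟩ : ∃ r, r = s.erase 0 := ⟨_, rfl⟩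
    rw [← hr] at hp
    have hTp := T_perm hp
    rw [hp.count_eq, C_perm hC hp, List.count_cons_self]
    obtain ⟨z, hz'⟩ : ∃ z, z = r.count 0 := ⟨_, rfl⟩
    have h1 := string_le hC (x := X) (r := r) (K := Kz z) (by omega) (by omega) (by
      intro d l hp2 hd
      have hTp2 := T_perm hp2
      have hd1 : d ≠ 1 := by
        rintro rfl
        exact hone (hp.symm.subset (List.mem_cons_of_mem _ (hp2.subset List.mem_cons_self)))
      have := ih ((d - 1) :: l) (by simp) (by simp at hTp hTp2 ⊢; omega)
      have hc : ((d - 1) :: l).count 0 = z := by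
        rw [hz', ← hp2.count_eq, List.count_cons_of_ne (by omega), List.count_cons_of_ne (by omega)]
      rwa [hc] at this)
    rw [← hz'] at h1 ⊢
    have hX2 : (2:ℝ) ≤ X := by
      have : 2 ≤ X := by omega
      exact_mod_cast this
    have hTr : (T r : ℝ) = 3 * X - 1 := by
      have : T r + 1 = 3 * X := by simp at hTp; omega
      have : (T r : ℝ) + 1 = 3 * X := by exact_mod_cast this
      linarith
    rw [hTr] at h1
    have h2 : 3 * ((X:ℝ) - 1) * (C (0 :: r) : ℝ) ≤ 3 * ((X:ℝ) - 1) * Kz (z + 1) := by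
      refine h1.trans ?_
      rcases z with _ | _ | z
      · simp [Kz]; linarith
      · simp [Kz]; linarith
      · have : Kz (z + 1 + 1) = 3 := by simp [Kz]
        have h3 : Kz (z + 1 + 1 + 1) = 3 := by simp [Kz]
        rw [this, h3]
        have : (0:ℝ) ≤ z := Nat.cast_nonneg z
        push_cast; linarith
    exact le_of_mul_le_mul_left h2 (by linarith)

theorem C_le (hC : IsNormalizedWitten C) {s : List ℕ} (hs : s ≠ []) : (C s : ℝ) ≤ 3 :=
  (C_boundN hC _ s hs le_rfl).trans (Kz_le _)

/-- one step of the comparison dynamics -/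
def Step (P : ℕ → List ℕ → Prop) (D : List ℕ → ℝ) (X0 : ℕ) (e : ℝ) : Prop :=
  ∀ X s, X0 < X → P X s → ∃ Pd Pu : ℝ, 0 ≤ Pd ∧ 0 ≤ Pu ∧ Pd + Pu ≤ 1 ∧
    1 - 1 / (s.length : ℝ) ≤ Pd ∧ 1 - 2 / (X : ℝ) ≤ Pd + Pu ∧
    ∀ α β : ℝ, 0 ≤ α → 0 ≤ β → (∀ s', P (X - 1) s' → s'.length + 1 = s.length → α ≤ D s') →
      (∀ s', P (X - 1) s' → s'.length = s.length + 1 → β ≤ D s') → Pd * α + Pu * β - e ≤ D s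

/-- the class condition -/
def Cls (P : ℕ → List ℕ → Prop) : Prop :=
  ∀ X s, P X s → s ≠ [] ∧ 3 * s.length ≤ 2 * X + 6 ∧ T s = 3 * X

lemma T_parity (s : List ℕ) : T s % 2 = s.length % 2 := by unfold T; omega

lemma phase2 {P : ℕ → List ℕ → Prop} {D : List ℕ → ℝ} {X0 : ℕ} {e : ℝ} (hP : Cls P)
    (hD : ∀ X s, X0 ≤ X → P X s → 0 ≤ D s) (hstep : Step P D X0 e) (he : 0 ≤ e) (hX0 : 4 ≤ X0)
    {s0 : ℕ} (hs0 : T [s0] = 3 * X0) {D0 : ℝ} (hD0 : 0 ≤ D0) (hD0' : D0 ≤ D [s0]) (j : ℕ) :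
    ∀ s, P (X0 + j) s → s.length ≤ j + 1 → (1/2:ℝ) ^ j * D0 - e * j ≤ D s := by
  induction j with
  | zero =>
    intro s hs hl
    obtain ⟨h1, h2, h3⟩ := hP _ _ hs
    have : s = [s0] := by
      rcases s with _ | ⟨a, _ | ⟨b, s⟩⟩
      · simp at h1
      · simp at h3 hs0 ⊢; omega
      · simp at hl
    subst this
    simpa using hD0'
  | succ j ih =>
    intro s hs hl
    obtain ⟨h1, h2, h3⟩ := hP _ _ hs
    have hn1 : 1 ≤ s.length := List.length_pos_iff.2 h1
    obtain ⟨Pd, Pu, p1, p2, p3, p4, p5, p6⟩ := hstep _ s (by omega) hs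
    have hXe : X0 + (j + 1) - 1 = X0 + j := by omega
    rw [hXe] at p6
    have q0 : 0 ≤ (1/2:ℝ) ^ j * D0 := by positivity
    obtain ⟨γ, hγ⟩ : ∃ γ, γ = max 0 ((1/2:ℝ) ^ j * D0 - e * j) := ⟨_, rfl⟩
    have hγ0 : 0 ≤ γ := hγ ▸ le_max_left _ _
    have hγ1 : (1/2:ℝ) ^ j * D0 - e * j ≤ γ := hγ ▸ le_max_right _ _
    have ej : 0 ≤ e * j := by positivity
    have fin : ∀ p : ℝ, 1/2 ≤ p → p ≤ 1 → p * γ - e ≤ D s →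
        (1/2:ℝ) ^ (j + 1) * D0 - e * ((j + 1 : ℕ) : ℝ) ≤ D s := by
      intro p hp1 hp2 hp3
      have h7 : p * ((1/2:ℝ) ^ j * D0 - e * j) ≤ p * γ := mul_le_mul_of_nonneg_left hγ1 (by linarith)
      have h8 : (1/2) * ((1/2:ℝ) ^ j * D0) ≤ p * ((1/2:ℝ) ^ j * D0) := mul_le_mul_of_nonneg_right hp1 q0
      have h9 : p * (e * j) ≤ 1 * (e * j) := mul_le_mul_of_nonneg_right hp2 ej
      rw [pow_succ]; push_cast
      linarith
    have hlow : ∀ s', P (X0 + j) s' → s'.length ≤ j + 1 → γ ≤ D s' := by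
      intro s' hs' hl'
      rw [hγ]
      exact max_le (hD _ _ (by omega) hs') (ih s' hs' hl')
    by_cases hn : s.length = 1
    · have hj : 1 ≤ j := by
        have := T_parity s
        have := T_parity [s0]
        simp only [List.length_cons, List.length_nil] at this
        rw [hs0] at this
        by_contra hj
        have : j = 0 := by omega
        subst this
        omega
      have := p6 γ γ hγ0 hγ0 (fun s' h' hl' => by
        have := (hP _ _ h').1
        have : 0 < s'.length := List.length_pos_iff.2 this
        omega) (fun s' h' hl' => hlow s' h' (by omega))
      refine fin (Pd + Pu) ?_ p3 (by linarith)
      have hX4 : (4:ℝ) ≤ ((X0 + (j + 1) : ℕ) : ℝ) := by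
        have : 4 ≤ X0 + (j + 1) := by omega
        exact_mod_cast this
      have : 2 / ((X0 + (j + 1) : ℕ) : ℝ) ≤ 2 / 4 :=
        div_le_div_of_nonneg_left (by norm_num) (by norm_num) hX4
      linarith
    · have h2n : (2:ℝ) ≤ s.length := by
        have : 2 ≤ s.length := by omega
        exact_mod_cast this
      have := p6 γ 0 hγ0 le_rfl (fun s' h' hl' => hlow s' h' (by omega))
        (fun s' h' _ => hD _ _ (by omega) h')
      refine fin Pd ?_ (by linarith) (by linarith)
      have : 1 / (s.length : ℝ) ≤ 1 / 2 :=
        div_le_div_of_nonneg_left (by norm_num) (by norm_num) h2n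
      linarith

/-- barrier -/
def fB (N t n : ℕ) : ℝ := 8 ^ n * (1/6:ℝ) ^ t + 8 ^ N * (6/5) * (1 - (1/6:ℝ) ^ t)

lemma fB_step {N t n : ℕ} (hN : 400 ≤ N) {Pd Pu : ℝ} (hn : 1 ≤ n) (p1 : 0 ≤ Pd) (p2 : 0 ≤ Pu)
    (p3 : Pd + Pu ≤ 1) (p4 : 1 - 1 / (n:ℝ) ≤ Pd) (p5 : 1/2 ≤ Pd + Pu) :
    Pd * fB N t (n - 1) + Pu * fB N t (n + 1) ≤ (Pd + Pu) * fB N (t + 1) n := by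
  obtain ⟨m, rfl⟩ : ∃ m, n = m + 1 := ⟨n - 1, by omega⟩
  have key : Pd * 8 ^ m + Pu * 8 ^ (m + 1 + 1) ≤ (Pd + Pu) * (8 ^ (m + 1) / 6 + 8 ^ N) := by
    have e0 : (0:ℝ) < 8 ^ m := by positivity
    have eN : (0:ℝ) < 8 ^ N := by positivity
    by_cases h : m + 1 < N
    · have : (8:ℝ) ^ (m + 1 + 1) ≤ 8 ^ N := pow_le_pow_right₀ (by norm_num) (by omega)
      have h1 : (8:ℝ) ^ m ≤ 8 ^ (m + 1 + 1) := pow_le_pow_right₀ (by norm_num) (by omega)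
      have h2 : Pd * 8 ^ m ≤ Pd * 8 ^ N := mul_le_mul_of_nonneg_left (h1.trans this) p1
      have h3 : Pu * 8 ^ (m + 1 + 1) ≤ Pu * 8 ^ N := mul_le_mul_of_nonneg_left this p2
      have h4 : 0 ≤ (Pd + Pu) * (8 ^ (m + 1) / 6) := by positivity
      nlinarith
    · have hm : (400:ℝ) ≤ ((m + 1 : ℕ) : ℝ) := by
        have : 400 ≤ m + 1 := by omega
        exact_mod_cast this
      have h1 : 1 / ((m + 1 : ℕ) : ℝ) ≤ 1 / 400 :=
        div_le_div_of_nonneg_left (by norm_num) (by norm_num) hm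
      have hPu : Pu ≤ 1 / 400 := by linarith
      have h2 : 0 ≤ (Pd + Pu) * 8 ^ N := by positivity
      have h3 : (Pd + 64 * Pu) ≤ (Pd + Pu) * (8 / 6) := by linarith
      have h4 := mul_le_mul_of_nonneg_right h3 e0.le
      rw [pow_succ, pow_succ]
      nlinarith
  have r0 : (0:ℝ) ≤ (1/6:ℝ) ^ t := by positivity
  have k2 := mul_le_mul_of_nonneg_right key r0
  unfold fB
  rw [Nat.add_sub_cancel, pow_succ (1/6:ℝ) t]
  nlinarith

lemma phase1 {P : ℕ → List ℕ → Prop} {D : List ℕ → ℝ} {X0 : ℕ} {e : ℝ} (hP : Cls P)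
    (hD : ∀ X s, X0 ≤ X → P X s → 0 ≤ D s) (hstep : Step P D X0 e) (he : 0 ≤ e) (hX0 : 4 ≤ X0)
    {s0 : ℕ} (hs0 : T [s0] = 3 * X0) {D0 : ℝ} (hD0 : 0 ≤ D0) (hD0' : D0 ≤ D [s0])
    {N : ℕ} (hN : 400 ≤ N) {X1 : ℕ} (hX1 : X1 = X0 + (N + 1)) (t : ℕ) :
    ∀ s, P (X1 + t) s → (1/2:ℝ) ^ (N + 1) * D0 *
      ((X1:ℝ) * ((X1:ℝ) - 1) / (((X1:ℝ) + t) * ((X1:ℝ) + t - 1))) *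
      max 0 (1 - fB N t s.length / 8 ^ (N + 1)) - e * ((N:ℝ) + 1 + t) ≤ D s := by
  have hX1' : (4:ℝ) ≤ X1 := by
    have : 4 ≤ X1 := by omega
    exact_mod_cast this
  obtain ⟨A, hA⟩ : ∃ A, A = (1/2:ℝ) ^ (N + 1) * D0 := ⟨_, rfl⟩
  have hA0 : 0 ≤ A := by rw [hA]; positivity
  rw [← hA]
  have e8 : (0:ℝ) < 8 ^ (N + 1) := by positivity
  induction t with
  | zero =>
    intro s hs
    have hw : (X1:ℝ) * ((X1:ℝ) - 1) / (((X1:ℝ) + (0:ℕ)) * ((X1:ℝ) + (0:ℕ) - 1)) = 1 := by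
      rw [Nat.cast_zero, add_zero]
      exact div_self (by nlinarith)
    rw [hw, mul_one]
    have eN : 0 ≤ e * ((N:ℝ) + 1 + (0:ℕ)) := by positivity
    by_cases hn : s.length ≤ N + 1
    · have := phase2 hP hD hstep he hX0 hs0 hD0 hD0' (N + 1) s (by rw [← hX1]; exact hs) (by omega)
      rw [← hA] at this
      have h1 : max 0 (1 - fB N 0 s.length / 8 ^ (N + 1)) ≤ 1 := by
        apply max_le (by norm_num)
        have : 0 ≤ fB N 0 s.length / 8 ^ (N + 1) := by
          unfold fB; simp
          positivity
        linarith
      have h2 := mul_le_mul_of_nonneg_left h1 hA0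
      push_cast at this ⊢
      linarith
    · have h1 : max 0 (1 - fB N 0 s.length / 8 ^ (N + 1)) = 0 := by
        apply max_eq_left
        have : 1 ≤ fB N 0 s.length / 8 ^ (N + 1) := by
          rw [le_div_iff₀ e8, one_mul]
          unfold fB; simp
          exact pow_le_pow_right₀ (by norm_num) (by omega)
        linarith
      rw [h1, mul_zero]
      have := hD (X1 + 0) s (by omega) hs
      linarith
  | succ t ih =>
    intro s hs
    obtain ⟨h1, h2, h3⟩ := hP _ _ hs
    have hn1 : 1 ≤ s.length := List.length_pos_iff.2 h1
    obtain ⟨Pd, Pu, p1, p2, p3, p4, p5, p6⟩ := hstep _ s (by omega) hs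
    have hXe : X1 + (t + 1) - 1 = X1 + t := by omega
    rw [hXe] at p6
    obtain ⟨n, hn⟩ : ∃ n, n = s.length := ⟨_, rfl⟩
    rw [← hn] at hn1 p4 p6 ⊢
    have ht0 : (0:ℝ) ≤ t := Nat.cast_nonneg t
    obtain ⟨x, hx⟩ : ∃ x : ℝ, x = (X1:ℝ) + t := ⟨_, rfl⟩
    have hx4 : 4 ≤ x := by linarith
    have c1 : ((X1 + (t + 1) : ℕ) : ℝ) = x + 1 := by rw [hx]; push_cast; ring
    have c2 : (X1:ℝ) + ((t + 1 : ℕ) : ℝ) = x + 1 := by rw [hx]; push_cast; ring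
    rw [c1] at p5
    rw [c2]
    rw [← hx] at ih
    obtain ⟨ω, hω⟩ : ∃ ω, ω = (X1:ℝ) * ((X1:ℝ) - 1) / (x * (x - 1)) := ⟨_, rfl⟩
    rw [← hω] at ih
    have hω0 : 0 ≤ ω := by
      rw [hω]; apply div_nonneg <;> nlinarith
    have hω' : (X1:ℝ) * ((X1:ℝ) - 1) / ((x + 1) * (x + 1 - 1)) = ω * (1 - 2 / (x + 1)) := by
      rw [hω]
      have : x - 1 ≠ 0 := by linarith
      have : x ≠ 0 := by linarith
      have : x + 1 ≠ 0 := by linarith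
      have : x + 1 - 1 ≠ 0 := by linarith
      field_simp
      ring
    rw [hω']
    have hlow : ∀ k s', P (X1 + t) s' → s'.length = k →
        max 0 (A * ω * max 0 (1 - fB N t k / 8 ^ (N + 1)) - e * ((N:ℝ) + 1 + t)) ≤ D s' := by
      intro k s' hs' hl'
      subst hl'
      exact max_le (hD _ _ (by omega) hs') (ih s' hs')
    have h6 := p6 _ _ (le_max_left 0 _) (le_max_left 0 _)
      (fun s' h' hl' => hlow (n - 1) s' h' (by omega)) (fun s' h' hl' => hlow (n + 1) s' h' hl')
    have hb : 1 - 2 / (x + 1) ≤ 1 := by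
      have : 0 ≤ 2 / (x + 1) := by positivity
      linarith
    have hhalf : 1 / 2 ≤ Pd + Pu := by
      have : 2 / (x + 1) ≤ 2 / 4 := div_le_div_of_nonneg_left (by norm_num) (by norm_num) (by linarith)
      linarith
    have hq0 : 0 ≤ 1 - 2 / (x + 1) := by
      have : 2 / (x + 1) ≤ 2 / 4 := div_le_div_of_nonneg_left (by norm_num) (by norm_num) (by linarith)
      linarith
    have hstepf := fB_step (t := t) hN hn1 p1 p2 p3 p4 hhalf
    obtain ⟨E, hE⟩ : ∃ E, E = e * ((N:ℝ) + 1 + t) := ⟨_, rfl⟩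
    have hE0 : 0 ≤ E := by rw [hE]; positivity
    rw [← hE] at h6
    obtain ⟨b1, hb1⟩ : ∃ b, b = 1 - fB N t (n - 1) / 8 ^ (N + 1) := ⟨_, rfl⟩
    obtain ⟨b2, hb2⟩ : ∃ b, b = 1 - fB N t (n + 1) / 8 ^ (N + 1) := ⟨_, rfl⟩
    obtain ⟨b3, hb3⟩ : ∃ b, b = 1 - fB N (t + 1) n / 8 ^ (N + 1) := ⟨_, rfl⟩
    rw [← hb1, ← hb2] at h6
    rw [← hb3]
    have hAω : 0 ≤ A * ω := mul_nonneg hA0 hω0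
    have g1 : Pd * (A * ω * max 0 b1 - E) ≤ Pd * max 0 (A * ω * max 0 b1 - E) :=
      mul_le_mul_of_nonneg_left (le_max_right _ _) p1
    have g2 : Pu * (A * ω * max 0 b2 - E) ≤ Pu * max 0 (A * ω * max 0 b2 - E) :=
      mul_le_mul_of_nonneg_left (le_max_right _ _) p2
    have g3 : (Pd + Pu) * E ≤ 1 * E := mul_le_mul_of_nonneg_right p3 hE0
    have g4 : (1 - 2 / (x + 1)) * max 0 b3 ≤ Pd * max 0 b1 + Pu * max 0 b2 := by
      have n1 := le_max_left 0 b1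
      have n2 := le_max_left 0 b2
      rcases le_total b3 0 with h0 | h0
      · rw [max_eq_left h0, mul_zero]; positivity
      · rw [max_eq_right h0]
        have k1 : (1 - 2 / (x + 1)) * b3 ≤ (Pd + Pu) * b3 := mul_le_mul_of_nonneg_right p5 h0
        have k2 : (Pd + Pu) * b3 ≤ Pd * b1 + Pu * b2 := by
          have : (Pd * fB N t (n - 1) + Pu * fB N t (n + 1)) / 8 ^ (N + 1)
              ≤ ((Pd + Pu) * fB N (t + 1) n) / 8 ^ (N + 1) := div_le_div_of_nonneg_right hstepf e8.le
          have e1 : (Pd + Pu) * b3 = (Pd + Pu) - ((Pd + Pu) * fB N (t + 1) n) / 8 ^ (N + 1) := by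
            rw [hb3]; ring
          have e2 : Pd * b1 + Pu * b2 = (Pd + Pu) -
              (Pd * fB N t (n - 1) + Pu * fB N t (n + 1)) / 8 ^ (N + 1) := by
            rw [hb1, hb2]; ring
          linarith
        have k3 := mul_le_mul_of_nonneg_left (le_max_right 0 b1) p1
        have k4 := mul_le_mul_of_nonneg_left (le_max_right 0 b2) p2
        linarith
    have g5 := mul_le_mul_of_nonneg_left g4 hAω
    have e3 : e * ((N:ℝ) + 1 + ((t + 1 : ℕ) : ℝ)) = E + e := by rw [hE]; push_cast; ring
    rw [e3]
    nlinarith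

theorem contraction {P : ℕ → List ℕ → Prop} {D : List ℕ → ℝ} {X0 : ℕ} {e : ℝ} (hP : Cls P)
    (hD : ∀ X s, X0 ≤ X → P X s → 0 ≤ D s) (hstep : Step P D X0 e) (he : 0 ≤ e)
    {s0 : ℕ} (hs0 : T [s0] = 3 * X0) {D0 : ℝ} (hD0 : 0 ≤ D0) (hD0' : D0 ≤ D [s0])
    {N : ℕ} (hN : 400 ≤ N) (hX0 : N ≤ X0) {X : ℕ} (hX : 10 * X0 ≤ X) (hX2 : X ≤ 20 * X0)
    {s : List ℕ} (hs : P X s) :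
    (1/2:ℝ) ^ (N + 1) * D0 / 800 - 20 * X0 * e ≤ D s := by
  obtain ⟨t, ht⟩ : ∃ t, X = (X0 + (N + 1)) + t := ⟨X - (X0 + (N + 1)), by omega⟩
  subst ht
  have h := phase1 hP hD hstep he (by omega) hs0 hD0 hD0' hN rfl t s hs
  obtain ⟨hh1, hh2, hh3⟩ := hP _ _ hs
  obtain ⟨A, hA⟩ : ∃ A, A = (1/2:ℝ) ^ (N + 1) * D0 := ⟨_, rfl⟩
  have hA0 : 0 ≤ A := by rw [hA]; positivity
  rw [← hA] at h ⊢
  have hb : (1/2:ℝ) ≤ 1 - fB N t s.length / 8 ^ (N + 1) := by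
    have e8 : (0:ℝ) < 8 ^ (N + 1) := by positivity
    have f1 : (8:ℝ) ^ s.length ≤ 64 * 4 ^ (X0 + (N + 1) + t) := by
      have : (8:ℝ) ^ s.length = 2 ^ (3 * s.length) := by rw [pow_mul]; norm_num
      rw [this]
      calc (2:ℝ) ^ (3 * s.length) ≤ 2 ^ (2 * (X0 + (N + 1) + t) + 6) :=
            pow_le_pow_right₀ (by norm_num) hh2
        _ = _ := by rw [pow_add, pow_mul]; norm_num; ring
    have f2 : (4:ℝ) ^ (X0 + (N + 1) + t) ≤ 6 ^ (N + 1 + t) := by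
      obtain ⟨j, hj⟩ : ∃ j, X0 + (N + 1) + t = 10 * X0 + j := ⟨X0 + (N + 1) + t - 10 * X0, by omega⟩
      rw [hj, show N + 1 + t = 9 * X0 + j by omega, pow_add, pow_add, pow_mul, pow_mul]
      have a1 : ((4:ℝ) ^ 10) ^ X0 ≤ (6 ^ 9) ^ X0 := pow_le_pow_left₀ (by norm_num) (by norm_num) _
      have a2 : (4:ℝ) ^ j ≤ 6 ^ j := pow_le_pow_left₀ (by norm_num) (by norm_num) _
      exact mul_le_mul a1 a2 (by positivity) (by positivity)
    have f3 : (8:ℝ) ^ s.length * (1/6) ^ t ≤ 64 * 6 ^ (N + 1) := by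
      have : (8:ℝ) ^ s.length ≤ 64 * 6 ^ (N + 1 + t) := f1.trans (by linarith)
      have h6 : (0:ℝ) ≤ (1/6:ℝ) ^ t := by positivity
      calc (8:ℝ) ^ s.length * (1/6) ^ t ≤ 64 * 6 ^ (N + 1 + t) * (1/6) ^ t :=
            mul_le_mul_of_nonneg_right this h6
        _ = 64 * 6 ^ (N + 1) * (6 * (1/6)) ^ t := by rw [mul_pow, pow_add]; ring
        _ = _ := by norm_num
    have f4 : (6:ℝ) ^ (N + 1) ≤ 1 / 900 * 8 ^ (N + 1) := by
      have : (6:ℝ) ^ (N + 1) = (3/4) ^ (N + 1) * 8 ^ (N + 1) := by rw [← mul_pow]; norm_num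
      rw [this]
      apply mul_le_mul_of_nonneg_right _ e8.le
      calc (3/4:ℝ) ^ (N + 1) ≤ (3/4) ^ 24 :=
            pow_le_pow_of_le_one (by norm_num) (by norm_num) (by omega)
        _ ≤ _ := by norm_num
    have f5 : fB N t s.length ≤ 64 * 6 ^ (N + 1) + 8 ^ N * (6/5) := by
      unfold fB
      have h6 : (0:ℝ) ≤ (1/6:ℝ) ^ t := by positivity
      have h7 : (0:ℝ) ≤ 8 ^ N * (6/5) * (1/6:ℝ) ^ t := by positivity
      linarith
    have f6 : fB N t s.length / 8 ^ (N + 1) ≤ 1 / 2 := by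
      rw [div_le_iff₀ e8]
      have : (8:ℝ) ^ (N + 1) = 8 * 8 ^ N := by rw [pow_succ]; ring
      linarith
    linarith
  have hx0 : (400:ℝ) ≤ X0 := by
    have : 400 ≤ X0 := by omega
    exact_mod_cast this
  have hNn : (0:ℝ) ≤ N := Nat.cast_nonneg N
  have htn : (0:ℝ) ≤ t := Nat.cast_nonneg t
  have hX2' : (X0:ℝ) + (N + 1) + t ≤ 20 * X0 := by exact_mod_cast hX2
  have hω : (1/400:ℝ) ≤ ((X0 + (N + 1) : ℕ) : ℝ) * (((X0 + (N + 1) : ℕ) : ℝ) - 1) /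
      ((((X0 + (N + 1) : ℕ) : ℝ) + t) * (((X0 + (N + 1) : ℕ) : ℝ) + t - 1)) := by
    push_cast
    rw [div_le_div_iff₀ (by norm_num) (mul_pos (by linarith) (by linarith))]
    have i1 : ((X0:ℝ) + (N + 1) + t) * ((X0:ℝ) + (N + 1) + t - 1) ≤ (20 * X0) * (20 * X0) :=
      mul_le_mul hX2' (by linarith) (by linarith) (by linarith)
    have i2 : (X0:ℝ) * X0 ≤ (X0 + (N + 1)) * (X0 + (N + 1) - 1) :=
      mul_le_mul (by linarith) (by linarith) (by linarith) (by linarith)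
    nlinarith
  obtain ⟨ω, hωd⟩ : ∃ ω, ω = ((X0 + (N + 1) : ℕ) : ℝ) * (((X0 + (N + 1) : ℕ) : ℝ) - 1) /
      ((((X0 + (N + 1) : ℕ) : ℝ) + t) * (((X0 + (N + 1) : ℕ) : ℝ) + t - 1)) := ⟨_, rfl⟩
  rw [← hωd] at h hω
  have k1 : A * (1/400) ≤ A * ω := mul_le_mul_of_nonneg_left hω hA0
  have k2 : A * (1/400) * (1/2) ≤ A * ω * max 0 (1 - fB N t s.length / 8 ^ (N + 1)) :=
    mul_le_mul k1 (hb.trans (le_max_right _ _)) (by norm_num) (by nlinarith)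
  have k3 : e * ((N:ℝ) + 1 + t) ≤ e * (20 * X0) := mul_le_mul_of_nonneg_left (by linarith) he
  linarith

/-- lower class -/
def EC (X : ℕ) (s : List ℕ) : Prop :=
  s ≠ [] ∧ 3 * s.length ≤ 2 * X + 6 ∧ T s = 3 * X ∧ s.count 0 ≤ 2

/-- upper class -/
def ZC (X : ℕ) (s : List ℕ) : Prop :=
  s ≠ [] ∧ 3 * s.length ≤ 2 * X + 6 ∧ T s = 3 * X ∧ ∀ e ∈ s, 1 ≤ e

lemma EC_cls : Cls EC := fun _ _ h => ⟨h.1, h.2.1, h.2.2.1⟩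
lemma ZC_cls : Cls ZC := fun _ _ h => ⟨h.1, h.2.1, h.2.2.1⟩

lemma ZC.toEC {X : ℕ} {s : List ℕ} (h : ZC X s) : EC X s :=
  ⟨h.1, h.2.1, h.2.2.1, by rw [count_zero_of h.2.2.2]; norm_num⟩

/-- the probability weight is large -/
lemma Pd_bound {X δ : ℕ} {r : List ℕ} (hX : 3 ≤ X)
    (hr : ∀ e ∈ r, δ + 2 ≤ e) (hT : T r + 2 * δ + 5 = 3 * X) :
    1 - 1 / ((r.length + 1 : ℕ) : ℝ) ≤ (T r : ℝ) / (3 * ((X:ℝ) - 1)) := by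
  have hX' : (3:ℝ) ≤ X := by exact_mod_cast hX
  have hT' : (T r : ℝ) + 2 * δ + 5 = 3 * X := by exact_mod_cast hT
  have h1 := T_ge hr
  have h1' : (r.length : ℝ) * (2 * (δ + 2) + 1) ≤ T r := by exact_mod_cast h1
  have hl : (0:ℝ) ≤ r.length := Nat.cast_nonneg _
  have hδ : (0:ℝ) ≤ δ := Nat.cast_nonneg _
  push_cast
  have p : (0:ℝ) < (r.length : ℝ) + 1 := by linarith
  have e1 : 1 - 1 / ((r.length : ℝ) + 1) = r.length / ((r.length : ℝ) + 1) := by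
    field_simp; ring
  rw [e1, div_le_div_iff₀ p (by linarith)]
  nlinarith

lemma low_core (hC : IsNormalizedWitten C) {X : ℕ} {s : List ℕ} (hX : 2 ≤ X) (hs : EC X s) :
    ∃ Pd Pu : ℝ, 0 ≤ Pd ∧ 0 ≤ Pu ∧ Pd + Pu = 1 ∧ 1 - 1 / (s.length : ℝ) ≤ Pd ∧
    ∀ α β : ℝ, 0 ≤ α → 0 ≤ β → (∀ s', EC (X - 1) s' → s'.length + 1 = s.length → α ≤ C s') →
      (∀ s', EC (X - 1) s' → s'.length = s.length + 1 → β ≤ C s') → Pd * α + Pu * β ≤ C s := by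
  obtain ⟨h1, h2, h3, h4⟩ := hs
  obtain ⟨d, r, hp, hmin⟩ := exists_min h1
  have hTp := T_perm hp
  have hlen := hp.length_eq
  have hc := hp.count_eq 0
  have hX' : (2:ℝ) ≤ X := by exact_mod_cast hX
  have hnn : (0:ℝ) ≤ 1 / (s.length : ℝ) := by positivity
  rw [h3, T_cons] at hTp
  rw [List.length_cons] at hlen
  rw [← C_perm hC hp]
  rcases Nat.eq_zero_or_pos d with rfl | hd
  · refine ⟨1, 0, by norm_num, le_rfl, by norm_num, by linarith, fun α β hα _ hα' _ => ?_⟩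
    rw [List.count_cons_self] at hc
    have h := string_ge hC (x := X) (r := r) (K := α) (by simp; omega) hX (by
      intro e l hp2 he
      have hTp2 := T_perm hp2
      have hl2 := hp2.length_eq
      rw [T_cons] at hTp2
      rw [List.length_cons] at hl2
      apply hα'
      · refine ⟨by simp, by simp; omega, by simp; omega, ?_⟩
        have hc2 := hp2.count_eq 0
        rw [List.count_cons_of_ne (by omega)] at hc2
        rw [List.count_cons]
        split_ifs <;> omega
      · simp; omega)
    have hTr : (T r : ℝ) = 3 * X - 1 := by
      have : T r + 1 = 3 * X := by omega
      have : (T r : ℝ) + 1 = 3 * X := by exact_mod_cast this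
      linarith
    have hc' : (r.count 0 : ℝ) ≤ 1 := by
      have : r.count 0 ≤ 1 := by omega
      exact_mod_cast this
    have h5 : 3 * ((X:ℝ) - 1) * α ≤ 3 * ((X:ℝ) - 1) * C (0 :: r) := by
      refine le_trans ?_ h
      apply mul_le_mul_of_nonneg_right _ hα
      linarith
    have := le_of_mul_le_mul_left h5 (by linarith)
    linarith
  rcases Nat.eq_or_lt_of_le (show 1 ≤ d from hd) with hd1 | hd2
  · subst hd1
    refine ⟨1, 0, by norm_num, le_rfl, by norm_num, by linarith, fun α β hα _ hα' _ => ?_⟩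
    have hr : r ≠ [] := by
      rintro rfl
      simp at hTp
      omega
    rw [dilaton hC hr]
    have := hα' r ⟨hr, by omega, by omega, by rw [List.count_cons_of_ne (by omega)] at hc; omega⟩ hlen
    linarith
  · obtain ⟨δ, rfl⟩ : ∃ δ, d = δ + 2 := ⟨d - 2, by omega⟩
    have hge := T_ge hmin
    have hX3 : 3 ≤ X := by
      rcases r with _ | ⟨a, r⟩
      · simp at hTp; omega
      · simp only [List.length_cons] at hge; nlinarith
    have hT : T r + 2 * δ + 5 = 3 * X := by omega
    have hT' : (T r : ℝ) + 2 * δ + 5 = 3 * X := by exact_mod_cast hT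
    have hX3' : (3:ℝ) ≤ X := by exact_mod_cast hX3
    have hδ : (0:ℝ) ≤ δ := Nat.cast_nonneg _
    have h5r : 5 * r.length ≤ T r := by nlinarith
    refine ⟨(T r : ℝ) / (3 * ((X:ℝ) - 1)), (2 * δ + 2) / (3 * ((X:ℝ) - 1)), ?_, ?_, ?_, ?_, ?_⟩
    · exact div_nonneg (Nat.cast_nonneg _) (by linarith)
    · exact div_nonneg (by linarith) (by linarith)
    · rw [← add_div, div_eq_one_iff_eq (by linarith)]; linarith
    · rw [← hlen]; exact Pd_bound hX3 hmin hT
    · intro α β hα hβ hα' hβ'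
      have hd := dvv2 hC hX3 hT
      have g1 : (T r : ℝ) * α ≤ pickSum (mt C (δ + 2)) r := merge_ge (by omega) (fun e l hp2 => by
        have hTp2 := T_perm hp2
        have hl2 := hp2.length_eq
        rw [T_cons] at hTp2
        rw [List.length_cons] at hl2
        apply hα'
        · refine ⟨by simp, by simp; omega, by simp; omega, ?_⟩
          rw [count_zero_of]
          · norm_num
          · intro f hf
            rcases List.mem_cons.1 hf with rfl | hf
            · omega
            · have := hmin f (hp2.subset (List.mem_cons_of_mem _ hf)); omega
        · simp; omega)
      have g2 : ((δ:ℝ) + 1) * β ≤ ∑ a ∈ Finset.range (δ + 1), (C (a :: (δ - a) :: r) : ℝ) := by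
        have : ∑ a ∈ Finset.range (δ + 1), β ≤ ∑ a ∈ Finset.range (δ + 1), (C (a :: (δ - a) :: r) : ℝ) := by
          refine Finset.sum_le_sum fun a ha => ?_
          rw [Finset.mem_range] at ha
          apply hβ'
          · refine ⟨by simp, by simp; omega, by simp; omega, ?_⟩
            have : r.count 0 = 0 := count_zero_of fun e he => by have := hmin e he; omega
            rw [List.count_cons, List.count_cons, this]
            split_ifs <;> omega
          · simp; omega
        rw [Finset.sum_const, Finset.card_range, nsmul_eq_mul] at this
        push_cast at this
        exact this
      have g3 : 0 ≤ ∑ a ∈ Finset.range (δ + 1), splitSum (qt C X a (δ - a)) r :=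
        Finset.sum_nonneg fun a _ => splitSum_nonneg fun I J _ => qt_nonneg hC _ _ _ _ _
      have g4 : 0 ≤ 3 * ((X:ℝ) - 1) * ∑ a ∈ Finset.range (δ + 1), splitSum (qt C X a (δ - a)) r :=
        mul_nonneg (by linarith) g3
      have e1 : (T r : ℝ) / (3 * ((X:ℝ) - 1)) * α + (2 * δ + 2) / (3 * ((X:ℝ) - 1)) * β
        = ((T r : ℝ) * α + (2 * δ + 2) * β) / (3 * ((X:ℝ) - 1)) := by ring
      rw [e1, div_le_iff₀ (by linarith)]
      linarith

lemma low_step (hC : IsNormalizedWitten C) {X0 : ℕ} (hX0 : 1 ≤ X0) {m : ℝ} (hm : 0 ≤ m) :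
    Step EC (fun s => (C s : ℝ) - m) X0 0 := by
  intro X s hX hs
  obtain ⟨Pd, Pu, p1, p2, p3, p4, p5⟩ := low_core hC (by omega : 2 ≤ X) hs
  refine ⟨Pd, Pu, p1, p2, p3.le, p4, ?_, ?_⟩
  · rw [p3]
    have : (0:ℝ) ≤ 2 / (X:ℝ) := by positivity
    linarith
  · intro α β hα hβ hα' hβ'
    have := p5 (α + m) (β + m) (by linarith) (by linarith)
      (fun s' h h' => by have := hα' s' h h'; linarith)
      (fun s' h h' => by have := hβ' s' h h'; linarith)
    have e : m = (Pd + Pu) * m := by rw [p3, one_mul]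
    beta_reduce
    linarith

/-- monotonicity of the infimum -/
lemma low_mono (hC : IsNormalizedWitten C) {Y : ℕ} (hY : 1 ≤ Y) {m : ℝ} (hm : 0 ≤ m)
    (h : ∀ s, EC Y s → m ≤ C s) (X : ℕ) (hX : Y ≤ X) : ∀ s, EC X s → m ≤ C s := by
  induction X, hX using Nat.le_induction with
  | base => exact h
  | succ X hX ih =>
    intro s hs
    obtain ⟨Pd, Pu, p1, p2, p3, p4, p5⟩ := low_core hC (by omega : 2 ≤ X + 1) hs
    have := p5 m m hm hm (fun s' h _ => ih s' h) (fun s' h _ => ih s' h)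
    have e : m = (Pd + Pu) * m := by rw [p3, one_mul]
    linarith

lemma bdry_all (hC : IsNormalizedWitten C) {X δ : ℕ} {r : List ℕ} {S : ℝ} (hS0 : 0 ≤ S) (hX : 6 ≤ X)
    (hr : ∀ e ∈ r, δ + 2 ≤ e) (hT : T r + 2 * δ + 5 = 3 * X) (hS : BS C X (r.length + 1) S) :
    (C (0 :: δ :: r) : ℝ) ≤ (1 + 2 / ((X:ℝ) - 4)) * S := by
  have hX' : (6:ℝ) ≤ X := by exact_mod_cast hX
  rcases Nat.eq_zero_or_pos δ with rfl | hδ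
  · obtain ⟨_, h⟩ := bdry0 hC hS0 hr (by omega) hS
    rw [if_neg (by omega), ← mul_assoc] at h
    refine h.trans (mul_le_mul_of_nonneg_right ?_ hS0)
    obtain ⟨y, hy⟩ : ∃ y : ℝ, y = 1 / ((X:ℝ) - 4) := ⟨_, rfl⟩
    have hy0 : 0 ≤ y := by rw [hy]; exact div_nonneg (by norm_num) (by linarith)
    have hy1 : y ≤ 1 := by rw [hy, div_le_one (by linarith)]; linarith
    have h1 : 1 / 3 / ((X:ℝ) - 2) ≤ 1 / 3 * y := by
      rw [hy, div_eq_mul_one_div]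
      apply mul_le_mul_of_nonneg_left _ (by norm_num)
      exact one_div_le_one_div_of_le (by linarith) (by linarith)
    have h2 : 2 / 3 / ((X:ℝ) - 4) = 2 / 3 * y := by rw [hy]; ring
    have h3 : 2 / ((X:ℝ) - 4) = 2 * y := by rw [hy]; ring
    rw [h2, h3]
    nlinarith
  rcases Nat.eq_or_lt_of_le (show 1 ≤ δ from hδ) with h1 | h1
  · subst h1
    obtain ⟨_, h⟩ := bdry1 hC hr (by omega) hS
    refine h.trans (mul_le_mul_of_nonneg_right ?_ hS0)
    have : 2 / 3 / ((X:ℝ) - 3) ≤ 2 / ((X:ℝ) - 4) := by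
      rw [div_le_div_iff₀ (by linarith) (by linarith)]; linarith
    linarith
  · have h := bdry2 hC h1 (by omega) hr hT hS
    refine h.trans (mul_le_mul_of_nonneg_right ?_ hS0)
    have : 2 / 3 / ((X:ℝ) - 2) ≤ 2 / ((X:ℝ) - 4) := by
      rw [div_le_div_iff₀ (by linarith) (by linarith)]; linarith
    linarith

lemma ZC_BS (hC : IsNormalizedWitten C) {Y X n : ℕ} {M : ℝ} (hM0 : 0 ≤ M)
    (hM : ∀ X s, Y ≤ X → ZC X s → (C s : ℝ) ≤ M) (hX : Y + 4 ≤ X) (hX10 : 10 ≤ X)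
    (hn : 5 * n ≤ 3 * X) : BS C X n M := by
  intro t ht h1 hl hT1 hT2
  by_cases h3 : 3 ∣ T t
  swap
  · rw [C_not_dvd hC h3]; push_cast; exact hM0
  obtain ⟨x, hx⟩ := h3
  exact hM x t (by omega) ⟨ht, by omega, hx, h1⟩

lemma up_step (hC : IsNormalizedWitten C) {Y X0 : ℕ} {M : ℝ} (hM0 : 0 ≤ M) (hM43 : M ≤ 4/3)
    (hM : ∀ X s, Y ≤ X → ZC X s → (C s : ℝ) ≤ M) (hX0 : Y + 4 ≤ X0) (hX20 : 20 ≤ X0) :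
    Step ZC (fun s => M - (C s : ℝ)) X0 (20 / (X0:ℝ) ^ 2) := by
  intro X s hX hs
  obtain ⟨h1, h2, h3, h4⟩ := hs
  obtain ⟨d, r, hp, hmin⟩ := exists_min h1
  have hTp := T_perm hp
  have hlen := hp.length_eq
  have hX' : (X0:ℝ) + 1 ≤ X := by exact_mod_cast hX
  have hX20' : (20:ℝ) ≤ X0 := by exact_mod_cast hX20
  have he0 : 0 ≤ 20 / (X0:ℝ) ^ 2 := by positivity
  have hnn : (0:ℝ) ≤ 1 / (s.length : ℝ) := by positivity
  have hnx : (0:ℝ) ≤ 2 / (X : ℝ) := by positivity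
  rw [h3, T_cons] at hTp
  rw [List.length_cons] at hlen
  beta_reduce
  rw [← C_perm hC hp]
  have hd : 1 ≤ d := h4 d (hp.subset List.mem_cons_self)
  rcases Nat.eq_or_lt_of_le hd with hd1 | hd2
  · subst hd1
    refine ⟨1, 0, by norm_num, le_rfl, by norm_num, by linarith, by linarith, fun α β hα _ hα' _ => ?_⟩
    have hr : r ≠ [] := by
      rintro rfl
      simp at hTp
      omega
    rw [dilaton hC hr]
    have := hα' r ⟨hr, by omega, by omega, hmin⟩ hlen
    linarith
  · obtain ⟨δ, rfl⟩ : ∃ δ, d = δ + 2 := ⟨d - 2, by omega⟩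
    have hge := T_ge hmin
    have hT : T r + 2 * δ + 5 = 3 * X := by omega
    have hT' : (T r : ℝ) + 2 * δ + 5 = 3 * X := by exact_mod_cast hT
    have hδ0 : (0:ℝ) ≤ δ := Nat.cast_nonneg _
    have h5r : 5 * r.length ≤ T r := by nlinarith
    have hdv := dvv2 hC (by omega : 3 ≤ X) hT
    have hq := quad_HB hC (S := 4/3) (by norm_num) (by omega) hmin hT
      (fun t ht h1 _ => Z_bound hC ht h1)
    have hb := bdry_all hC hM0 (by omega) hmin hT
      (ZC_BS hC hM0 hM (by omega) (by omega) (by omega))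
    have pX : 0 < 3 * ((X:ℝ) - 1) := by linarith
    have g1 : ∀ α, (∀ s', ZC (X - 1) s' → s'.length + 1 = s.length → α ≤ M - C s') →
        pickSum (mt C (δ + 2)) r ≤ (T r : ℝ) * (M - α) := fun α hα' => merge_le (by omega) (fun e l hp2 => by
        have hTp2 := T_perm hp2
        have hl2 := hp2.length_eq
        rw [T_cons] at hTp2
        rw [List.length_cons] at hl2
        have := hα' ((δ + 2 + e - 1) :: l) ⟨by simp, by simp; omega, by simp; omega, by
          intro f hf
          rcases List.mem_cons.1 hf with rfl | hf
          · omega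
          · have := hmin f (hp2.subset (List.mem_cons_of_mem _ hf)); omega⟩ (by simp; omega)
        linarith)
    -- the error terms
    have herr : 4 * (2 / ((X:ℝ) - 4) * M) + 3 * ((X:ℝ) - 1) *
        (∑ a ∈ Finset.range (δ + 1), splitSum (qt C X a (δ - a)) r)
        ≤ 3 * ((X:ℝ) - 1) * (20 / (X0:ℝ) ^ 2) := by
      have k1 := mul_le_mul_of_nonneg_left hq pX.le
      have k2 : 3 * ((X:ℝ) - 1) * (25 / 9 * (4/3) ^ 2 / (((X:ℝ) - 1) * ((X:ℝ) - 2)))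
          = 400 / 27 / ((X:ℝ) - 2) := by
        have : (X:ℝ) - 1 ≠ 0 := by linarith
        have : (X:ℝ) - 2 ≠ 0 := by linarith
        field_simp
        norm_num
      rw [k2] at k1
      have k3 : 400 / 27 / ((X:ℝ) - 2) ≤ 400 / 27 / ((X:ℝ) - 4) :=
        div_le_div_of_nonneg_left (by norm_num) (by linarith) (by linarith)
      have k4 : 2 / ((X:ℝ) - 4) * M ≤ 2 / ((X:ℝ) - 4) * (4/3) :=
        mul_le_mul_of_nonneg_left hM43 (div_nonneg (by norm_num) (by linarith))
      have k5 : 4 * (2 / ((X:ℝ) - 4) * (4/3)) + 400 / 27 / ((X:ℝ) - 4) ≤ 3 * ((X:ℝ) - 1) * (20 / (X0:ℝ) ^ 2) := by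
        have : 4 * (2 / ((X:ℝ) - 4) * (4/3)) + 400 / 27 / ((X:ℝ) - 4) = (32/3 + 400/27) / ((X:ℝ) - 4) := by
          ring
        rw [this, mul_div_assoc', div_le_div_iff₀ (by linarith) (by positivity)]
        nlinarith
      linarith
    rcases Nat.eq_zero_or_pos δ with h0 | hδ
    · subst h0
      refine ⟨(T r : ℝ) / (3 * ((X:ℝ) - 1)), 0, div_nonneg (Nat.cast_nonneg _) pX.le, le_rfl, ?_, ?_, ?_, ?_⟩
      · rw [add_zero, div_le_one pX]; push_cast at hT'; linarith
      · rw [← hlen]; exact Pd_bound (by omega) hmin hT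
      · rw [add_zero, le_div_iff₀ pX]
        have : (T r : ℝ) = 3 * X - 5 := by push_cast at hT'; linarith
        rw [this]
        have h9 : 2 / (X:ℝ) * (3 * ((X:ℝ) - 1)) = 6 - 6 / X := by
          have : (X:ℝ) ≠ 0 := by linarith
          field_simp
          ring
        have h10 : 6 / (X:ℝ) ≤ 1 := by rw [div_le_one (by linarith)]; linarith
        linarith
      · intro α β hα hβ hα' hβ'
        have g1' := g1 α hα'
        have hsum : ∑ a ∈ Finset.range (0 + 1), (C (a :: (0 - a) :: r) : ℝ) = C (0 :: 0 :: r) := by simp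
        rw [hsum] at hdv
        have nn : 0 ≤ 2 / ((X:ℝ) - 4) * M := mul_nonneg (div_nonneg (by norm_num) (by linarith)) hM0
        have hfin : 3 * ((X:ℝ) - 1) * ((T r : ℝ) / (3 * ((X:ℝ) - 1)) * α + 0 * β - 20 / (X0:ℝ) ^ 2)
            ≤ 3 * ((X:ℝ) - 1) * (M - C ((0 + 2) :: r)) := by
          have e1 : 3 * ((X:ℝ) - 1) * ((T r : ℝ) / (3 * ((X:ℝ) - 1)) * α + 0 * β - 20 / (X0:ℝ) ^ 2)
            = T r * α - 3 * ((X:ℝ) - 1) * (20 / (X0:ℝ) ^ 2) := by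
            have : (X:ℝ) - 1 ≠ 0 := by linarith
            have : (X0:ℝ) ≠ 0 := by linarith
            field_simp
            ring
          rw [e1, mul_sub (3 * ((X:ℝ) - 1)) M, hdv]
          have e2 : 3 * ((X:ℝ) - 1) * M = T r * M + 2 * M := by
            have : (T r : ℝ) = 3 * X - 5 := by push_cast at hT'; linarith
            rw [this]; ring
          rw [e2]
          linarith
        exact le_of_mul_le_mul_left hfin pX
    · have hδ1 : (1:ℝ) ≤ δ := by exact_mod_cast hδ
      refine ⟨(T r : ℝ) / (3 * ((X:ℝ) - 1)), (2 * (δ - 1)) / (3 * ((X:ℝ) - 1)),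
        div_nonneg (Nat.cast_nonneg _) pX.le, div_nonneg (by linarith) pX.le, ?_, ?_, ?_, ?_⟩
      · rw [← add_div, div_le_one pX]; linarith
      · rw [← hlen]; exact Pd_bound (by omega) hmin hT
      · rw [← add_div, le_div_iff₀ pX]
        have : (T r : ℝ) + 2 * (δ - 1) = 3 * X - 7 := by linarith
        rw [this]
        have h9 : 2 / (X:ℝ) * (3 * ((X:ℝ) - 1)) = 6 - 6 / X := by
          have : (X:ℝ) ≠ 0 := by linarith
          field_simp
          ring
        have h10 : 6 / (X:ℝ) ≤ 1 := by rw [div_le_one (by linarith)]; linarith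
        linarith
      · intro α β hα hβ hα' hβ'
        have g1' := g1 α hα'
        have hsum := sum_ends hδ (fun a => (C (a :: (δ - a) :: r) : ℝ))
        beta_reduce at hsum
        have hsw : (C (δ :: (δ - δ) :: r) : ℝ) = C (0 :: δ :: r) := by
          rw [Nat.sub_self]; exact C_perm hC (List.Perm.swap 0 δ r)
        rw [hsw, Nat.sub_zero] at hsum
        have hinterior : ∑ a ∈ Finset.range (δ - 1), (C ((a + 1) :: (δ - (a + 1)) :: r) : ℝ) ≤ ((δ:ℝ) - 1) * (M - β) := by
          have : ∑ a ∈ Finset.range (δ - 1), (C ((a + 1) :: (δ - (a + 1)) :: r) : ℝ)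
              ≤ ∑ a ∈ Finset.range (δ - 1), (M - β) := by
            refine Finset.sum_le_sum fun a ha => ?_
            rw [Finset.mem_range] at ha
            have := hβ' ((a + 1) :: (δ - (a + 1)) :: r) ⟨by simp, by simp; omega, by simp; omega, by
              intro e he
              simp only [List.mem_cons] at he
              rcases he with rfl | rfl | he
              · omega
              · omega
              · have := hmin e he; omega⟩ (by simp; omega)
            linarith
          rw [Finset.sum_const, Finset.card_range, nsmul_eq_mul, Nat.cast_sub hδ] at this
          push_cast at this
          exact this
        have hfin : 3 * ((X:ℝ) - 1) * ((T r : ℝ) / (3 * ((X:ℝ) - 1)) * α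
            + (2 * (δ - 1)) / (3 * ((X:ℝ) - 1)) * β - 20 / (X0:ℝ) ^ 2)
            ≤ 3 * ((X:ℝ) - 1) * (M - C ((δ + 2) :: r)) := by
          have e1 : 3 * ((X:ℝ) - 1) * ((T r : ℝ) / (3 * ((X:ℝ) - 1)) * α
              + (2 * (δ - 1)) / (3 * ((X:ℝ) - 1)) * β - 20 / (X0:ℝ) ^ 2)
            = T r * α + 2 * (δ - 1) * β - 3 * ((X:ℝ) - 1) * (20 / (X0:ℝ) ^ 2) := by
            have : (X:ℝ) - 1 ≠ 0 := by linarith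
            have : (X0:ℝ) ≠ 0 := by linarith
            field_simp
          rw [e1, mul_sub (3 * ((X:ℝ) - 1)) M, hdv, hsum]
          have e2 : 3 * ((X:ℝ) - 1) * M = T r * M + 2 * (δ - 1) * M + 4 * M := by
            have : (T r : ℝ) = 3 * X - 5 - 2 * δ := by linarith
            rw [this]; ring
          rw [e2]
          linarith
        exact le_of_mul_le_mul_left hfin pX

lemma ZC_single {X : ℕ} (hX : 1 ≤ X) (ho : X % 2 = 1) : ZC X [(3 * X - 1) / 2] :=
  ⟨by simp, by simp, by simp; omega, by simp; omega⟩

lemma EC_nonempty (X : ℕ) (hX : 1 ≤ X) : ∃ s, EC X s := by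
  rcases Nat.mod_two_eq_zero_or_one X with h | h
  · refine ⟨[(3 * X - 2) / 2, 0], by simp, by simp, by simp; omega, ?_⟩
    exact List.count_le_length
  · exact ⟨_, (ZC_single hX h).toEC⟩

set_option exponentiation.threshold 1000 in
/-- uniform convergence on the class `ZC` -/
theorem unifZ (hC : IsNormalizedWitten C) : ∃ m : ℝ, 0 ≤ m ∧ ∀ ε : ℝ, 0 < ε → ∃ Y : ℕ, ∀ X s, Y ≤ X →
    ZC X s → |(C s : ℝ) - m| ≤ ε := by
  obtain ⟨SL, hSL⟩ : ∃ SL : Set ℝ, SL = {m : ℝ | 0 ≤ m ∧ ∃ Y : ℕ, 1 ≤ Y ∧ ∀ X s, Y ≤ X → EC X s → m ≤ C s} :=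
    ⟨_, rfl⟩
  obtain ⟨SU, hSU⟩ : ∃ SU : Set ℝ, SU = {M : ℝ | M ≤ 4/3 ∧ ∃ Y : ℕ, ∀ X s, Y ≤ X → ZC X s → (C s : ℝ) ≤ M} :=
    ⟨_, rfl⟩
  have hL0 : (0:ℝ) ∈ SL := by
    rw [hSL]
    exact ⟨le_rfl, 1, le_rfl, fun X s _ hs => by exact_mod_cast C_nn' hC hs.1⟩
  have hU0 : (4/3:ℝ) ∈ SU := by
    rw [hSU]
    exact ⟨le_rfl, 0, fun X s _ hs => Z_bound hC hs.1 hs.2.2.2⟩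
  have hLb : BddAbove SL := by
    refine ⟨3, fun m hm => ?_⟩
    rw [hSL] at hm
    obtain ⟨_, Y, hY, h⟩ := hm
    obtain ⟨s, hs⟩ := EC_nonempty Y hY
    exact (h Y s le_rfl hs).trans (C_le hC hs.1)
  have hUnn : ∀ M ∈ SU, 0 ≤ M := by
    intro M hM
    rw [hSU] at hM
    obtain ⟨_, Y, h⟩ := hM
    have hz := ZC_single (X := 2 * Y + 1) (by omega) (by omega)
    refine le_trans ?_ (h (2 * Y + 1) _ (by omega) hz)
    exact_mod_cast C_nn' hC hz.1
  have hUb : BddBelow SU := ⟨0, fun M hM => hUnn M hM⟩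
  obtain ⟨m, hm⟩ : ∃ m, m = sSup SL := ⟨_, rfl⟩
  obtain ⟨M, hM⟩ : ∃ M, M = sInf SU := ⟨_, rfl⟩
  have hm0 : 0 ≤ m := by rw [hm]; exact le_csSup hLb hL0
  have hM43 : M ≤ 4/3 := by rw [hM]; exact csInf_le hUb hU0
  have approxL : ∀ ε : ℝ, 0 < ε → ∃ m' ∈ SL, m - ε < m' := by
    intro ε hε
    exact exists_lt_of_lt_csSup ⟨0, hL0⟩ (by rw [← hm]; linarith)
  have approxU : ∀ ε : ℝ, 0 < ε → ∃ M' ∈ SU, M' < M + ε := by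
    intro ε hε
    exact exists_lt_of_csInf_lt ⟨_, hU0⟩ (by rw [← hM]; linarith)
  have hML : M ≤ m := by
    by_contra hlt
    rw [not_le] at hlt
    obtain ⟨η, hη⟩ : ∃ η : ℝ, η = (1/2) ^ (400 + 1) / 800 := ⟨_, rfl⟩
    have hη0 : 0 < η := by rw [hη]; positivity
    obtain ⟨κ, hκ⟩ : ∃ κ : ℝ, κ = η * (M - m) := ⟨_, rfl⟩
    have hκ0 : 0 < κ := by rw [hκ]; exact mul_pos hη0 (by linarith)
    obtain ⟨m', hm', hm1⟩ := approxL (κ / 16) (by linarith)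
    obtain ⟨M', hM', hM1⟩ := approxU (κ / 16) (by linarith)
    have hm'm : m' ≤ m := by rw [hm]; exact le_csSup hLb hm'
    have hMM' : M ≤ M' := by rw [hM]; exact csInf_le hUb hM'
    have hM'0 := hUnn M' hM'
    rw [hSL] at hm'
    rw [hSU] at hM'
    obtain ⟨hm'0, Y1, hY1, hY1'⟩ := hm'
    obtain ⟨hM'43, Y2, hY2⟩ := hM'
    obtain ⟨K, hK⟩ := exists_nat_gt (1600 / κ)
    -- a level where the upper deviation is small
    obtain ⟨X, s, hX, hs, hsC⟩ : ∃ X s, 20 * (Y1 + Y2 + K + 400 + 4) ≤ X ∧ ZC X s ∧ M - κ / 16 ≤ C s := by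
      by_contra hcon
      push Not at hcon
      have : M - κ / 16 ∈ SU := by
        rw [hSU]
        exact ⟨by linarith, 20 * (Y1 + Y2 + K + 400 + 4), fun X s hX hs => (hcon X s hX hs).le⟩
      have := csInf_le hUb this
      rw [← hM] at this
      linarith
    obtain ⟨s', hs', hsC'⟩ : ∃ s', EC X s' ∧ (C s' : ℝ) ≤ m + κ / 16 := by
      by_contra hcon
      push Not at hcon
      have : m + κ / 16 ∈ SL := by
        rw [hSL]
        exact ⟨by linarith, X, by omega, fun X' s hX' hs =>
          low_mono hC (by omega) (by linarith) (fun s hs => (hcon s hs).le) X' hX' s hs⟩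
      have := le_csSup hLb this
      rw [← hm] at this
      linarith
    obtain ⟨X0, hX0⟩ : ∃ X0, X0 = 2 * (X / 30) + 1 := ⟨_, rfl⟩
    have hz := ZC_single (X := X0) (by omega) (by omega)
    have hx1 : 10 * X0 ≤ X := by omega
    have hx2 : X ≤ 20 * X0 := by omega
    have hU := contraction ZC_cls (D := fun s => M' - (C s : ℝ))
      (fun X s hX hs => by have := hY2 X s (by omega) hs; linarith)
      (up_step hC hM'0 hM'43 hY2 (by omega : Y2 + 4 ≤ X0) (by omega)) (by positivity)
      hz.2.2.1 (D0 := M' - C [(3 * X0 - 1) / 2])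
      (by have := hY2 X0 _ (by omega) hz; linarith) le_rfl (le_refl 400) (by omega) hx1 hx2 hs
    have hL := contraction EC_cls (D := fun s => (C s : ℝ) - m')
      (fun X s hX hs => by have := hY1' X s (by omega) hs; linarith)
      (low_step hC (by omega : 1 ≤ X0) hm'0) le_rfl
      hz.2.2.1 (D0 := C [(3 * X0 - 1) / 2] - m')
      (by have := hY1' X0 _ (by omega) hz.toEC; linarith) le_rfl (le_refl 400) (by omega) hx1 hx2 hs'
    beta_reduce at hU hL
    obtain ⟨c0, hc0⟩ : ∃ c0 : ℝ, c0 = C [(3 * X0 - 1) / 2] := ⟨_, rfl⟩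
    rw [← hc0] at hU hL
    have hKX : (K:ℝ) ≤ X0 := by
      have : K ≤ X0 := by omega
      exact_mod_cast this
    have hX0p : (0:ℝ) < X0 := by
      have : 0 < X0 := by omega
      exact_mod_cast this
    have e1 : (20:ℝ) * X0 * (20 / (X0:ℝ) ^ 2) = 400 / X0 := by field_simp; norm_num
    have e2 : 400 / (X0:ℝ) < κ / 4 := by
      rw [div_lt_iff₀ hX0p]
      have : 1600 < K * κ := by rwa [div_lt_iff₀ hκ0] at hK
      nlinarith
    have e3 : (1/2:ℝ) ^ (400 + 1) * (M' - c0) / 800 + (1/2) ^ (400 + 1) * (c0 - m') / 800 = η * (M' - m') := by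
      rw [hη]; ring
    have e4 : κ ≤ η * (M' - m') := by
      rw [hκ]; exact mul_le_mul_of_nonneg_left (by linarith) hη0.le
    rw [e1] at hU
    linarith
  refine ⟨m, hm0, fun ε hε => ?_⟩
  obtain ⟨m', hm', hm1⟩ := approxL ε hε
  obtain ⟨M', hM', hM1⟩ := approxU ε hε
  rw [hSL] at hm'
  rw [hSU] at hM'
  obtain ⟨hm'0, Y1, hY1, hY1'⟩ := hm'
  obtain ⟨hM'43, Y2, hY2⟩ := hM'
  refine ⟨Y1 + Y2, fun X s hX hs => ?_⟩
  have h1 := hY1' X s (by omega) hs.toEC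
  have h2 := hY2 X s (by omega) hs
  rw [abs_le]
  constructor <;> linarith

/-- number of zeros (twice) and ones -/
def zo (s : List ℕ) : ℕ := 2 * s.count 0 + s.count 1

lemma zo_perm {s t : List ℕ} (h : s.Perm t) : zo s = zo t := by
  unfold zo; rw [h.count_eq, h.count_eq]

lemma unif_ext (hC : IsNormalizedWitten C) {m : ℝ} (hm0 : 0 ≤ m) (hm : ∀ ε : ℝ, 0 < ε → ∃ Y : ℕ, ∀ X s, Y ≤ X →
    ZC X s → |(C s : ℝ) - m| ≤ ε) (p : ℕ) : ∀ ε : ℝ, 0 < ε → ∃ Y : ℕ, ∀ X s, Y ≤ X → s ≠ [] → T s = 3 * X →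
    zo s ≤ p → |(C s : ℝ) - m| ≤ ε := by
  induction p with
  | zero =>
    intro ε hε
    obtain ⟨Y, hY⟩ := hm ε hε
    refine ⟨Y, fun X s hX hs hT hz => hY X s hX ?_⟩
    have h2 : ∀ e ∈ s, 2 ≤ e := by
      intro e he
      by_contra hlt
      unfold zo at hz
      have h0 : s.count 0 = 0 := by omega
      have h1 : s.count 1 = 0 := by omega
      rw [List.count_eq_zero] at h0 h1
      interval_cases e
      · exact h0 he
      · exact h1 he
    have := T_ge h2
    exact ⟨hs, by omega, hT, fun e he => by have := h2 e he; omega⟩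
  | succ p ih =>
    intro ε hε
    obtain ⟨Y, hY⟩ := ih (ε / 2) (by linarith)
    obtain ⟨K, hK⟩ := exists_nat_gt (((p:ℝ) + 4) * (m + ε) * 2 / ε)
    refine ⟨Y + K + 3, fun X s hX hs hT hz => ?_⟩
    obtain ⟨d, r, hp, hmin⟩ := exists_min hs
    have hTp := T_perm hp
    rw [hT, T_cons] at hTp
    have hr : r ≠ [] ∨ 2 ≤ d := by
      rcases r with _ | ⟨a, r⟩
      · right
        simp at hTp
        omega
      · left; simp
    rw [← C_perm hC hp]
    rw [← zo_perm hp] at hz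
    have hXr : (K:ℝ) + 3 ≤ X := by
      have : K + 3 ≤ X := by omega
      exact_mod_cast this
    have hK0 : (0:ℝ) ≤ K := Nat.cast_nonneg _
    rcases Nat.eq_zero_or_pos d with rfl | hd
    · have hc0 : 2 * r.count 0 + 2 + r.count 1 ≤ p + 1 := by
        unfold zo at hz
        rw [List.count_cons_self, List.count_cons_of_ne (by omega)] at hz
        omega
      have hnext : ∀ d l, (d :: l).Perm r → 1 ≤ d → |(C ((d - 1) :: l) : ℝ) - m| ≤ ε / 2 := by
        intro e l hp2 he
        have hTp2 := T_perm hp2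
        rw [T_cons] at hTp2
        refine hY (X - 1) _ (by omega) (by simp) (by simp; omega) ?_
        have a0 := hp2.count_eq 0
        have a1 := hp2.count_eq 1
        unfold zo
        rw [List.count_cons] at a0 a1 ⊢
        rw [List.count_cons]
        simp only [beq_iff_eq] at *
        split_ifs at * <;> omega
      have hTr : (T r : ℝ) = 3 * X - 1 := by
        have : T r + 1 = 3 * X := by omega
        have : (T r : ℝ) + 1 = 3 * X := by exact_mod_cast this
        linarith
      have hcp : (r.count 0 : ℝ) ≤ p := by
        have : r.count 0 ≤ p := by omega
        exact_mod_cast this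
      have hc0' : (0:ℝ) ≤ r.count 0 := Nat.cast_nonneg _
      have hT0 : T (0 :: r) = 3 * X := by simp; omega
      have hu := string_le hC (K := m + ε / 2) hT0 (by omega) (fun e l h1 h2 => by
        have := abs_le.1 (hnext e l h1 h2); linarith)
      have hKε : ((p:ℝ) + 4) * (m + ε) * 2 < K * ε := by rwa [div_lt_iff₀ hε] at hK
      have hp0 : (0:ℝ) ≤ p := Nat.cast_nonneg _
      have hup : (C (0 :: r) : ℝ) ≤ m + ε := by
        have : 3 * ((X:ℝ) - 1) * C (0 :: r) ≤ 3 * ((X:ℝ) - 1) * (m + ε) := by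
          rw [hTr] at hu
          refine hu.trans ?_
          nlinarith
        exact le_of_mul_le_mul_left this (by linarith)
      have hlo : m - ε ≤ (C (0 :: r) : ℝ) := by
        by_cases hneg : m - ε / 2 < 0
        · have : (0:ℝ) ≤ C (0 :: r) := by exact_mod_cast C_nn' hC (by simp)
          linarith
        · rw [not_lt] at hneg
          have hl := string_ge hC (K := m - ε / 2) hT0 (by omega) (fun e l h1 h2 => by
            have := abs_le.1 (hnext e l h1 h2); linarith)
          have : 3 * ((X:ℝ) - 1) * (m - ε) ≤ 3 * ((X:ℝ) - 1) * C (0 :: r) := by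
            rw [hTr] at hl
            refine le_trans ?_ hl
            nlinarith
          exact le_of_mul_le_mul_left this (by linarith)
      rw [abs_le]; constructor <;> linarith
    rcases Nat.eq_or_lt_of_le (show 1 ≤ d from hd) with hd1 | hd2
    · subst hd1
      have hr : r ≠ [] := by
        rcases hr with h | h
        · exact h
        · omega
      rw [dilaton hC hr]
      refine (hY (X - 1) r (by omega) hr (by omega) ?_).trans (by linarith)
      unfold zo at *
      rw [List.count_cons_self, List.count_cons_of_ne (by omega)] at hz
      omega
    · refine (hY X _ (by omega) (by simp) (by simp; omega) ?_).trans (by linarith)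
      unfold zo
      have h0 : (d :: r).count 0 = 0 := by
        rw [List.count_eq_zero]
        intro h
        rcases List.mem_cons.1 h with h | h
        · omega
        · have := hmin _ h; omega
      have h1 : (d :: r).count 1 = 0 := by
        rw [List.count_eq_zero]
        intro h
        rcases List.mem_cons.1 h with h | h
        · omega
        · have := hmin _ h; omega
      omega

lemma zo_pick (l : List ℕ) :
    (zo l : ℝ) = pickSum (fun d _ => if d = 0 then 2 else if d = 1 then 1 else 0) l := by
  rw [pickSum_weight (fun d => if d = 0 then (2:ℝ) else if d = 1 then 1 else 0)]
  induction l with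
  | nil => simp [zo]
  | cons a l ih =>
    rw [List.map_cons, List.sum_cons, ← ih]
    unfold zo
    rw [List.count_cons, List.count_cons]
    simp only [beq_iff_eq]
    split_ifs <;> first | omega | (push_cast; ring)

lemma W_zo {N : ℕ} (hN : 4 ≤ N) : W N (fun l => (zo l : ℝ)) ≤ 10 := by
  rw [W_congr (fun l _ => zo_pick l)]
  rw [mecke]
  obtain ⟨k, hk⟩ : ∃ k, (N + 1) / 2 = k + 2 := ⟨(N + 1) / 2 - 2, by omega⟩
  rw [hk, Finset.sum_range_succ', Finset.sum_range_succ']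
  have hc : ∀ (M : ℕ) (c : ℝ), 0 < M → W M (fun _ => c) = 2 * c := by
    intro M c hM
    have := W_mul M c (fun _ => 1)
    rw [W_one hM] at this
    simp only [mul_one] at this
    linarith
  have h0 : ∀ M, W M (fun _ => (0:ℝ)) = 0 := by
    intro M
    have := W_mul M 0 (fun _ => 1)
    simpa using this
  have hz : ∑ d ∈ Finset.range k, 2 / (2 * ((d + 1 + 1 : ℕ) : ℝ) + 1) * W (N - 2 * (d + 1 + 1) - 1)
      (fun _ => if d + 1 + 1 = 0 then (2:ℝ) else if d + 1 + 1 = 1 then 1 else 0) = 0 := by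
    refine Finset.sum_eq_zero fun d _ => ?_
    rw [if_neg (by omega), if_neg (by omega), h0, mul_zero]
  rw [hz]
  simp only [Nat.zero_add, if_true]
  rw [if_neg (by norm_num : ¬ (1 = 0)), hc _ _ (by omega), hc _ _ (by omega)]
  norm_num

/-- the limit is `1/π` -/
theorem unif_pi (hC : IsNormalizedWitten C) : ∀ ε : ℝ, 0 < ε → ∃ Y : ℕ, ∀ X s, Y ≤ X →
    ZC X s → |(C s : ℝ) - 1 / Real.pi| ≤ ε := by
  obtain ⟨m, hm0, hm⟩ := unifZ hC
  have key : Filter.Tendsto (fun X : ℕ => wA C (3 * X)) Filter.atTop (nhds (2 * m)) := by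
    rw [Metric.tendsto_atTop]
    intro ε hε
    obtain ⟨P, hP⟩ := exists_nat_gt (10 * (3 + m) / (ε / 4))
    have hP0 : (0:ℝ) < P := lt_of_le_of_lt (by positivity) hP
    obtain ⟨Y, hY⟩ := unif_ext hC hm0 hm P (ε / 4) (by linarith)
    refine ⟨Y + 2, fun X hX => ?_⟩
    have hb : ∀ l, T l = 3 * X → |(C l : ℝ) - m| ≤ ε / 4 * 1 + (3 + m) / P * zo l := by
      intro l hl
      have hl0 : l ≠ [] := by
        rintro rfl
        simp at hl
        omega
      have hzn : (0:ℝ) ≤ (3 + m) / P := by positivity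
      by_cases hz : zo l ≤ P
      · have := hY X l (by omega) hl0 hl hz
        have : (0:ℝ) ≤ (3 + m) / P * zo l := mul_nonneg hzn (Nat.cast_nonneg _)
        linarith
      · have h1 : (P:ℝ) ≤ zo l := by
          have : P ≤ zo l := by omega
          exact_mod_cast this
        have h2 := C_le hC hl0
        have h3 : (0:ℝ) ≤ C l := by exact_mod_cast C_nn' hC hl0
        have h4 : (3 + m) / P * P ≤ (3 + m) / P * zo l := mul_le_mul_of_nonneg_left h1 hzn
        rw [div_mul_cancel₀ _ hP0.ne'] at h4
        rw [abs_le]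
        constructor <;> linarith
    have hu : wA C (3 * X) ≤ W (3 * X) (fun l => (m + ε / 4) * 1 + (3 + m) / P * zo l) :=
      W_mono fun l hl => by have := (abs_le.1 (hb l hl)).2; linarith
    have hl : W (3 * X) (fun l => (m - ε / 4) * 1 + (-((3 + m) / P)) * zo l) ≤ wA C (3 * X) :=
      W_mono fun l hl => by have := (abs_le.1 (hb l hl)).1; linarith
    rw [W_add, W_mul, W_mul, W_one (by omega)] at hu hl
    have hz := W_zo (N := 3 * X) (by omega)
    have hzm : (3 + m) / P * W (3 * X) (fun l => (zo l : ℝ)) ≤ (3 + m) / P * 10 :=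
      mul_le_mul_of_nonneg_left hz (by positivity)
    have hlast : (3 + m) / P * 10 < ε / 4 := by
      rw [div_lt_iff₀ (by linarith)] at hP
      rw [div_mul_eq_mul_div, div_lt_iff₀ hP0]
      linarith
    rw [Real.dist_eq, abs_lt]
    constructor <;> linarith
  have heq := tendsto_nhds_unique key (A_tendsto hC)
  have : m = 1 / Real.pi := by
    have h2 : 2 * m = 2 * (1 / Real.pi) := by rw [heq]; ring
    linarith
  rw [← this]
  exact hm

/-- the tuple `(0^k, 2^n)` -/
def zt (k n : ℕ) : List ℕ := List.replicate k 0 ++ List.replicate n 2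

lemma zt_T (k n : ℕ) : T (zt k n) = k + 5 * n := by
  unfold zt T; simp; ring

lemma zt_rec (hC : IsNormalizedWitten C) {g : ℕ} (hg : 2 ≤ g) (k : ℕ) :
    (15 * (g:ℝ) - 12 + 6 * k) * C (zt (k + 1) (3 * g - 3 + (k + 1)))
      = (15 * (g:ℝ) - 10 + 5 * k) * C (zt k (3 * g - 3 + k)) := by
  obtain ⟨n, hn⟩ : ∃ n, n = 3 * g - 3 + k := ⟨_, rfl⟩
  have hz : zt (k + 1) (3 * g - 3 + (k + 1)) = 0 :: zt k (n + 1) := by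
    rw [← add_assoc, ← hn]
    simp [zt, List.replicate_succ]
  rw [hz, ← hn]
  have hT : T (0 :: zt k (n + 1)) = 3 * (5 * g - 3 + 2 * k) := by
    rw [T_cons, zt_T]; omega
  have hpp : (2 :: zt k n).Perm (zt k (n + 1)) := by
    unfold zt
    rw [List.replicate_succ]
    exact List.perm_middle.symm
  have hval : ∀ d l, (d :: l).Perm (zt k (n + 1)) → 1 ≤ d → (C ((d - 1) :: l) : ℝ) = C (zt k n) := by
    intro d l hp hd
    have hmem : d ∈ zt k (n + 1) := hp.subset List.mem_cons_self
    have hd2 : d = 2 := by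
      unfold zt at hmem
      simp at hmem
      omega
    subst hd2
    have hl : l.Perm (zt k n) := (hp.trans hpp.symm).cons_inv
    have hne : l ≠ [] := by
      rintro rfl
      have := hl.length_eq
      simp [zt] at this
      omega
    rw [show 2 - 1 = 1 from rfl, dilaton hC hne]
    exact C_perm hC hl
  have h1 := string_le hC (K := C (zt k n)) hT (by omega) (fun d l a b => (hval d l a b).le)
  have h2 := string_ge hC (K := C (zt k n)) hT (by omega) (fun d l a b => (hval d l a b).ge)
  have h3 := le_antisymm h1 h2
  have hcount : (zt k (n + 1)).count 0 = k := by
    unfold zt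
    rw [List.count_append, List.count_replicate_self, List.count_replicate]
    simp
  rw [hcount, zt_T] at h3
  have e1 : ((5 * g - 3 + 2 * k : ℕ) : ℝ) = 5 * g - 3 + 2 * k := by
    have : 5 * g - 3 + 2 * k + 3 = 5 * g + 2 * k := by omega
    have : ((5 * g - 3 + 2 * k : ℕ) : ℝ) + 3 = 5 * g + 2 * k := by exact_mod_cast this
    linarith
  have e2 : (n:ℝ) = 3 * g - 3 + k := by
    have : n + 3 = 3 * g + k := by omega
    have : (n:ℝ) + 3 = 3 * g + k := by exact_mod_cast this
    linarith
  rw [e1] at h3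
  push_cast at h3
  rw [e2] at h3
  linarith

lemma ratA {g j b : ℝ} (hg : 2 ≤ g) (hj : 0 ≤ j) (hb : 0 ≤ b) (h2 : j ^ 2 ≤ b * g) :
    (2 * j + 1) / (30 * g) + (2 - j) / (15 * g - 12 + 6 * j) ≤ (1 + b) / g := by
  have hD : 0 < 15 * g - 12 + 6 * j := by linarith
  rw [div_add_div _ _ (by linarith) hD.ne', div_le_div_iff₀ (by positivity) (by linarith)]
  have : (2 * j + 1) * (15 * g - 12 + 6 * j) + 30 * g * (2 - j) ≤ 30 * (1 + b) * (15 * g - 12 + 6 * j) := by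
    nlinarith [mul_nonneg hb hj, mul_nonneg hb (by linarith : 0 ≤ g - 2)]
  nlinarith

lemma ratB {g j b : ℝ} (hg : 2 ≤ g) (hj : 0 ≤ j) (hb : 0 ≤ b) (h2 : j ^ 2 ≤ b * g) (_hjj : j ≤ j ^ 2) :
    (j - 2) / (15 * g - 10 + 5 * j) - (2 * j + 1) / (30 * g) ≤ (1 + b) / g := by
  have hD : 0 < 15 * g - 10 + 5 * j := by linarith
  rw [div_sub_div _ _ hD.ne' (by linarith), div_le_div_iff₀ (by positivity) (by linarith)]
  have : (j - 2) * (30 * g) - (15 * g - 10 + 5 * j) * (2 * j + 1) ≤ 30 * (1 + b) * (15 * g - 10 + 5 * j) := by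
    nlinarith [mul_nonneg hb hj, mul_nonneg hb (by linarith : 0 ≤ g - 2)]
  nlinarith

lemma zt_bounds (hC : IsNormalizedWitten C) {g : ℕ} (hg : 2 ≤ g) {b : ℝ} (hb : 0 ≤ b) (k : ℕ)
    (hk : (k:ℝ) ^ 2 ≤ b * g) :
    Real.exp ((k:ℝ) ^ 2 / (30 * g)) * C (zt k (3 * g - 3 + k))
        ≤ Real.exp (k * ((1 + b) / g)) * C (zt 0 (3 * g - 3)) ∧
    Real.exp (-(k * ((1 + b) / g))) * C (zt 0 (3 * g - 3)) ≤
      Real.exp ((k:ℝ) ^ 2 / (30 * g)) * C (zt k (3 * g - 3 + k)) := by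
  have hg' : (2:ℝ) ≤ g := by exact_mod_cast hg
  induction k with
  | zero => simp
  | succ k ih =>
    have hk0 : (0:ℝ) ≤ k := Nat.cast_nonneg _
    push_cast at hk
    have hk2 : (k:ℝ) ^ 2 ≤ b * g := by nlinarith
    have hkk : (k:ℝ) ≤ (k:ℝ) ^ 2 := by
      have : k ≤ k ^ 2 := Nat.le_self_pow (by norm_num) k
      exact_mod_cast this
    obtain ⟨i1, i2⟩ := ih hk2
    have hrec := zt_rec hC hg k
    have hnn : (0:ℝ) ≤ C (zt k (3 * g - 3 + k)) := by
      have hne : zt k (3 * g - 3 + k) ≠ [] := by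
        intro h
        have := congrArg List.length h
        simp [zt] at this
        omega
      exact_mod_cast C_nn' hC hne
    have hA := ratA hg' hk0 hb hk2
    have hB := ratB hg' hk0 hb hk2 hkk
    obtain ⟨c, hc⟩ : ∃ c : ℝ, c = C (zt k (3 * g - 3 + k)) := ⟨_, rfl⟩
    obtain ⟨c', hc'⟩ : ∃ c : ℝ, c = C (zt (k + 1) (3 * g - 3 + (k + 1))) := ⟨_, rfl⟩
    obtain ⟨c0, hc0⟩ : ∃ c : ℝ, c = C (zt 0 (3 * g - 3)) := ⟨_, rfl⟩
    rw [← hc, ← hc0] at i1 i2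
    rw [← hc, ← hc'] at hrec
    rw [← hc] at hnn
    rw [← hc', ← hc0]
    have hD1 : (0:ℝ) < 15 * g - 12 + 6 * k := by linarith
    have hD2 : (0:ℝ) < 15 * g - 10 + 5 * k := by linarith
    have hcc : c' = (1 + (2 - k) / (15 * g - 12 + 6 * k)) * c := by
      have : c' = (15 * (g:ℝ) - 10 + 5 * k) * c / (15 * g - 12 + 6 * k) := by
        rw [eq_div_iff hD1.ne']; linarith
      have hne := hD1.ne'
      rw [this, div_eq_iff hne, mul_assoc, mul_comm c, ← mul_assoc, add_mul 1, div_mul_cancel₀ _ hne]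
      ring
    have hcc2 : c = (1 + (k - 2) / (15 * g - 10 + 5 * k)) * c' := by
      have : c = (15 * (g:ℝ) - 12 + 6 * k) * c' / (15 * g - 10 + 5 * k) := by
        rw [eq_div_iff hD2.ne']; linarith
      have hne := hD2.ne'
      rw [this, div_eq_iff hne, mul_assoc, mul_comm c', ← mul_assoc, add_mul 1, div_mul_cancel₀ _ hne]
      ring
    have hc'0 : 0 ≤ c' := by
      have : 0 ≤ (15 * (g:ℝ) - 12 + 6 * k) * c' := by rw [hrec]; positivity
      exact nonneg_of_mul_nonneg_right this hD1
    have esq : ((k + 1 : ℕ):ℝ) ^ 2 / (30 * g) = (2 * (k:ℝ) + 1) / (30 * g) + (k:ℝ) ^ 2 / (30 * g) := by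
      push_cast; ring
    obtain ⟨x, hx⟩ : ∃ x, x = (2 * (k:ℝ) + 1) / (30 * g) := ⟨_, rfl⟩
    obtain ⟨q, hq⟩ : ∃ q, q = (1 + b) / (g:ℝ) := ⟨_, rfl⟩
    rw [esq, Real.exp_add, ← hx, ← hq]
    rw [← hx, ← hq] at hA hB
    rw [← hq] at i1 i2
    have eq1 : ((k + 1 : ℕ):ℝ) * q = q + k * q := by push_cast; ring
    rw [eq1, neg_add, Real.exp_add, Real.exp_add]
    have u1 : Real.exp x * c' ≤ Real.exp q * c := by
      rw [hcc, ← mul_assoc]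
      apply mul_le_mul_of_nonneg_right _ hnn
      calc Real.exp x * (1 + (2 - k) / (15 * g - 12 + 6 * k))
          ≤ Real.exp x * Real.exp ((2 - k) / (15 * g - 12 + 6 * k)) := by
            apply mul_le_mul_of_nonneg_left _ (Real.exp_pos _).le
            have := Real.add_one_le_exp ((2 - (k:ℝ)) / (15 * g - 12 + 6 * k))
            linarith
        _ = Real.exp (x + (2 - k) / (15 * g - 12 + 6 * k)) := (Real.exp_add _ _).symm
        _ ≤ _ := Real.exp_le_exp.2 hA
    have u2 : Real.exp (-q) * c ≤ Real.exp x * c' := by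
      have e : c ≤ Real.exp (x + q) * c' := by
        rw [hcc2]
        apply mul_le_mul_of_nonneg_right _ hc'0
        have := Real.add_one_le_exp (((k:ℝ) - 2) / (15 * g - 10 + 5 * k))
        have h9 : Real.exp (((k:ℝ) - 2) / (15 * g - 10 + 5 * k)) ≤ Real.exp (x + q) :=
          Real.exp_le_exp.2 (by linarith)
        linarith
      have := mul_le_mul_of_nonneg_left e (Real.exp_pos (-q)).le
      refine this.trans (le_of_eq ?_)
      rw [← mul_assoc, ← Real.exp_add]
      congr 2; ring
    obtain ⟨y, hy⟩ : ∃ y, y = Real.exp ((k:ℝ) ^ 2 / (30 * g)) := ⟨_, rfl⟩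
    have hy0 : 0 ≤ y := by rw [hy]; positivity
    rw [← hy] at i1 i2 ⊢
    constructor
    · have a1 := mul_le_mul_of_nonneg_left u1 hy0
      have a2 := mul_le_mul_of_nonneg_left i1 (Real.exp_pos q).le
      linarith
    · have a1 := mul_le_mul_of_nonneg_left u2 hy0
      have a2 := mul_le_mul_of_nonneg_left i2 (Real.exp_pos (-q)).le
      linarith

lemma final_num {ε a t y : ℝ} (hε : 0 < ε) (hε1 : ε ≤ 1) (ha : |a - 1| ≤ ε / 4) (ht0 : 0 ≤ t) (ht : t ≤ ε / 4)
    (h1 : y ≤ Real.exp t * a) (h2 : Real.exp (-t) * a ≤ y) : |y - 1| ≤ ε := by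
  obtain ⟨a1, a2⟩ := abs_le.1 ha
  have e1 := (abs_le.1 (Real.abs_exp_sub_one_le (x := t) (by rw [abs_of_nonneg ht0]; linarith))).2
  rw [abs_of_nonneg ht0] at e1
  have e2 := Real.add_one_le_exp (-t)
  rw [abs_le]
  constructor <;> nlinarith

theorem main_aux (C : List ℕ → ℚ) (hC : IsNormalizedWitten C)
    (B : ℝ) (hB : 0 < B) (ε : ℝ) (hε : 0 < ε) (hε1 : ε ≤ 1) :
    ∃ G : ℕ, ∀ g : ℕ, G ≤ g → ∀ k : ℕ, (k : ℝ) ≤ B * Real.sqrt g →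
      |Real.pi * Real.exp ((k : ℝ) ^ 2 / (30 * (g : ℝ))) *
          (C (List.replicate k 0 ++ List.replicate (3 * g - 3 + k) 2) : ℝ) - 1| ≤ ε := by
  have hπ := Real.pi_pos
  obtain ⟨Y, hY⟩ := unif_pi hC (ε / 4 / Real.pi) (by positivity)
  obtain ⟨K, hK⟩ := exists_nat_gt ((4 * B * (1 + B ^ 2) / ε) ^ 2)
  refine ⟨Y + K + 2, fun g hg k hk => ?_⟩
  have hgK : (K:ℝ) ≤ g := by
    have : K ≤ g := by omega
    exact_mod_cast this
  have hg2 : (2:ℝ) ≤ g := by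
    have : 2 ≤ g := by omega
    exact_mod_cast this
  have hk0 : (0:ℝ) ≤ k := Nat.cast_nonneg _
  have hs0 := Real.sqrt_nonneg (g:ℝ)
  have hss := Real.sq_sqrt (by linarith : (0:ℝ) ≤ g)
  have hksq : (k:ℝ) ^ 2 ≤ B ^ 2 * g := by
    have := pow_le_pow_left₀ hk0 hk 2
    rw [mul_pow, hss] at this
    exact this
  obtain ⟨b1, b2⟩ := zt_bounds hC (by omega : 2 ≤ g) (sq_nonneg B) k hksq
  have hlarge : 4 * B * (1 + B ^ 2) / ε ≤ Real.sqrt g := by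
    apply Real.le_sqrt_of_sq_le
    linarith
  have hz := hY (5 * g - 5) (zt 0 (3 * g - 3)) (by omega) ⟨by
      intro h
      have := congrArg List.length h
      simp [zt] at this
      omega, by simp [zt]; omega, by rw [zt_T]; omega, by
      intro e he
      simp [zt] at he
      omega⟩
  refine final_num (a := Real.pi * C (zt 0 (3 * g - 3))) (t := k * ((1 + B ^ 2) / g)) hε hε1 ?_ (by positivity) ?_ ?_ ?_
  · have : Real.pi * (C (zt 0 (3 * g - 3)) : ℝ) - 1 = Real.pi * ((C (zt 0 (3 * g - 3)) : ℝ) - 1 / Real.pi) := by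
      field_simp
    rw [this, abs_mul, abs_of_pos hπ]
    calc _ ≤ Real.pi * (ε / 4 / Real.pi) := mul_le_mul_of_nonneg_left hz hπ.le
      _ = ε / 4 := by field_simp
  · rw [← mul_div_assoc, div_le_iff₀ (by linarith)]
    rw [div_le_iff₀ hε] at hlarge
    have p : 0 < 1 + B ^ 2 := by positivity
    have q1 : (k:ℝ) * (1 + B ^ 2) ≤ B * Real.sqrt g * (1 + B ^ 2) := mul_le_mul_of_nonneg_right hk p.le
    have q2 := mul_le_mul_of_nonneg_right hlarge hs0
    have q3 : Real.sqrt g * ε * Real.sqrt g = ε * g := by linear_combination ε * hss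
    linarith
  · have := mul_le_mul_of_nonneg_left b1 hπ.le
    unfold zt at *
    linarith
  · have := mul_le_mul_of_nonneg_left b2 hπ.le
    unfold zt at *
    linarith

end Lemmas

/-- Uniformly for `k = O(√g)`, `C(0^k, 2^{3g−3+k}) ∼ (1/π) e^{−k²/(30g)}` as
`g → ∞`: for every `B > 0`, the maximum over `0 ≤ k ≤ B√g` of
`|π e^{k²/(30g)} C(0^k,2^{3g−3+k}) − 1|` tends to `0` as `g → ∞`. -/
theorem uniform_asymptotics_zeros_twos (C : List ℕ → ℚ) (hC : IsNormalizedWitten C)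
    (B : ℝ) (hB : 0 < B) :
    ∀ ε : ℝ, 0 < ε → ∃ G : ℕ, ∀ g : ℕ, G ≤ g → ∀ k : ℕ, (k : ℝ) ≤ B * Real.sqrt g →
      |Real.pi * Real.exp ((k : ℝ) ^ 2 / (30 * (g : ℝ))) *
          (C (List.replicate k 0 ++ List.replicate (3 * g - 3 + k) 2) : ℝ) - 1| ≤ ε := by
  intro ε hε
  obtain ⟨G, hG⟩ := main_aux C hC B hB (min ε 1) (lt_min hε one_pos) (min_le_right _ _)
  exact ⟨G, fun g hg k hk => (hG g hg k hk).trans (min_le_left _ _)⟩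

end WittenAsym
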